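/- For all integers k ≥ 3 and n ≥ 2, the fundamental group of the unordered configuration space C_{k+1}^{1,n} (at any basepoint) is isomorphic to the group presented by generators σ_1,…,σ_k subject to the Artin relations among σ_1,…,σ_k, the relation σ_1σ_2⋯σ_{k-1}σ_k²σ_{k-1}⋯σ_2σ_1 = 1, and the relation Δ_k² = 1, where Δ_k = σ_1(σ_2σ_1)(σ_3σ_2σ_1)⋯(σ_{k-1}⋯σ_2σ_1). -/

import Mathlib

noncomputable section

open Module Submodule

/-- Topology on the projectivization (quotient topology). -/
instance (K V : Type*) [DivisionRing K] [AddCommGroup V] [Module K V] [TopologicalSpace V] :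
    TopologicalSpace (Projectivization K V) :=
  inferInstanceAs (TopologicalSpace (Quotient (projectivizationSetoid K V)))

/-- The complex projective space `ℂP^n`. -/
abbrev CP (n : ℕ) := Projectivization ℂ (Fin (n + 1) → ℂ)

/-- `Fconf k i n` is the ordered configuration space `F_k^{i,n}` of `k` pairwise distinct
points of `ℂP^n` whose projective span has dimension `i` (i.e. the span of representative
vectors has linear dimension `i + 1`). -/
def Fconf (k i n : ℕ) : Set (Fin k → CP n) :=
  {x | Function.Injective x ∧
    finrank ℂ (span ℂ (Set.range fun j => (x j).rep)) = i + 1}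

/-- The equivalence relation on `F_k^{i,n}` identifying tuples differing by a
permutation of the coordinates. -/
def permSetoid (k i n : ℕ) : Setoid (Fconf k i n) where
  r x y := ∃ σ : Equiv.Perm (Fin k), (y : Fin k → CP n) = (x : Fin k → CP n) ∘ σ
  iseqv := by
    constructor
    · intro x; exact ⟨Equiv.refl _, rfl⟩
    · rintro x y ⟨σ, h⟩
      refine ⟨σ.symm, ?_⟩
      funext i
      simp [h]
    · rintro x y z ⟨σ, h⟩ ⟨τ, h'⟩
      exact ⟨τ.trans σ, by rw [h', h]; rfl⟩

/-- `Cconf k i n` is the unordered configuration space `C_k^{i,n} = F_k^{i,n}/Σ_k`. -/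
def Cconf (k i n : ℕ) : Type := Quotient (permSetoid k i n)

instance (k i n : ℕ) : TopologicalSpace (Cconf k i n) :=
  inferInstanceAs (TopologicalSpace (Quotient (permSetoid k i n)))
/-- The free-group generator `σ_{i+1}` (0-indexed: `σ_i` for `i < k`); junk value `1`
out of range. -/
def br (k i : ℕ) : FreeGroup (Fin k) := if h : i < k then FreeGroup.of ⟨i, h⟩ else 1

/-- The Artin relators among `σ_1, …, σ_k`: `σᵢσⱼ = σⱼσᵢ` for `|i - j| ≥ 2` and
`σᵢσᵢ₊₁σᵢ = σᵢ₊₁σᵢσᵢ₊₁`. -/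
def ArtinRels (k : ℕ) : Set (FreeGroup (Fin k)) :=
  {r | (∃ i j : ℕ, i + 2 ≤ j ∧ j < k ∧ r = br k i * br k j * (br k j * br k i)⁻¹) ∨
       (∃ i : ℕ, i + 1 < k ∧
         r = br k i * br k (i + 1) * br k i * (br k (i + 1) * br k i * br k (i + 1))⁻¹)}

/-- The word `σ_1 σ_2 ⋯ σ_{k-1} σ_k² σ_{k-1} ⋯ σ_2 σ_1` (0-indexed). -/
def sphereWord (k : ℕ) : FreeGroup (Fin k) :=
  ((List.range k).map (br k)).prod * ((List.range k).reverse.map (br k)).prod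

/-- The Garside word `Δ_k = σ_1(σ_2σ_1)(σ_3σ_2σ_1)⋯(σ_{k-1}⋯σ_2σ_1)` (0-indexed). -/
def DeltaWord (k : ℕ) : FreeGroup (Fin k) :=
  ((List.range k).map fun m => ((List.range m).reverse.map (br k)).prod).prod

section Auxiliary

open Topology unitInterval Set Filter

section Paths

variable {X : Type*} [TopologicalSpace X]

/-- Induction principle for paths: a property which is invariant under homotopy, closed under
concatenation and true for all sufficiently small paths holds for all paths. -/
theorem path_induction {P : ∀ {a b : X}, Path a b → Prop}
    (htrans : ∀ {a b c : X} (p : Path a b) (q : Path b c), P p → P q → P (p.trans q))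
    (hhom : ∀ {a b : X} (p q : Path a b), p.Homotopic q → P p → P q)
    (U : X → Set X) (hU : ∀ x, U x ∈ 𝓝 x)
    (hloc : ∀ (x : X) {a b : X} (p : Path a b), range p ⊆ U x → P p)
    {a b : X} (p : Path a b) : P p := by
  obtain ⟨t, ht0, htm, ⟨n, hn⟩, ht⟩ := exists_monotone_Icc_subset_open_cover_unitInterval
    (c := fun x => p ⁻¹' interior (U x)) (fun x => isOpen_interior.preimage p.continuous)
    (fun s _ => mem_iUnion.2 ⟨p s, mem_interior_iff_mem_nhds.2 (hU _)⟩)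
  have key : ∀ m, P (p.subpath 0 (t m)) := by
    intro m
    induction m with
    | zero =>
      rw [ht0, Path.subpath_self]
      refine hloc (p 0) _ ?_
      rintro _ ⟨s, rfl⟩
      exact mem_of_mem_nhds (hU _)
    | succ m ih =>
      refine hhom _ _ ⟨Path.Homotopy.subpathTransSubpath p 0 (t m) (t (m + 1))⟩
        (htrans _ _ ih ?_)
      obtain ⟨x, hx⟩ := ht m
      refine hloc x _ ?_
      rw [Path.range_subpath_of_le _ _ _ (htm (Nat.le_succ m))]
      rintro _ ⟨s, hs, rfl⟩
      exact interior_subset (hx hs)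
  have h1 := key n
  rw [hn n le_rfl, Path.subpath_zero_one] at h1
  have cast_elim : ∀ {a' b' : X} (q : Path a b) (h : a' = a) (h' : b' = b),
      P (q.cast h h') → P q := by
    rintro a' b' q rfl rfl h
    exact h
  exact cast_elim _ _ _ h1

/-- A homotopy invariant, multiplicative function on paths, i.e. a functor from the fundamental
groupoid to a group. -/
structure PathHom (X : Type*) [TopologicalSpace X] (G : Type*) [Group G] where
  /-- The value on a path. -/
  val : ∀ {a b : X}, Path a b → G
  val_trans : ∀ {a b c : X} (p : Path a b) (q : Path b c), val (p.trans q) = val p * val q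
  val_homotopic : ∀ {a b : X} {p q : Path a b}, p.Homotopic q → val p = val q

namespace PathHom

variable {G : Type*} [Group G] (W : PathHom X G)

theorem val_refl (a : X) : W.val (Path.refl a) = 1 := by
  have h := W.val_trans (Path.refl a) (Path.refl a)
  rw [Path.refl_trans_refl] at h
  exact (left_eq_mul.1 h)

theorem val_symm {a b : X} (p : Path a b) : W.val p.symm = (W.val p)⁻¹ := by
  have h := W.val_homotopic (⟨Path.Homotopy.reflTransSymm p⟩ :
    (Path.refl a).Homotopic (p.trans p.symm))
  rw [val_refl, W.val_trans] at h
  exact eq_inv_of_mul_eq_one_right h.symm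

theorem val_cast {a b a' b' : X} (p : Path a b) (h : a' = a) (h' : b' = b) :
    W.val (p.cast h h') = W.val p := by
  subst h h'; rfl

/-- Path homs which agree on sufficiently small paths agree. -/
theorem ext_of_local {W W' : PathHom X G} (U : X → Set X) (hU : ∀ x, U x ∈ 𝓝 x)
    (h : ∀ (x : X) {a b : X} (p : Path a b), range p ⊆ U x → W.val p = W'.val p)
    {a b : X} (p : Path a b) : W.val p = W'.val p := by
  induction p using path_induction with
  | htrans p q hp hq => rw [W.val_trans, W'.val_trans, hp, hq]
  | hhom p q hpq hp => rw [← W.val_homotopic hpq, ← W'.val_homotopic hpq, hp]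
  | U => exact U ‹_›
  | hU => exact hU _
  | hloc x p hp => exact h x p hp

end PathHom

/-- The data of a locally multiplicative `G`-valued function defines a principal covering. -/
def cocycleCore {G : Type*} [Group G] [TopologicalSpace G] [DiscreteTopology G]
    (c : X → X → G) (U : X → Set X) (hUo : ∀ x, IsOpen (U x)) (hU : ∀ x, x ∈ U x)
    (hc : ∀ x, ∀ y ∈ U x, ∀ᶠ z in 𝓝 y, c x z = c x y * c y z) :
    FiberBundleCore X X G where
  baseSet := U
  isOpen_baseSet := hUo
  indexAt := id
  mem_baseSet_at := hU
  coordChange i j z g := g * c i z * (c j z)⁻¹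
  coordChange_self i x _ v := by simp
  coordChange_comp i j k x _ v := by simp [mul_assoc]
  continuousOn_coordChange i j := by
    rintro ⟨y, g⟩ ⟨⟨hyi, hyj⟩, -⟩
    apply ContinuousAt.continuousWithinAt
    have : (fun p : X × G => p.2 * c i p.1 * (c j p.1)⁻¹) =ᶠ[𝓝 (y, g)]
        fun p => p.2 * (c i y * (c j y)⁻¹) := by
      have h1 := (continuous_fst (X := X) (Y := G)).continuousAt.eventually
        (show ∀ᶠ z in 𝓝 (y, g).1, _ from (hc i y hyi).and (hc j y hyj))
      filter_upwards [h1] with p hp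
      rw [hp.1, hp.2]
      group
    refine ContinuousAt.congr ?_ this.symm
    exact (continuous_of_discreteTopology
      (f := fun g : G => g * (c i y * (c j y)⁻¹))).continuousAt.comp
      continuous_snd.continuousAt

theorem exists_pathHom_of_cocycle {G : Type*} [Group G]
    (c : X → X → G) (U : X → Set X) (hUo : ∀ x, IsOpen (U x)) (hU : ∀ x, x ∈ U x)
    (hc : ∀ x, ∀ y ∈ U x, ∀ᶠ z in 𝓝 y, c x z = c x y * c y z) :
    ∃ W : PathHom X G, ∀ (x : X) {y z : X} (p : Path y z), range p ⊆ U x →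
      W.val p = (c x y)⁻¹ * c x z := by
  let _ : TopologicalSpace G := ⊥
  have : DiscreteTopology G := ⟨rfl⟩
  have hcc : ∀ x, c x x = 1 := fun x => by
    have := (hc x x (hU x)).self_of_nhds
    exact (left_eq_mul.1 this)
  let Z := cocycleCore c U hUo hU hc
  have cov : IsCoveringMap Z.proj := IsCoveringMap.mk _ (fun _ => G)
    (fun x => Z.localTriv x) (fun x => hU x)
  -- a lift of `p` starting at height `g` and ending at height `h`
  let L : ∀ {a b : X}, Path a b → G → G → Prop := fun {a b} p g h =>
    ∃ Γ : Path (⟨a, g⟩ : Z.TotalSpace) ⟨b, h⟩, ∀ t, Z.proj (Γ t) = p t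
  have hloc : ∀ (x : X) {a b : X} (p : Path a b), range p ⊆ U x →
      ∀ g, L p g (g * ((c x a)⁻¹ * c x b)) := by
    intro x a b p hp g
    have hcont : Continuous fun t => (Z.localTriv x).toOpenPartialHomeomorph.symm
        (p t, g * (c x a)⁻¹) := by
      refine (Z.localTriv x).toOpenPartialHomeomorph.continuousOn_symm.comp_continuous
        (by fun_prop) fun t => ?_
      rw [(Z.localTriv x).mem_target]
      exact hp ⟨t, rfl⟩
    have hval : ∀ t, (Z.localTriv x).toOpenPartialHomeomorph.symm (p t, g * (c x a)⁻¹) =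
        (⟨p t, g * (c x a)⁻¹ * c x (p t)⟩ : Z.TotalSpace) := by
      intro t
      have : Z.coordChange x (p t) (p t) (g * (c x a)⁻¹) = g * (c x a)⁻¹ * c x (p t) := by
        change g * (c x a)⁻¹ * c x (p t) * (c (p t) (p t))⁻¹ = _
        rw [hcc]; simp
      rw [← this]
      rfl
    refine ⟨⟨⟨_, hcont⟩, ?_, ?_⟩, fun t => ?_⟩
    · refine (hval 0).trans ?_
      rw [p.source, inv_mul_cancel_right]
    · refine (hval 1).trans ?_
      rw [p.target, mul_assoc]
    · change Z.proj ((Z.localTriv x).toOpenPartialHomeomorph.symm (p t, g * (c x a)⁻¹)) = _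
      rw [hval]
  have huniq : ∀ {a b : X} (p q : Path a b) (g h h' : G), p.Homotopic q → L p g h → L q g h' →
      h = h' := by
    rintro a b p q g h h' hpq ⟨Γ, hΓ⟩ ⟨Γ', hΓ'⟩
    have e1 : Γ.toContinuousMap = cov.liftPath p.toContinuousMap ⟨a, g⟩ (by simp) := by
      rw [cov.eq_liftPath_iff']
      exact ⟨funext hΓ, Γ.source⟩
    have e2 : Γ'.toContinuousMap = cov.liftPath q.toContinuousMap ⟨a, g⟩ (by simp) := by
      rw [cov.eq_liftPath_iff']
      exact ⟨funext hΓ', Γ'.source⟩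
    have := cov.liftPath_apply_one_eq_of_homotopicRel (γ₀ := p.toContinuousMap)
      (γ₁ := q.toContinuousMap) hpq ⟨a, g⟩ (by simp) (by simp)
    rw [← e1, ← e2] at this
    have h3 : (⟨b, h⟩ : Z.TotalSpace) = ⟨b, h'⟩ := by
      rw [← Γ.target, ← Γ'.target]; exact this
    exact eq_of_heq (Bundle.TotalSpace.mk.inj h3).2
  have hex1 : ∀ {a b : X} (p : Path a b) (g : G), ∃ h, L p g h := by
    intro a b p g
    have hl := cov.liftPath_lifts p.toContinuousMap (⟨a, g⟩ : Z.TotalSpace) (by simp)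
    have h1 : Z.proj (cov.liftPath p.toContinuousMap (⟨a, g⟩ : Z.TotalSpace) (by simp) 1) = b := by
      have := congr_fun hl 1
      simpa using this
    obtain ⟨h, hh⟩ : ∃ h : G, cov.liftPath p.toContinuousMap (⟨a, g⟩ : Z.TotalSpace) (by simp) 1
        = ⟨b, h⟩ := by
      generalize cov.liftPath p.toContinuousMap (⟨a, g⟩ : Z.TotalSpace) (by simp) 1 = e at h1
      obtain ⟨e1, e2⟩ := e
      cases h1
      exact ⟨e2, rfl⟩
    exact ⟨h, ⟨⟨_, cov.liftPath_zero .., hh⟩, fun t => congr_fun hl t⟩⟩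
  have hex : ∀ {a b : X} (p : Path a b), ∃ ψ, ∀ g, L p g (g * ψ) := by
    intro a b p
    induction p using path_induction with
    | htrans p q hp hq =>
      obtain ⟨ψ, hψ⟩ := hp
      obtain ⟨χ, hχ⟩ := hq
      refine ⟨ψ * χ, fun g => ?_⟩
      obtain ⟨Γ, hΓ⟩ := hψ g
      obtain ⟨Γ', hΓ'⟩ := hχ (g * ψ)
      rw [← mul_assoc]
      refine ⟨Γ.trans Γ', fun t => ?_⟩
      rw [Path.trans_apply, Path.trans_apply]
      split_ifs <;> simp only [hΓ, hΓ']
    | hhom p q hpq hp =>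
      obtain ⟨ψ, hψ⟩ := hp
      refine ⟨ψ, fun g => ?_⟩
      obtain ⟨h, hh⟩ := hex1 q g
      rwa [huniq p q g _ _ hpq (hψ g) hh]
    | U => exact U ‹_›
    | hU => exact (hUo _).mem_nhds (hU _)
    | hloc x p hp => exact ⟨_, hloc x p hp⟩
  choose ψ hψ using @hex
  refine ⟨⟨fun p => ψ p, ?_, ?_⟩, ?_⟩
  · intro a b c p q
    obtain ⟨Γ, hΓ⟩ := hψ p 1
    obtain ⟨Γ', hΓ'⟩ := hψ q (1 * ψ p)
    have h1 : L (p.trans q) 1 (1 * ψ p * ψ q) := by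
      refine ⟨Γ.trans Γ', fun t => ?_⟩
      rw [Path.trans_apply, Path.trans_apply]
      split_ifs <;> simp only [hΓ, hΓ']
    have := huniq _ _ _ _ _ (Path.Homotopic.refl _) (hψ (p.trans q) 1) h1
    simpa using this
  · intro a b p q hpq
    simpa using huniq _ _ _ _ _ hpq (hψ p 1) (hψ q 1)
  · intro x y z p hp
    simpa using huniq _ _ _ _ _ (Path.Homotopic.refl _) (hψ p 1) (hloc x p hp 1)

end Paths

section Paths

variable {X Y : Type*} [TopologicalSpace X] [TopologicalSpace Y]

namespace PathHom

variable {G : Type*} [Group G] (W : PathHom X G)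

theorem val_congr {a b a' b' : X} (p : Path a b) (q : Path a' b') (h : ∀ t, p t = q t) :
    W.val p = W.val q := by
  obtain rfl : a = a' := by rw [← p.source, ← q.source, h]
  obtain rfl : b = b' := by rw [← p.target, ← q.target, h]
  congr 1
  ext t
  exact h t

/-- Pull back along a continuous map. -/
def comap (f : C(Y, X)) : PathHom Y G where
  val p := W.val (p.map f.continuous)
  val_trans p q := by rw [Path.map_trans, W.val_trans]
  val_homotopic h := W.val_homotopic (h.map f)

theorem comap_val (f : C(Y, X)) {a b : Y} (p : Path a b) :
    (W.comap f).val p = W.val (p.map f.continuous) := rfl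

/-- Change of trivialization over the points. -/
def gauge (g : X → G) : PathHom X G where
  val {a b} p := g a * W.val p * (g b)⁻¹
  val_trans p q := by rw [W.val_trans]; group
  val_homotopic h := by rw [W.val_homotopic h]

theorem gauge_val (g : X → G) {a b : X} (p : Path a b) :
    (W.gauge g).val p = g a * W.val p * (g b)⁻¹ := rfl

/-- Push forward along a group homomorphism. -/
def push {H : Type*} [Group H] (φ : G →* H) : PathHom X H where
  val p := φ (W.val p)
  val_trans p q := by rw [W.val_trans, map_mul]
  val_homotopic h := by rw [W.val_homotopic h]

theorem push_val {H : Type*} [Group H] (φ : G →* H) {a b : X} (p : Path a b) :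
    (W.push φ).val p = φ (W.val p) := rfl

end PathHom

theorem exists_universal_pathHom (x₀ : X) :
    ∃ U : PathHom X (FundamentalGroup X x₀)ᵐᵒᵖ,
      (∀ p q : Path x₀ x₀, U.val p = U.val q → p.Homotopic q) ∧
      ∀ γ, ∃ p : Path x₀ x₀, U.val p = γ := by
  classical
  let κ : ∀ {a}, Joined x₀ a → Path x₀ a := fun h => h.somePath
  let toG : Path.Homotopic.Quotient x₀ x₀ → (FundamentalGroup X x₀)ᵐᵒᵖ :=
    fun q => MulOpposite.op q
  have toG_mul : ∀ p q, toG (p.trans q) = toG p * toG q := fun p q => rfl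
  let v : ∀ {a b : X}, Path a b → (FundamentalGroup X x₀)ᵐᵒᵖ := fun {a b} p =>
    if h : Joined x₀ a then toG (Path.Homotopic.Quotient.trans (Path.Homotopic.Quotient.trans
      (.mk (κ h)) (.mk p)) (.symm (.mk (κ (h.trans ⟨p⟩))))) else 1
  refine ⟨⟨v, ?_, ?_⟩, ?_, ?_⟩
  · intro a b c p q
    by_cases h : Joined x₀ a
    · have h' : Joined x₀ b := h.trans ⟨p⟩
      simp only [v, dif_pos h, dif_pos h', ← toG_mul]
      congr 1
      rw [Path.Homotopic.Quotient.mk_trans]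
      simp only [Path.Homotopic.Quotient.trans_assoc]
      congr 2
      rw [← Path.Homotopic.Quotient.trans_assoc (Path.Homotopic.Quotient.symm _)]
      simp
    · have h' : ¬ Joined x₀ b := fun h' => h (h'.trans ⟨p.symm⟩)
      simp only [v, dif_neg h, dif_neg h', mul_one]
  · intro a b p q hpq
    simp only [v, Path.Homotopic.Quotient.eq.2 hpq]
  · intro p q hpq
    have h : Joined x₀ x₀ := Joined.refl _
    simp only [v, dif_pos h] at hpq
    have h2 := MulOpposite.op_injective hpq
    have h3 := congrArg (fun z => Path.Homotopic.Quotient.trans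
      (Path.Homotopic.Quotient.symm (.mk (κ h))) (Path.Homotopic.Quotient.trans z (.mk (κ h)))) h2
    simp only [Path.Homotopic.Quotient.trans_assoc] at h3
    rw [← Path.Homotopic.Quotient.trans_assoc (Path.Homotopic.Quotient.symm _),
      ← Path.Homotopic.Quotient.trans_assoc (Path.Homotopic.Quotient.symm _)] at h3
    simp at h3
    exact Path.Homotopic.Quotient.eq.1 h3
  · intro γ
    have h : Joined x₀ x₀ := Joined.refl _
    obtain ⟨p, hp⟩ := Path.Homotopic.Quotient.mk_surjective (x₀ := x₀) (x₁ := x₀) γ.unop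
    refine ⟨((κ h).symm.trans p).trans (κ h), ?_⟩
    simp only [v, dif_pos h]
    apply MulOpposite.unop_injective
    rw [← hp]
    change (Path.Homotopic.Quotient.trans (Path.Homotopic.Quotient.trans (.mk (κ h)) (.mk _))
      (.symm (.mk (κ h))) : Path.Homotopic.Quotient x₀ x₀) = .mk p
    simp only [Path.Homotopic.Quotient.mk_trans, Path.Homotopic.Quotient.mk_symm,
      Path.Homotopic.Quotient.trans_assoc]
    rw [← Path.Homotopic.Quotient.trans_assoc (.mk (κ h))]
    simp

theorem homotopic_prod_left {a₀ a₁ : X} {b₀ b₁ : Y} (p : Path a₀ a₁) (q : Path b₀ b₁) :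
    (p.prod q).Homotopic ((p.prod (Path.refl b₀)).trans ((Path.refl a₁).prod q)) := by
  rw [Path.trans_prod_eq_prod_trans]
  exact ⟨Path.Homotopic.prodHomotopy (Path.Homotopy.transRefl p).symm
    (Path.Homotopy.reflTrans q).symm⟩

theorem homotopic_prod_right {a₀ a₁ : X} {b₀ b₁ : Y} (p : Path a₀ a₁) (q : Path b₀ b₁) :
    (p.prod q).Homotopic (((Path.refl a₀).prod q).trans (p.prod (Path.refl b₁))) := by
  rw [Path.trans_prod_eq_prod_trans]
  exact ⟨Path.Homotopic.prodHomotopy (Path.Homotopy.reflTrans p).symm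
    (Path.Homotopy.transRefl q).symm⟩

/-- A loop which is freely homotopic to a constant loop is null-homotopic. -/
theorem homotopic_refl_of_free {a : X} (p : Path a a) (H : C(I × I, X))
    (h0 : ∀ t, H (0, t) = p t) (hends : ∀ s, H (s, 0) = H (s, 1))
    (h1 : ∀ t, H (1, t) = H (1, 0)) : p.Homotopic (Path.refl a) := by
  obtain ⟨U, hU, -⟩ := exists_universal_pathHom a
  apply hU
  let i : Path (0 : I) 1 := ⟨⟨id, continuous_id⟩, rfl, rfl⟩
  have e := (U.comap H).val_homotopic ((homotopic_prod_left i i).symm.trans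
    (homotopic_prod_right i i))
  rw [PathHom.val_trans, PathHom.val_trans] at e
  simp only [PathHom.comap_val] at e
  have e1 : U.val (((Path.refl (0 : I)).prod i).map H.continuous) = U.val p :=
    U.val_congr _ _ fun t => h0 t
  have e2 : U.val (((Path.refl (1 : I)).prod i).map H.continuous) =
      U.val (Path.refl (H (1, 0))) := U.val_congr _ _ fun t => h1 t
  have e3 : U.val ((i.prod (Path.refl (0 : I))).map H.continuous) =
      U.val ((i.prod (Path.refl (1 : I))).map H.continuous) :=
    U.val_congr _ _ fun t => hends t
  rw [e1, e2, e3, U.val_refl, mul_one] at e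
  rw [U.val_refl]
  exact (right_eq_mul.1 e)

variable {E : Type*} [AddCommGroup E] [Module ℝ E] [TopologicalSpace E]
  [IsTopologicalAddGroup E] [ContinuousSMul ℝ E]

theorem homotopic_of_convex {F S : Set E} (hS : Convex ℝ S) (hSF : S ⊆ F) {a b : F}
    (p q : Path a b) (hp : ∀ t, (p t : E) ∈ S) (hq : ∀ t, (q t : E) ∈ S) : p.Homotopic q := by
  refine ⟨⟨⟨⟨fun x => ⟨AffineMap.lineMap (p x.2 : E) (q x.2 : E) (x.1 : ℝ),
    hSF (hS.lineMap_mem (hp _) (hq _) x.1.2)⟩, ?_⟩, ?_, ?_⟩, ?_⟩⟩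
  · refine Continuous.subtype_mk ?_ _
    simp only [AffineMap.lineMap_apply_module]
    fun_prop
  · intro t; ext; simp
  · intro t; ext; simp
  · intro s t ht
    rcases ht with rfl | rfl <;> ext <;> simp

/-- The straight path between two points of a subset of a vector space. -/
def segPath {F : Set E} (a b : F) (h : segment ℝ (a : E) b ⊆ F) : Path a b where
  toFun t := ⟨AffineMap.lineMap (a : E) (b : E) (t : ℝ),
    h ((convex_segment (a : E) (b : E)).lineMap_mem (left_mem_segment ℝ (a : E) (b : E))
      (right_mem_segment ℝ (a : E) (b : E)) t.2)⟩
  continuous_toFun := by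
    refine Continuous.subtype_mk ?_ _
    simp only [AffineMap.lineMap_apply_module]
    fun_prop
  source' := by ext; simp
  target' := by ext; simp

theorem segPath_coe {F : Set E} (a b : F) (h : segment ℝ (a : E) b ⊆ F) (t : I) :
    (segPath a b h t : E) = AffineMap.lineMap (a : E) (b : E) (t : ℝ) := rfl

theorem segPath_mem {F S : Set E} (a b : F) (h : segment ℝ (a : E) b ⊆ F) (hS : Convex ℝ S)
    (ha : (a : E) ∈ S) (hb : (b : E) ∈ S) (t : I) : (segPath a b h t : E) ∈ S :=
  hS.lineMap_mem ha hb t.2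

end Paths

section Algebra

variable {G H : Type*} [Group G] [Group H]

/-- The adjacent transposition `(i, i + 1)` of `Fin N` (the identity if out of range). -/
def adj (N i : ℕ) : Equiv.Perm (Fin N) :=
  if h : i + 1 < N then Equiv.swap ⟨i, by omega⟩ ⟨i + 1, h⟩ else 1

theorem adj_val {N i : ℕ} (h : i + 1 < N) (p : Fin N) :
    (adj N i p : ℕ) = if (p : ℕ) = i then i + 1 else if (p : ℕ) = i + 1 then i else p := by
  rw [adj, dif_pos h, Equiv.swap_apply_def]
  simp only [Fin.ext_iff]
  split_ifs <;> rfl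

theorem adj_mul_self (N i : ℕ) : adj N i * adj N i = 1 := by
  unfold adj
  split_ifs
  · exact Equiv.swap_mul_self _ _
  · rfl

theorem mul_adj_mul_adj {N : ℕ} (i : ℕ) (u : Equiv.Perm (Fin N)) :
    u * adj N i * adj N i = u := by rw [mul_assoc, adj_mul_self, mul_one]

/-- The permutation `u` has an ascent at position `i`. -/
def Ascent {N : ℕ} (u : Equiv.Perm (Fin N)) (i : ℕ) : Prop :=
  ∃ h : i + 1 < N, u ⟨i, by omega⟩ < u ⟨i + 1, h⟩

theorem ascent_or {N : ℕ} (u : Equiv.Perm (Fin N)) {i : ℕ} (h : i + 1 < N) :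
    Ascent u i ∨ Ascent (u * adj N i) i := by
  have e1 : adj N i ⟨i, by omega⟩ = ⟨i + 1, h⟩ := by ext; rw [adj_val h]; simp
  have e2 : adj N i ⟨i + 1, h⟩ = ⟨i, by omega⟩ := by ext; rw [adj_val h]; simp
  have hne : u ⟨i, by omega⟩ ≠ u ⟨i + 1, h⟩ := fun e => by simpa using u.injective e
  rcases lt_or_gt_of_ne hne with h1 | h1
  · exact Or.inl ⟨h, h1⟩
  · refine Or.inr ⟨h, ?_⟩
    rwa [Equiv.Perm.mul_apply, Equiv.Perm.mul_apply, e1, e2]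

/-- A size of permutations which increases at ascents. -/
def permSize {N : ℕ} (u : Equiv.Perm (Fin N)) : ℕ := ∑ p : Fin N, (N - p) * (u p : ℕ)

theorem permSize_lt {N i : ℕ} {u : Equiv.Perm (Fin N)} (h : Ascent u i) :
    permSize u < permSize (u * adj N i) := by
  obtain ⟨hi, h⟩ := h
  have e1 : adj N i ⟨i, by omega⟩ = ⟨i + 1, hi⟩ := by ext; rw [adj_val hi]; simp
  have e2 : adj N i ⟨i + 1, hi⟩ = ⟨i, by omega⟩ := by ext; rw [adj_val hi]; simp
  have key : ∀ v : Equiv.Perm (Fin N), permSize v = (N - i) * (v ⟨i, by omega⟩ : ℕ) +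
      ((N - (i + 1)) * (v ⟨i + 1, hi⟩ : ℕ) +
      ∑ p ∈ ((Finset.univ.erase (⟨i, by omega⟩ : Fin N)).erase ⟨i + 1, hi⟩),
        (N - p) * (v p : ℕ)) := by
    intro v
    rw [permSize, ← Finset.add_sum_erase Finset.univ _ (Finset.mem_univ (⟨i, by omega⟩ : Fin N)),
      ← Finset.add_sum_erase (Finset.univ.erase (⟨i, by omega⟩ : Fin N)) _
        (show (⟨i + 1, hi⟩ : Fin N) ∈ _ by simp [Fin.ext_iff])]
  rw [key u, key (u * adj N i), Equiv.Perm.mul_apply, Equiv.Perm.mul_apply, e1, e2]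
  have : ∑ p ∈ ((Finset.univ.erase (⟨i, by omega⟩ : Fin N)).erase ⟨i + 1, hi⟩),
        (N - p) * (u p : ℕ) =
      ∑ p ∈ ((Finset.univ.erase (⟨i, by omega⟩ : Fin N)).erase ⟨i + 1, hi⟩),
        (N - p) * ((u * adj N i) p : ℕ) := by
    refine Finset.sum_congr rfl fun p hp => ?_
    simp only [Finset.mem_erase, Fin.ext_iff, Finset.mem_univ, and_true, ne_eq] at hp
    have : adj N i p = p := by
      ext; rw [adj_val hi, if_neg hp.2, if_neg hp.1]
    rw [Equiv.Perm.mul_apply, this]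
  rw [← this]
  obtain ⟨d, hd⟩ : ∃ d, N - i = d + 1 + 1 := ⟨N - i - 2, by omega⟩
  have hd' : N - (i + 1) = d + 1 := by omega
  rw [hd, hd']
  have h' : (u ⟨i, by omega⟩ : ℕ) < u ⟨i + 1, hi⟩ := h
  nlinarith

theorem exists_ascent_or_eq_one {N : ℕ} (u : Equiv.Perm (Fin N)) :
    (∃ i, i + 1 < N ∧ Ascent (u * adj N i) i) ∨ u = 1 := by
  by_cases hu : ∃ i, i + 1 < N ∧ Ascent (u * adj N i) i
  · exact Or.inl hu
  · right
    have h1 : ∀ i, i + 1 < N → Ascent u i := by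
      intro i hi
      rcases ascent_or u hi with h | h
      · exact h
      · exact absurd ⟨i, hi, h⟩ hu
    have hmono : StrictMono u := by
      cases N with
      | zero => exact fun a => a.elim0
      | succ N =>
        rw [Fin.strictMono_iff_lt_succ]
        intro i
        obtain ⟨_, h⟩ := h1 i (by omega)
        exact h
    ext p
    have : (u : Fin N → Fin N) = id :=
      (hmono.range_inj strictMono_id).1 (by simp [u.surjective.range_eq])
    rw [this]; rfl

/-- `PosWord a u g` says that `g` is the product of the `a i` along a reduced word of `u`. -/
inductive PosWord {N : ℕ} (a : ℕ → G) : Equiv.Perm (Fin N) → G → Prop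
  | one : PosWord a 1 1
  | step (u : Equiv.Perm (Fin N)) (g : G) (i : ℕ) : PosWord a u g → Ascent u i →
      PosWord a (u * adj N i) (g * a i)

/-- The Artin relations for the generators of the braid group on `N` strands. -/
structure ArtinFam (N : ℕ) (a : ℕ → G) : Prop where
  comm : ∀ i j, i + 2 ≤ j → j + 1 < N → a i * a j = a j * a i
  braid : ∀ i, i + 2 < N → a i * a (i + 1) * a i = a (i + 1) * a i * a (i + 1)

theorem exists_posWord {N : ℕ} (a : ℕ → G) (u : Equiv.Perm (Fin N)) : ∃ g, PosWord a u g := by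
  induction hn : permSize u using Nat.strong_induction_on generalizing u with
  | _ n ih =>
    rcases exists_ascent_or_eq_one u with ⟨i, hi, h⟩ | rfl
    · have hlt := permSize_lt h
      rw [mul_adj_mul_adj] at hlt
      obtain ⟨g, hg⟩ := ih _ (hn ▸ hlt) _ rfl
      have := PosWord.step _ _ _ hg h
      rw [mul_adj_mul_adj] at this
      exact ⟨_, this⟩
    · exact ⟨1, .one⟩

theorem posWord_map {N : ℕ} {a : ℕ → G} (φ : G →* H) {u : Equiv.Perm (Fin N)} {g : G}
    (h : PosWord a u g) : PosWord (fun i => φ (a i)) u (φ g) := by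
  induction h with
  | one => rw [map_one]; exact .one
  | step u g i _ hi ih => rw [map_mul]; exact .step _ _ _ ih hi

theorem ascent_iff {N i : ℕ} (h : i + 1 < N) (u : Equiv.Perm (Fin N)) :
    Ascent u i ↔ (u ⟨i, by omega⟩ : ℕ) < u ⟨i + 1, h⟩ :=
  ⟨fun ⟨_, h⟩ => h, fun h' => ⟨h, h'⟩⟩

theorem adj_apply_left {N i : ℕ} (h : i + 1 < N) : adj N i ⟨i, by omega⟩ = ⟨i + 1, h⟩ := by
  ext; rw [adj_val h]; simp

theorem adj_apply_right {N i : ℕ} (h : i + 1 < N) : adj N i ⟨i + 1, h⟩ = ⟨i, by omega⟩ := by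
  ext; rw [adj_val h]; simp

theorem adj_apply_of_ne {N i j : ℕ} (hj : j < N) (h1 : j ≠ i) (h2 : j ≠ i + 1) :
    adj N i ⟨j, hj⟩ = ⟨j, hj⟩ := by
  unfold adj
  split_ifs with h
  · exact Equiv.swap_apply_of_ne_of_ne (by simpa using h1) (by simpa using h2)
  · rfl

theorem adj_comm {N i j : ℕ} (h : i + 2 ≤ j) : adj N i * adj N j = adj N j * adj N i := by
  by_cases hj : j + 1 < N
  · ext p
    simp only [Equiv.Perm.mul_apply]
    rw [adj_val (by omega), adj_val hj, adj_val hj, adj_val (by omega)]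
    split_ifs <;> omega
  · simp [show adj N j = 1 by rw [adj, dif_neg hj]]

theorem adj_braid {N i : ℕ} (h : i + 2 < N) : adj N i * adj N (i + 1) * adj N i =
    adj N (i + 1) * adj N i * adj N (i + 1) := by
  ext p
  simp only [Equiv.Perm.mul_apply]
  rw [adj_val (by omega), adj_val (by omega), adj_val (by omega), adj_val (by omega),
    adj_val (by omega),
    adj_val (by omega)]
  split_ifs <;> omega

theorem posWord_unique_aux {N : ℕ} {a : ℕ → G} (ha : ArtinFam N a) {v v' : Equiv.Perm (Fin N)}
    {g g' : G} {i j : ℕ} (ih : ∀ w : Equiv.Perm (Fin N), permSize w < permSize (v * adj N i) →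
      ∀ k k', PosWord a w k → PosWord a w k' → k = k') (hij : i < j)
    (hvv : v * adj N i = v' * adj N j)
    (hv : PosWord a v g) (hi : Ascent v i) (hv' : PosWord a v' g') (hj : Ascent v' j) :
    g * a i = g' * a j := by
  have s1 := permSize_lt hi
  have s2 := permSize_lt hj
  rw [← hvv] at s2
  have hjN := hj.1
  have hiN := hi.1
  have hi2 := hi.2
  have hj2 := hj.2
  obtain rfl : v' = v * adj N i * adj N j := by rw [hvv, mul_adj_mul_adj]
  rcases (show i + 2 ≤ j ∨ j = i + 1 by omega) with h | rfl
  · have hw : Ascent (v * adj N j) i := by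
      rw [ascent_iff hiN, Equiv.Perm.mul_apply, Equiv.Perm.mul_apply,
        adj_apply_of_ne _ (by omega) (by omega), adj_apply_of_ne _ (by omega) (by omega)]
      exact hi2
    have e : v * adj N i * adj N j = v * adj N j * adj N i := by
      rw [mul_assoc, adj_comm h, mul_assoc]
    have hw' : Ascent (v * adj N j) j := by
      have q1 : adj N i ⟨j, by omega⟩ = ⟨j, by omega⟩ := adj_apply_of_ne _ (by omega) (by omega)
      have q2 : adj N i ⟨j + 1, hjN⟩ = ⟨j + 1, hjN⟩ := adj_apply_of_ne _ (by omega) (by omega)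
      rw [ascent_iff hjN]
      rw [e] at hj2
      simp only [Equiv.Perm.mul_apply, q1, q2, adj_apply_left hjN, adj_apply_right hjN] at hj2 ⊢
      exact hj2
    obtain ⟨k, hk⟩ := exists_posWord a (v * adj N j)
    have h1 := PosWord.step _ _ _ hk hw'
    rw [mul_adj_mul_adj] at h1
    have h2 := PosWord.step _ _ _ hk hw
    rw [← e] at h2
    rw [ih _ s1 _ _ hv h1, ih _ s2 _ _ hv' h2, mul_assoc, mul_assoc, ha.comm i j h hjN]
  · have hb : (v * adj N i * adj N (i + 1)) * adj N i * adj N (i + 1) = v * adj N (i + 1) *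
        adj N i := by
      have := adj_braid hjN
      calc _ = v * (adj N i * adj N (i + 1) * adj N i) * adj N (i + 1) := by group
        _ = v * adj N (i + 1) * adj N i * adj N (i + 1) * adj N (i + 1) := by rw [this]; group
        _ = _ := mul_adj_mul_adj _ _
    have r1 := adj_apply_left hiN
    have r2 := adj_apply_right hiN
    have r3 := adj_apply_left hjN
    have r4 := adj_apply_right hjN
    have r5 : adj N i ⟨i + 1 + 1, hjN⟩ = ⟨i + 1 + 1, hjN⟩ :=
      adj_apply_of_ne _ (by omega) (by omega)
    have r6 : adj N (i + 1) ⟨i, by omega⟩ = ⟨i, by omega⟩ := adj_apply_of_ne _ (by omega) (by omega)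
    simp only [Equiv.Perm.mul_apply, r2, r3, r4, r5] at hi2 hj2
    -- the minimal coset representative
    have hw1 : Ascent (v * adj N (i + 1) * adj N i) i := by
      rw [ascent_iff hiN]
      simp only [Equiv.Perm.mul_apply, r1, r2, r3, r6]
      exact hj2
    have hw2 : Ascent (v * adj N (i + 1) * adj N i) (i + 1) := by
      rw [ascent_iff hjN]
      simp only [Equiv.Perm.mul_apply, r2, r4, r5, r6]
      exact hi2
    have hw3 : Ascent (v * adj N (i + 1)) (i + 1) := by
      rw [ascent_iff hjN]
      simp only [Equiv.Perm.mul_apply, r3, r4]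
      exact hi2.trans' hj2
    have hw4 : Ascent (v * adj N i * adj N (i + 1) * adj N i) i := by
      rw [ascent_iff hiN]
      simp only [Equiv.Perm.mul_apply, r1, r2, r3, r5, r6]
      exact hi2.trans' hj2
    obtain ⟨k, hk⟩ := exists_posWord a (v * adj N (i + 1) * adj N i)
    have h1 := PosWord.step _ _ _ hk hw1
    rw [mul_adj_mul_adj] at h1
    have h1' := PosWord.step _ _ _ h1 hw3
    rw [mul_adj_mul_adj] at h1'
    have h2 := PosWord.step _ _ _ hk hw2
    rw [← hb, mul_adj_mul_adj] at h2
    have h2' := PosWord.step _ _ _ h2 hw4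
    rw [mul_adj_mul_adj] at h2'
    rw [ih _ s1 _ _ hv h1', ih _ s2 _ _ hv' h2']
    simp only [mul_assoc]
    have := ha.braid i hjN
    simp only [mul_assoc] at this
    rw [this]

theorem posWord_unique {N : ℕ} {a : ℕ → G} (ha : ArtinFam N a) (u : Equiv.Perm (Fin N))
    (g g' : G) (h : PosWord a u g) (h' : PosWord a u g') : g = g' := by
  induction hn : permSize u using Nat.strong_induction_on generalizing u g g' with
  | _ n ih =>
    have hone : ∀ (v : Equiv.Perm (Fin N)) (i : ℕ), Ascent v i → v * adj N i ≠ 1 := by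
      rintro v i ⟨hi, h⟩ e
      have : v = adj N i := by rw [← mul_adj_mul_adj i v, e, one_mul]
      rw [this, adj_apply_left hi, adj_apply_right hi] at h
      exact absurd (Fin.mk_lt_mk.1 h) (by omega)
    rcases h with _ | ⟨v, k, i, hv, hi⟩
    · generalize hu : (1 : Equiv.Perm (Fin N)) = u at h'
      rcases h' with _ | ⟨v, k, i, hv, hi⟩
      · rfl
      · exact absurd hu.symm (hone _ _ hi)
    · generalize hu : v * adj N i = u at h' hn
      rcases h' with _ | ⟨v', k', j, hv', hj⟩
      · exact absurd hu (hone _ _ hi)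
      · subst hn
        rcases lt_trichotomy i j with hij | rfl | hij
        · refine posWord_unique_aux ha (fun w hw k k' hk hk' => ?_) hij hu hv hi hv' hj
          exact ih _ (hu ▸ hw) w k k' hk hk' rfl
        · have e : v = v' := mul_right_cancel hu
          subst e
          rw [ih _ (permSize_lt hj) v k k' hv hv' rfl]
        · refine (posWord_unique_aux ha (fun w hw k k' hk hk' => ?_) hij hu.symm hv' hj
            hv hi).symm
          exact ih _ hw w k k' hk hk' rfl

/-- The positive lift of a permutation. -/
def posLift {N : ℕ} (a : ℕ → G) (u : Equiv.Perm (Fin N)) : G := (exists_posWord a u).choose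

theorem posLift_spec {N : ℕ} (a : ℕ → G) (u : Equiv.Perm (Fin N)) : PosWord a u (posLift a u) :=
  (exists_posWord a u).choose_spec

theorem PosWord.eq {N : ℕ} {a : ℕ → G} (ha : ArtinFam N a) {u : Equiv.Perm (Fin N)} {g : G}
    (h : PosWord a u g) : g = posLift a u := posWord_unique ha u _ _ h (posLift_spec a u)

theorem posLift_one {N : ℕ} {a : ℕ → G} (ha : ArtinFam N a) :
    posLift a (1 : Equiv.Perm (Fin N)) = 1 := (PosWord.one.eq ha).symm

theorem posLift_mul_adj {N : ℕ} {a : ℕ → G} (ha : ArtinFam N a) {u : Equiv.Perm (Fin N)} {i : ℕ}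
    (h : Ascent u i) : posLift a (u * adj N i) = posLift a u * a i :=
  ((PosWord.step _ _ _ (posLift_spec a u) h).eq ha).symm

theorem posLift_map {N : ℕ} {a : ℕ → G} (φ : G →* H) (hφ : ArtinFam N fun i => φ (a i))
    (u : Equiv.Perm (Fin N)) : φ (posLift a u) = posLift (fun i => φ (a i)) u :=
  (posWord_map φ (posLift_spec a u)).eq hφ

/-- A function on permutations which is multiplicative at ascents gives the Artin relations. -/
theorem artinFam_of_fun {N : ℕ} {a : ℕ → G} (S : Equiv.Perm (Fin N) → G)
    (hS : ∀ u i, Ascent u i → S (u * adj N i) = S u * a i) : ArtinFam N a := by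
  constructor
  · intro i j hij hj
    have hi : i + 1 < N := by omega
    have a1 : Ascent (1 : Equiv.Perm (Fin N)) i := by rw [ascent_iff hi]; simp
    have a2 : Ascent (1 : Equiv.Perm (Fin N)) j := by rw [ascent_iff hj]; simp
    have a3 : Ascent (1 * adj N i) j := by
      rw [ascent_iff hj, one_mul, adj_apply_of_ne _ (by omega) (by omega),
        adj_apply_of_ne _ (by omega) (by omega)]; simp
    have a4 : Ascent (1 * adj N j) i := by
      rw [ascent_iff hi, one_mul, adj_apply_of_ne _ (by omega) (by omega),
        adj_apply_of_ne _ (by omega) (by omega)]; simp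
    have e1 := hS _ _ a3
    have e2 := hS _ _ a4
    rw [hS _ _ a1, one_mul, adj_comm hij, mul_assoc] at e1
    rw [hS _ _ a2, one_mul, mul_assoc, e1] at e2
    exact mul_left_cancel e2
  · intro i hi
    have hi' : i + 1 < N := by omega
    have r1 := adj_apply_left hi'
    have r2 := adj_apply_right hi'
    have r3 := adj_apply_left hi
    have r4 := adj_apply_right hi
    have r5 : adj N i ⟨i + 1 + 1, hi⟩ = ⟨i + 1 + 1, hi⟩ :=
      adj_apply_of_ne _ (by omega) (by omega)
    have r6 : adj N (i + 1) ⟨i, by omega⟩ = ⟨i, by omega⟩ := adj_apply_of_ne _ (by omega) (by omega)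
    have a1 : Ascent (1 : Equiv.Perm (Fin N)) i := by rw [ascent_iff hi']; simp
    have a2 : Ascent (1 * adj N i) (i + 1) := by
      rw [ascent_iff hi]; simp [r2, r5]
    have a3 : Ascent (1 * adj N i * adj N (i + 1)) i := by
      rw [ascent_iff hi']; simp only [Equiv.Perm.mul_apply, Equiv.Perm.one_apply]
      simp [r1, r3, r5, r6]
    have b1 : Ascent (1 : Equiv.Perm (Fin N)) (i + 1) := by rw [ascent_iff hi]; simp
    have b2 : Ascent (1 * adj N (i + 1)) i := by
      rw [ascent_iff hi']; simp [r3, r6]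
    have b3 : Ascent (1 * adj N (i + 1) * adj N i) (i + 1) := by
      rw [ascent_iff hi]; simp only [Equiv.Perm.mul_apply, Equiv.Perm.one_apply]
      simp [r2, r4, r5, r6]
    have e1 := hS _ _ a3
    have e2 := hS _ _ b3
    rw [hS _ _ a2, hS _ _ a1, one_mul, adj_braid hi] at e1
    rw [hS _ _ b2, hS _ _ b1, one_mul, e1] at e2
    simp only [mul_assoc] at e2 ⊢
    exact mul_left_cancel e2

theorem posLift_mul {N : ℕ} {a : ℕ → G} (ha : ArtinFam N a) (u v : Equiv.Perm (Fin N))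
    (h : ∀ p q, p < q → v q < v p → u (v q) < u (v p)) :
    posLift a (u * v) = posLift a u * posLift a v := by
  induction hn : permSize v using Nat.strong_induction_on generalizing v with
  | _ n ih =>
    rcases exists_ascent_or_eq_one v with ⟨i, hi, hv⟩ | rfl
    · obtain ⟨w, rfl⟩ : ∃ w, v = w * adj N i := ⟨v * adj N i, (mul_adj_mul_adj i v).symm⟩
      rw [mul_adj_mul_adj] at hv
      have hw : ∀ p q, p < q → w q < w p → u (w q) < u (w p) := by
        intro p q hpq hwpq
        have := h (adj N i p) (adj N i q)
        have e : ∀ z, adj N i (adj N i z) = z := fun z => by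
          rw [← Equiv.Perm.mul_apply, adj_mul_self]; rfl
        simp only [Equiv.Perm.mul_apply, e] at this
        refine this ?_ hwpq
        have hne : ¬ ((p : ℕ) = i ∧ (q : ℕ) = i + 1) := by
          rintro ⟨h1, h2⟩
          have := hv.2
          have hp : p = ⟨i, by omega⟩ := Fin.ext h1
          have hq : q = ⟨i + 1, hi⟩ := Fin.ext h2
          rw [hp, hq] at hwpq
          exact lt_asymm this hwpq
        rw [Fin.lt_def, adj_val hi, adj_val hi]
        have : (p : ℕ) < q := hpq
        split_ifs <;> omega
      have hu : Ascent (u * w) i := by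
        rw [ascent_iff hi]
        have h1 := hv.2
        have := h ⟨i, by omega⟩ ⟨i + 1, hi⟩ (by simp)
        simp only [Equiv.Perm.mul_apply, adj_apply_left hi, adj_apply_right hi] at this
        exact this h1
      rw [← mul_assoc, posLift_mul_adj ha hu, posLift_mul_adj ha hv,
        ih _ (hn ▸ permSize_lt hv) w hw rfl, mul_assoc]
    · rw [mul_one, posLift_one ha, mul_one]

end Algebra

section Algebra

variable {G H : Type*} [Group G] [Group H]

/-- The product `a (m - 1) ⋯ a 1 a 0`. -/
def descWord (a : ℕ → G) (m : ℕ) : G := ((List.range m).reverse.map a).prod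

/-- The product `a 0 a 1 ⋯ a (m - 1)`. -/
def ascWord (a : ℕ → G) (m : ℕ) : G := ((List.range m).map a).prod

/-- The Garside element on `m` strands. -/
def garside (a : ℕ → G) (m : ℕ) : G := ((List.range m).map (descWord a)).prod

theorem descWord_succ (a : ℕ → G) (m : ℕ) : descWord a (m + 1) = a m * descWord a m := by
  simp [descWord, List.range_succ]

theorem ascWord_succ (a : ℕ → G) (m : ℕ) : ascWord a (m + 1) = ascWord a m * a m := by
  simp [ascWord, List.range_succ]

theorem garside_succ (a : ℕ → G) (m : ℕ) : garside a (m + 1) = garside a m * descWord a m := by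
  simp [garside, List.range_succ]

@[simp] theorem descWord_zero (a : ℕ → G) : descWord a 0 = 1 := by simp [descWord]
@[simp] theorem ascWord_zero (a : ℕ → G) : ascWord a 0 = 1 := by simp [ascWord]
@[simp] theorem garside_zero (a : ℕ → G) : garside a 0 = 1 := by simp [garside]

theorem map_descWord (φ : G →* H) (a : ℕ → G) (m : ℕ) :
    φ (descWord a m) = descWord (fun i => φ (a i)) m := by
  induction m with
  | zero => simp
  | succ m ih => rw [descWord_succ, descWord_succ, map_mul, ih]

theorem map_ascWord (φ : G →* H) (a : ℕ → G) (m : ℕ) :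
    φ (ascWord a m) = ascWord (fun i => φ (a i)) m := by
  induction m with
  | zero => simp
  | succ m ih => rw [ascWord_succ, ascWord_succ, map_mul, ih]

theorem map_garside (φ : G →* H) (a : ℕ → G) (m : ℕ) :
    φ (garside a m) = garside (fun i => φ (a i)) m := by
  induction m with
  | zero => simp
  | succ m ih => rw [garside_succ, garside_succ, map_mul, ih, map_descWord]

theorem descWord_congr {a b : ℕ → G} {m : ℕ} (h : ∀ i < m, a i = b i) :
    descWord a m = descWord b m := by
  induction m with
  | zero => simp
  | succ m ih => rw [descWord_succ, descWord_succ, h m (by omega), ih fun i hi => h i (by omega)]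

theorem garside_congr {a b : ℕ → G} {m : ℕ} (h : ∀ i, i + 1 < m → a i = b i) :
    garside a m = garside b m := by
  induction m with
  | zero => simp
  | succ m ih =>
    rw [garside_succ, garside_succ, ih fun i hi => h i (by omega),
      descWord_congr fun i hi => h i (by omega)]

theorem descWord_adj_val {N m : ℕ} (hm : m < N) (p : Fin N) :
    (descWord (adj N) m p : ℕ) = if (p : ℕ) = 0 then m else if (p : ℕ) ≤ m then p - 1 else p := by
  induction m with
  | zero => rw [descWord_zero, Equiv.Perm.one_apply]; split_ifs <;> omega
  | succ m ih =>
    rw [descWord_succ, Equiv.Perm.mul_apply, adj_val hm, ih (by omega)]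
    split_ifs <;> omega

theorem ascWord_adj_val {N m : ℕ} (hm : m < N) (p : Fin N) :
    (ascWord (adj N) m p : ℕ) =
      if (p : ℕ) < m then (p : ℕ) + 1 else if (p : ℕ) = m then 0 else p := by
  induction m generalizing p with
  | zero => rw [ascWord_zero, Equiv.Perm.one_apply]; split_ifs <;> omega
  | succ m ih =>
    rw [ascWord_succ, Equiv.Perm.mul_apply, ih (by omega), adj_val hm]
    split_ifs <;> omega

theorem garside_adj_val {N m : ℕ} (hm : m ≤ N) (p : Fin N) :
    (garside (adj N) m p : ℕ) = if (p : ℕ) < m then m - 1 - p else p := by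
  induction m generalizing p with
  | zero => simp
  | succ m ih =>
    rw [garside_succ, Equiv.Perm.mul_apply, ih (by omega), descWord_adj_val (by omega)]
    split_ifs <;> omega

theorem posLift_adj {N : ℕ} {a : ℕ → G} (ha : ArtinFam N a) {i : ℕ} (hi : i + 1 < N) :
    posLift a (adj N i) = a i := by
  have h : Ascent (1 : Equiv.Perm (Fin N)) i := by rw [ascent_iff hi]; simp
  simpa [posLift_one ha] using posLift_mul_adj ha h

theorem posLift_descWord {N m : ℕ} {a : ℕ → G} (ha : ArtinFam N a) (hm : m < N) :
    posLift a (descWord (adj N) m) = descWord a m := by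
  induction m with
  | zero => simp [posLift_one ha]
  | succ m ih =>
    rw [descWord_succ, posLift_mul ha, ih (by omega), posLift_adj ha hm, descWord_succ]
    intro p q hpq h
    rw [Fin.lt_def] at *
    rw [adj_val hm, adj_val hm]
    rw [descWord_adj_val (by omega), descWord_adj_val (by omega)] at *
    split_ifs at * <;> omega

theorem posLift_ascWord {N m : ℕ} {a : ℕ → G} (ha : ArtinFam N a) (hm : m < N) :
    posLift a (ascWord (adj N) m) = ascWord a m := by
  induction m with
  | zero => simp [posLift_one ha]
  | succ m ih =>
    rw [ascWord_succ, posLift_mul_adj ha, ih (by omega), ascWord_succ]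
    rw [ascent_iff hm, ascWord_adj_val (by omega), ascWord_adj_val (by omega)]
    simp

theorem posLift_garside {N m : ℕ} {a : ℕ → G} (ha : ArtinFam N a) (hm : m ≤ N) :
    posLift a (garside (adj N) m) = garside a m := by
  induction m with
  | zero => simp [posLift_one ha]
  | succ m ih =>
    rw [garside_succ, posLift_mul ha, ih (by omega), posLift_descWord ha hm, garside_succ]
    intro p q hpq h
    rw [Fin.lt_def] at *
    rw [garside_adj_val (by omega), garside_adj_val (by omega)]
    rw [descWord_adj_val (by omega), descWord_adj_val (by omega)] at *
    split_ifs at * <;> omega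

theorem garside_succ' {k : ℕ} {a : ℕ → G} (ha : ArtinFam (k + 1) a) :
    garside a (k + 1) = ascWord a k * garside a k := by
  rw [← posLift_garside ha le_rfl, ← posLift_garside ha (Nat.le_succ k),
    ← posLift_ascWord ha (Nat.lt_succ_self k), ← posLift_mul ha]
  · congr 1
    ext p
    rw [Equiv.Perm.mul_apply, garside_adj_val le_rfl, ascWord_adj_val (by omega),
      garside_adj_val (by omega)]
    split_ifs <;> omega
  · intro p q hpq h
    rw [Fin.lt_def] at *
    rw [ascWord_adj_val (by omega), ascWord_adj_val (by omega)]
    rw [garside_adj_val (by omega), garside_adj_val (by omega)] at *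
    split_ifs at * <;> omega

theorem asc_mul_desc_eq_one {k : ℕ} {a : ℕ → G} (ha : ArtinFam (k + 1) a)
    (h1 : garside a (k + 1) ^ 2 = 1) (h2 : garside a k ^ 2 = 1) :
    ascWord a k * descWord a k = 1 := by
  have e : garside a (k + 1) ^ 2 =
      garside a k * (descWord a k * ascWord a k) * (garside a k)⁻¹ * garside a k ^ 2 := by
    conv_lhs => rw [pow_two, garside_succ' ha]
    conv_lhs => enter [1]; rw [← garside_succ' ha, garside_succ]
    group
  rw [h1, h2, mul_one] at e
  have e2 : descWord a k * ascWord a k = 1 := by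
    rw [eq_comm, mul_inv_eq_one] at e
    simpa using e
  exact mul_eq_one_comm.1 e2

section Coset

variable {k : ℕ} {a : ℕ → G}

/-- The coset representatives `a (k - 1) ⋯ a (k - d)`. -/
def cosetRep (k : ℕ) (a : ℕ → G) : ℕ → G
  | 0 => 1
  | d + 1 => cosetRep k a d * a (k - 1 - d)

theorem cosetRep_comm (ha : ArtinFam (k + 1) a) {d i : ℕ} (h : i + d + 1 < k) :
    cosetRep k a d * a i = a i * cosetRep k a d := by
  induction d with
  | zero => simp [cosetRep]
  | succ d ih =>
    rw [cosetRep, mul_assoc, ← ha.comm i (k - 1 - d) (by omega) (by omega), ← mul_assoc,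
      ih (by omega), mul_assoc]

theorem cosetRep_shift (ha : ArtinFam (k + 1) a) {d i : ℕ} (hd : d ≤ k) (h : k < i + d + 1)
    (hi : i + 1 < k) : cosetRep k a d * a (i + 1) = a i * cosetRep k a d := by
  induction d with
  | zero => omega
  | succ d ih =>
    rcases (show k < i + d + 1 ∨ k = i + d + 1 by omega) with h1 | h1
    · rw [cosetRep, mul_assoc, ha.comm (k - 1 - d) (i + 1) (by omega) (by omega), ← mul_assoc,
        ih (by omega) h1, mul_assoc]
    · cases d with
      | zero => omega
      | succ d =>
        have e1 : k - 1 - (d + 1) = i := by omega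
        have e2 : k - 1 - d = i + 1 := by omega
        rw [cosetRep, cosetRep, e1, e2]
        have := ha.braid i (by omega)
        have c := cosetRep_comm ha (d := d) (i := i) (by omega)
        calc _ = cosetRep k a d * (a (i + 1) * a i * a (i + 1)) := by group
          _ = (cosetRep k a d * a i) * (a (i + 1) * a i) := by rw [← this]; group
          _ = _ := by rw [c]; group

theorem cosetRep_conj_mem (ha : ArtinFam (k + 1) a) (hs : ascWord a k * descWord a k = 1)
    {d : ℕ} (hd : d < k) : cosetRep k a d * a (k - 1 - d) ^ 2 * (cosetRep k a d)⁻¹ ∈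
      Subgroup.closure (a '' {i | i + 1 < k}) := by
  induction d with
  | zero =>
    obtain ⟨m, rfl⟩ : ∃ m, k = m + 1 := ⟨k - 1, by omega⟩
    have hA : ∀ j ≤ m, ascWord a j ∈ Subgroup.closure (a '' {i | i + 1 < m + 1}) ∧
        descWord a j ∈ Subgroup.closure (a '' {i | i + 1 < m + 1}) := by
      intro j
      induction j with
      | zero => intro; simp
      | succ j ih =>
        intro hj
        have hm : a j ∈ Subgroup.closure (a '' {i | i + 1 < m + 1}) :=
          Subgroup.subset_closure ⟨j, by simp; omega, rfl⟩
        rw [ascWord_succ, descWord_succ]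
        exact ⟨mul_mem (ih (by omega)).1 hm, mul_mem hm (ih (by omega)).2⟩
    obtain ⟨h1, h2⟩ := hA m le_rfl
    rw [ascWord_succ, descWord_succ] at hs
    have : a m ^ 2 = (ascWord a m)⁻¹ * (descWord a m)⁻¹ := by
      rw [eq_mul_inv_iff_mul_eq]
      refine eq_inv_of_mul_eq_one_right ?_
      rw [← hs]; simp only [pow_two, mul_assoc]
    simp only [cosetRep, Nat.add_sub_cancel, Nat.sub_zero, one_mul, inv_one, mul_one]
    rw [this]
    exact mul_mem (inv_mem h1) (inv_mem h2)
  | succ d ih =>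
    obtain ⟨i, hi⟩ : ∃ i, k - 1 - (d + 1) = i := ⟨_, rfl⟩
    have e2 : k - 1 - d = i + 1 := by omega
    have h := ih (by omega)
    rw [e2] at h
    rw [hi, cosetRep, e2]
    have hm : a i ∈ Subgroup.closure (a '' {i | i + 1 < k}) :=
      Subgroup.subset_closure ⟨i, by simp; omega, rfl⟩
    have c := cosetRep_comm ha (d := d) (i := i) (by omega)
    have hb := ha.braid i (by omega)
    have hb' : a (i + 1) * a i ^ 2 * (a (i + 1))⁻¹ = (a i)⁻¹ * a (i + 1) ^ 2 * a i := by
      rw [mul_inv_eq_iff_eq_mul]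
      have : a i * (a (i + 1) * a i ^ 2) = a (i + 1) ^ 2 * a i * a (i + 1) := by
        calc _ = a i * a (i + 1) * a i * a i := by simp only [pow_two, mul_assoc]
          _ = a (i + 1) * (a i * a (i + 1) * a i) := by nth_rw 1 [hb]; simp only [mul_assoc]
          _ = _ := by rw [hb]; simp only [pow_two, mul_assoc]
      rw [mul_assoc (_ * _), mul_assoc (_)⁻¹, eq_inv_mul_iff_mul_eq, this]
      group
    have e : cosetRep k a d * a (i + 1) * a i ^ 2 * (cosetRep k a d * a (i + 1))⁻¹ =
        (a i)⁻¹ * (cosetRep k a d * a (i + 1) ^ 2 * (cosetRep k a d)⁻¹) * a i := by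
      calc _ = cosetRep k a d * (a (i + 1) * a i ^ 2 * (a (i + 1))⁻¹) * (cosetRep k a d)⁻¹ := by
            group
        _ = cosetRep k a d * (a i)⁻¹ * a (i + 1) ^ 2 * (a i * (cosetRep k a d)⁻¹) := by
            rw [hb']; group
        _ = _ := by
            have c1 : cosetRep k a d * (a i)⁻¹ = (a i)⁻¹ * cosetRep k a d := by
              rw [mul_inv_eq_iff_eq_mul, mul_assoc, c]; group
            have c2 : a i * (cosetRep k a d)⁻¹ = (cosetRep k a d)⁻¹ * a i := by
              rw [mul_inv_eq_iff_eq_mul, mul_assoc, ← c]; group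
            rw [c1, c2]; group
    rw [e]
    exact mul_mem (mul_mem (inv_mem hm) h) hm

theorem exists_eq_mul_cosetRep (ha : ArtinFam (k + 1) a) (hs : ascWord a k * descWord a k = 1)
    {g : G} (hg : g ∈ Subgroup.closure (a '' {i | i < k})) :
    ∃ h ∈ Subgroup.closure (a '' {i | i + 1 < k}), ∃ d ≤ k, g = h * cosetRep k a d := by
  have hgen : ∀ i, i + 1 < k → a i ∈ Subgroup.closure (a '' {i | i + 1 < k}) := fun i hi =>
    Subgroup.subset_closure ⟨i, hi, rfl⟩
  -- the four cases of multiplying a representative by a generator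
  have cases : ∀ d ≤ k, ∀ i < k, (∃ i', i' + 1 < k ∧ cosetRep k a d * a i =
      a i' * cosetRep k a d) ∨ (d < k ∧ i = k - 1 - d) ∨ (∃ e, d = e + 1 ∧ i = k - 1 - e) := by
    intro d hd i hi
    rcases (show i + d + 1 < k ∨ (d < k ∧ i = k - 1 - d) ∨ (∃ e, d = e + 1 ∧ i = k - 1 - e) ∨
        k < i + d by
      by_cases h : i + d = k
      · exact Or.inr (Or.inr (Or.inl ⟨d - 1, by omega, by omega⟩))
      · omega) with h | h | h | h
    · exact Or.inl ⟨i, by omega, cosetRep_comm ha h⟩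
    · exact Or.inr (Or.inl h)
    · exact Or.inr (Or.inr h)
    · obtain ⟨j, rfl⟩ : ∃ j, i = j + 1 := ⟨i - 1, by omega⟩
      exact Or.inl ⟨j, hi, cosetRep_shift ha hd (by omega) hi⟩
  have hsq : ∀ e < k, ∃ A ∈ Subgroup.closure (a '' {i | i + 1 < k}),
      cosetRep k a (e + 1) * a (k - 1 - e) = A * cosetRep k a e := by
    intro e he
    refine ⟨_, cosetRep_conj_mem ha hs he, ?_⟩
    rw [cosetRep, inv_mul_cancel_right, pow_two, mul_assoc]
  induction hg using Subgroup.closure_induction_right with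
  | one => exact ⟨1, one_mem _, 0, by omega, by simp [cosetRep]⟩
  | mul_right x hx y hy ih =>
    obtain ⟨h, hh, d, hd, rfl⟩ := ih
    obtain ⟨i, hi, rfl⟩ := hy
    rcases cases d hd i hi with ⟨i', hi', e⟩ | ⟨hd', rfl⟩ | ⟨e, rfl, rfl⟩
    · exact ⟨h * a i', mul_mem hh (hgen _ hi'), d, hd, by rw [mul_assoc, e, mul_assoc]⟩
    · exact ⟨h, hh, d + 1, hd', by rw [cosetRep, mul_assoc]⟩
    · obtain ⟨A, hA, e1⟩ := hsq e (by omega)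
      exact ⟨h * A, mul_mem hh hA, e, by omega, by rw [mul_assoc, e1, mul_assoc]⟩
  | mul_inv_cancel x hx y hy ih =>
    obtain ⟨h, hh, d, hd, rfl⟩ := ih
    obtain ⟨i, hi, rfl⟩ := hy
    rcases cases d hd i hi with ⟨i', hi', e⟩ | ⟨hd', rfl⟩ | ⟨e, rfl, rfl⟩
    · refine ⟨h * (a i')⁻¹, mul_mem hh (inv_mem (hgen _ hi')), d, hd, ?_⟩
      rw [mul_inv_eq_iff_eq_mul, mul_assoc (h * _), e]; group
    · obtain ⟨A, hA, e1⟩ := hsq d hd'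
      refine ⟨h * A⁻¹, mul_mem hh (inv_mem hA), d + 1, hd', ?_⟩
      rw [mul_inv_eq_iff_eq_mul, mul_assoc (h * _), e1]; group
    · exact ⟨h, hh, e, by omega, by rw [cosetRep]; group⟩

end Coset

end Algebra

section Seg

variable {E : Type*} [AddCommGroup E] [Module ℝ E] [TopologicalSpace E]
  [IsTopologicalAddGroup E] [ContinuousSMul ℝ E] {F : Set E} {Γ : Type*} [Group Γ]

open Classical in
/-- The value on the straight path from `a` to `b`, when that path stays in `F`. -/
def PathHom.seg (W : PathHom F Γ) (a b : E) : Γ :=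
  if h : segment ℝ a b ⊆ F then
    W.val (segPath ⟨a, h (left_mem_segment ℝ a b)⟩ ⟨b, h (right_mem_segment ℝ a b)⟩ h) else 1

namespace PathHom

variable (W : PathHom F Γ) {S : Set E}

theorem val_eq_seg (hS : Convex ℝ S) (hSF : S ⊆ F) {a b : F} (p : Path a b)
    (hp : ∀ t, (p t : E) ∈ S) : W.val p = W.seg a b := by
  have ha : (a : E) ∈ S := by simpa using hp 0
  have hb : (b : E) ∈ S := by simpa using hp 1
  have h : segment ℝ (a : E) b ⊆ F := (hS.segment_subset ha hb).trans hSF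
  rw [seg, dif_pos h]
  exact W.val_homotopic (homotopic_of_convex hS hSF _ _ hp (segPath_mem _ _ _ hS ha hb))

theorem val_segPath {a b : F} (h : segment ℝ (a : E) b ⊆ F) :
    W.val (segPath a b h) = W.seg a b := by
  rw [seg, dif_pos h]

theorem seg_mul_seg (hS : Convex ℝ S) (hSF : S ⊆ F) {a b c : E} (ha : a ∈ S) (hb : b ∈ S)
    (hc : c ∈ S) : W.seg a b * W.seg b c = W.seg a c := by
  have h1 := (hS.segment_subset ha hb).trans hSF
  have h2 := (hS.segment_subset hb hc).trans hSF
  rw [← W.val_segPath (a := ⟨a, hSF ha⟩) (b := ⟨b, hSF hb⟩) h1,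
    ← W.val_segPath (a := ⟨b, hSF hb⟩) (b := ⟨c, hSF hc⟩) h2, ← W.val_trans]
  refine W.val_eq_seg hS hSF _ fun t => ?_
  rw [Path.trans_apply]
  split_ifs
  · exact segPath_mem _ _ _ hS ha hb _
  · exact segPath_mem _ _ _ hS hb hc _

theorem seg_self {a : E} : W.seg a a = 1 := by
  by_cases h : a ∈ F
  · have := W.seg_mul_seg (convex_singleton a) (singleton_subset_iff.2 h)
      (mem_singleton a) (mem_singleton a) (mem_singleton a)
    simpa using this
  · rw [seg, dif_neg]
    simpa using h

theorem seg_inv (hS : Convex ℝ S) (hSF : S ⊆ F) {a b : E} (ha : a ∈ S) (hb : b ∈ S) :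
    (W.seg a b)⁻¹ = W.seg b a :=
  inv_eq_of_mul_eq_one_right (by rw [W.seg_mul_seg hS hSF ha hb ha, seg_self])

end PathHom

end Seg

section Config

variable {N : ℕ} {Γ : Type*} [Group Γ]

/-- The ordered configuration space of `N` points of the complex plane. -/
def planeConf (N : ℕ) : Set (Fin N → ℂ) := {z | Function.Injective z}

/-- Permute the labels of a configuration. -/
def permuteLabels (ρ : Equiv.Perm (Fin N)) : C(planeConf N, planeConf N) where
  toFun z := ⟨(z : Fin N → ℂ) ∘ ρ, z.2.comp ρ.injective⟩
  continuous_toFun := by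
    refine Continuous.subtype_mk ?_ _
    exact continuous_pi fun i => (continuous_apply _).comp continuous_subtype_val

theorem permuteLabels_coe (ρ : Equiv.Perm (Fin N)) (z : planeConf N) :
    (permuteLabels ρ z : Fin N → ℂ) = (z : Fin N → ℂ) ∘ ρ := rfl

/-- The lexicographic order on the plane. -/
def LexLt (x y : ℂ) : Prop := x.re < y.re ∨ x.re = y.re ∧ x.im < y.im

theorem LexLt.asymm {x y : ℂ} (h : LexLt x y) (h' : LexLt y x) : False := by
  unfold LexLt at *
  rcases h with h | ⟨h, h2⟩ <;> rcases h' with h' | ⟨h', h2'⟩ <;> linarith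

theorem lexLt_or {x y : ℂ} (h : x ≠ y) : LexLt x y ∨ LexLt y x := by
  unfold LexLt
  rcases lt_trichotomy x.re y.re with h1 | h1 | h1
  · exact Or.inl (Or.inl h1)
  · rcases lt_trichotomy x.im y.im with h2 | h2 | h2
    · exact Or.inl (Or.inr ⟨h1, h2⟩)
    · exact absurd (Complex.ext h1 h2) h
    · exact Or.inr (Or.inr ⟨h1.symm, h2⟩)
  · exact Or.inr (Or.inl h1)

/-- The labels in lexicographic order. -/
def lexLabel (z : Fin N → ℂ) : Equiv.Perm (Fin N) :=
  Tuple.sort fun i => (toLex ((z i).re, (z i).im) : ℝ ×ₗ ℝ)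

theorem lexLt_iff (x y : ℂ) :
    LexLt x y ↔ (toLex (x.re, x.im) : ℝ ×ₗ ℝ) < toLex (y.re, y.im) := by
  rw [Prod.Lex.toLex_lt_toLex, LexLt]

/-- The convex cell of configurations with given lexicographic order of labels. -/
def lexCell (π : Equiv.Perm (Fin N)) : Set (Fin N → ℂ) :=
  {z | ∀ p q, p < q → LexLt (z (π p)) (z (π q))}

theorem lexCell_subset (π : Equiv.Perm (Fin N)) : lexCell π ⊆ planeConf N := by
  intro z hz a b hab
  by_contra hne
  have : ∀ p q, p < q → z (π p) ≠ z (π q) := by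
    intro p q h e
    have := hz p q h
    rw [e] at this
    exact this.asymm this
  rcases lt_trichotomy (π.symm a) (π.symm b) with h | h | h
  · exact this _ _ h (by simpa using hab)
  · exact hne (π.symm.injective h)
  · exact this _ _ h (by simpa using hab.symm)

theorem lexLabel_eq_iff {z : Fin N → ℂ} (hz : z ∈ planeConf N) (π : Equiv.Perm (Fin N)) :
    lexLabel z = π ↔ z ∈ lexCell π := by
  have hinj : ∀ i j, (toLex ((z i).re, (z i).im) : ℝ ×ₗ ℝ) = toLex ((z j).re, (z j).im) →
      i = j := by
    intro i j h
    have h' := toLex.injective h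
    rw [Prod.mk.injEq] at h'
    exact hz (Complex.ext h'.1 h'.2)
  rw [eq_comm, lexLabel, Tuple.eq_sort_iff]
  constructor
  · rintro ⟨h1, -⟩ p q hpq
    rw [lexLt_iff]
    refine lt_of_le_of_ne (h1 hpq.le) fun e => ?_
    exact hpq.ne (π.injective (hinj _ _ e))
  · intro h
    refine ⟨fun p q hpq => ?_, fun i j hij e => ?_⟩
    · rcases hpq.eq_or_lt with rfl | hlt
      · exact le_rfl
      · exact ((lexLt_iff _ _).1 (h p q hlt)).le
    · exact absurd (π.injective (hinj _ _ e)) hij.ne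

theorem mem_lexCell {z : Fin N → ℂ} (hz : z ∈ planeConf N) : z ∈ lexCell (lexLabel z) :=
  (lexLabel_eq_iff hz _).1 rfl

theorem lexLabel_of_mem {z : Fin N → ℂ} {π : Equiv.Perm (Fin N)} (hz : z ∈ lexCell π) :
    lexLabel z = π := (lexLabel_eq_iff (lexCell_subset π hz) _).2 hz

theorem comp_mem_lexCell {z : Fin N → ℂ} {π ρ : Equiv.Perm (Fin N)} :
    z ∘ ρ ∈ lexCell (ρ⁻¹ * π) ↔ z ∈ lexCell π := by
  simp [lexCell]

theorem lexLabel_comp {z : Fin N → ℂ} (hz : z ∈ planeConf N) (ρ : Equiv.Perm (Fin N)) :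
    lexLabel (z ∘ ρ) = ρ⁻¹ * lexLabel z :=
  lexLabel_of_mem (comp_mem_lexCell.2 (mem_lexCell hz))

/-- Comparison of positions and of points. -/
theorem lexLabel_symm_lt_iff {z : Fin N → ℂ} (hz : z ∈ planeConf N) (a b : Fin N) :
    (lexLabel z)⁻¹ a < (lexLabel z)⁻¹ b ↔ LexLt (z a) (z b) := by
  have h := mem_lexCell hz
  constructor
  · intro hlt
    simpa using h _ _ hlt
  · intro hlt
    by_contra hcon
    rcases (not_lt.1 hcon).eq_or_lt with e | e
    · have : a = b := ((lexLabel z)⁻¹).injective e.symm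
      subst this
      exact hlt.asymm hlt
    · have := h _ _ e
      simp only [Equiv.Perm.inv_def, Equiv.apply_symm_apply] at this
      exact hlt.asymm this

theorem convex_re_lt (a b : Fin N) : Convex ℝ {z : Fin N → ℂ | (z a).re < (z b).re} := by
  have := convex_halfSpace_lt (𝕜 := ℝ) (f := fun z : Fin N → ℂ => (z a).re - (z b).re)
    ⟨by intros; simp; ring, by intros; simp; ring⟩ 0
  simpa only [sub_neg] using this

theorem convex_im_lt (a b : Fin N) : Convex ℝ {z : Fin N → ℂ | (z a).im < (z b).im} := by
  have := convex_halfSpace_lt (𝕜 := ℝ) (f := fun z : Fin N → ℂ => (z a).im - (z b).im)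
    ⟨by intros; simp; ring, by intros; simp; ring⟩ 0
  simpa only [sub_neg] using this

theorem convex_lexLt (a b : Fin N) : Convex ℝ {z : Fin N → ℂ | LexLt (z a) (z b)} := by
  intro x hx y hy s t hs ht hst
  rcases hs.eq_or_lt with rfl | hs
  · obtain rfl : t = 1 := by linarith
    simpa using hy
  rcases ht.eq_or_lt with rfl | ht
  · obtain rfl : s = 1 := by linarith
    simpa using hx
  simp only [LexLt, mem_ofPred_eq] at hx hy ⊢
  simp only [Pi.add_apply, Pi.smul_apply, Complex.add_re, Complex.add_im, Complex.real_smul,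
    Complex.mul_re, Complex.mul_im, Complex.ofReal_re, Complex.ofReal_im, zero_mul, sub_zero,
    add_zero]
  rcases hx with hx | ⟨hx, hx'⟩ <;> rcases hy with hy | ⟨hy, hy'⟩
  · left; nlinarith
  · left; rw [hy]; nlinarith
  · left; rw [hx]; nlinarith
  · right; rw [hx, hy]; exact ⟨rfl, by nlinarith⟩

theorem convex_lexCell (π : Equiv.Perm (Fin N)) : Convex ℝ (lexCell π) := by
  simp only [lexCell, ofPred_forall]
  exact convex_iInter fun p => convex_iInter fun q => convex_iInter fun _ => convex_lexLt _ _

/-- The neighbourhood of `z` where all comparisons which are robust at `z` persist. -/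
def lexNhd (z : Fin N → ℂ) : Set (Fin N → ℂ) :=
  {e | ∀ a b, ((z a).re < (z b).re → (e a).re < (e b).re) ∧
    ((z a).re = (z b).re → (z a).im < (z b).im → (e a).im < (e b).im)}

theorem convex_lexNhd (z : Fin N → ℂ) : Convex ℝ (lexNhd z) := by
  simp only [lexNhd, ofPred_forall, ofPred_and]
  exact convex_iInter fun p => convex_iInter fun q =>
    (convex_iInter fun _ => convex_re_lt _ _).inter
      (convex_iInter fun _ => convex_iInter fun _ => convex_im_lt _ _)

theorem isOpen_lexNhd (z : Fin N → ℂ) : IsOpen (lexNhd z) := by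
  simp only [lexNhd, ofPred_forall, ofPred_and]
  refine isOpen_iInter_of_finite fun a => isOpen_iInter_of_finite fun b => IsOpen.inter ?_ ?_
  · exact isOpen_iInter_of_finite fun _ => isOpen_lt (by fun_prop) (by fun_prop)
  · exact isOpen_iInter_of_finite fun _ => isOpen_iInter_of_finite fun _ =>
      isOpen_lt (by fun_prop) (by fun_prop)

theorem self_mem_lexNhd (z : Fin N → ℂ) : z ∈ lexNhd z := fun _ _ => ⟨id, fun _ => id⟩

theorem lexNhd_subset {z : Fin N → ℂ} (hz : z ∈ planeConf N) : lexNhd z ⊆ planeConf N := by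
  intro e he a b hab
  by_contra hne
  rcases lexLt_or (fun h => hne (hz h)) with h | h <;> rcases h with h | ⟨h, h'⟩
  · exact ((he a b).1 h).ne (by rw [hab])
  · exact ((he a b).2 h h').ne (by rw [hab])
  · exact ((he b a).1 h).ne (by rw [hab])
  · exact ((he b a).2 h h').ne (by rw [hab])

theorem comp_mem_lexNhd {z e : Fin N → ℂ} (ρ : Equiv.Perm (Fin N)) :
    e ∘ ρ ∈ lexNhd (z ∘ ρ) ↔ e ∈ lexNhd z := by
  constructor
  · intro h a b
    simpa using h (ρ.symm a) (ρ.symm b)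
  · intro h a b
    exact h (ρ a) (ρ b)

/-- The relative position of the label orders multiplies positively. -/
theorem lexLabel_cocycle {G : Type*} [Group G] {b : ℕ → G} (hb : ArtinFam N b)
    {z e e' : Fin N → ℂ} (hz : z ∈ planeConf N) (he : e ∈ lexNhd z) (he' : e' ∈ lexNhd e) :
    posLift b ((lexLabel z)⁻¹ * lexLabel e') =
      posLift b ((lexLabel z)⁻¹ * lexLabel e) * posLift b ((lexLabel e)⁻¹ * lexLabel e') := by
  have heF := lexNhd_subset hz he
  have heF' := lexNhd_subset heF he'
  rw [← posLift_mul hb]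
  · congr 1
    group
  · intro p q hpq h
    simp only [Equiv.Perm.mul_apply, Equiv.Perm.inv_def, Equiv.apply_symm_apply] at h ⊢
    simp only [← Equiv.Perm.inv_def] at h ⊢
    have h1 := mem_lexCell heF' p q hpq
    rw [lexLabel_symm_lt_iff heF] at h
    rw [lexLabel_symm_lt_iff hz]
    set x := lexLabel e' p
    set y := lexLabel e' q
    have hne : y ≠ x := by rintro h; rw [h] at h1; exact h1.asymm h1
    have h2 : (e y).re = (e x).re ∧ (e y).im < (e x).im := by
      rcases h with h | h
      · exact absurd (Or.inl ((he' y x).1 h)) fun h' => h1.asymm h'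
      · exact h
    rcases lexLt_or (fun h => hne (hz h)) with h3 | h3
    · exact h3
    · rcases h3 with h3 | ⟨h3, h4⟩
      · exact absurd ((he x y).1 h3) (by rw [h2.1]; exact lt_irrefl _)
      · exact absurd ((he x y).2 h3 h4) h2.2.le.not_gt

/-- The path functor from plane configurations to a group generated by braid generators. -/
theorem exists_braidHom {G : Type*} [Group G] {b : ℕ → G} (hb : ArtinFam N b) :
    ∃ Ψ : PathHom (planeConf N) G, ∀ (x : planeConf N) {y z : planeConf N} (p : Path y z),
      (∀ t, (p t : Fin N → ℂ) ∈ lexNhd (x : Fin N → ℂ)) →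
      Ψ.val p = (posLift b ((lexLabel (x : Fin N → ℂ))⁻¹ * lexLabel (y : Fin N → ℂ)))⁻¹ *
        posLift b ((lexLabel (x : Fin N → ℂ))⁻¹ * lexLabel (z : Fin N → ℂ)) := by
  obtain ⟨Ψ, h⟩ := exists_pathHom_of_cocycle
    (fun x y : planeConf N => posLift b
      ((lexLabel (x : Fin N → ℂ))⁻¹ * lexLabel (y : Fin N → ℂ)))
    (fun x => Subtype.val ⁻¹' lexNhd (x : Fin N → ℂ))
    (fun x => (isOpen_lexNhd _).preimage continuous_subtype_val)
    (fun x => self_mem_lexNhd _) (by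
      intro x y hy
      filter_upwards [((isOpen_lexNhd (y : Fin N → ℂ)).preimage
        continuous_subtype_val).mem_nhds (self_mem_lexNhd _)] with z hz
      exact lexLabel_cocycle hb x.2 hy hz)
  exact ⟨Ψ, fun x y z p hp => h x p (range_subset_iff.2 hp)⟩

end Config

section BraidHom

variable {N : ℕ} {Γ : Type*} [Group Γ]

/-- A path functor on plane configurations which ignores labels and is trivial on cells. -/
structure IsBraidHom (W : PathHom (planeConf N) Γ) : Prop where
  inv : ∀ (ρ : Equiv.Perm (Fin N)) {a b : planeConf N} (p : Path a b),
    W.val (p.map (permuteLabels ρ).continuous) = W.val p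
  cell : ∀ (π : Equiv.Perm (Fin N)), ∀ a ∈ lexCell π, ∀ b ∈ lexCell π, W.seg a b = 1

theorem seg_comp {W : PathHom (planeConf N) Γ}
    (hW : ∀ (ρ : Equiv.Perm (Fin N)) {a b : planeConf N} (p : Path a b),
      W.val (p.map (permuteLabels ρ).continuous) = W.val p)
    (ρ : Equiv.Perm (Fin N)) {a b : Fin N → ℂ}
    (h : segment ℝ a b ⊆ planeConf N) : W.seg (a ∘ ρ) (b ∘ ρ) = W.seg a b := by
  have h' : segment ℝ (a ∘ ρ) (b ∘ ρ) ⊆ planeConf N := by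
    rintro _ ⟨s, t, hs, ht, hst, rfl⟩
    exact (h ⟨s, t, hs, ht, hst, rfl⟩ : Function.Injective _).comp ρ.injective
  have ha := h (left_mem_segment ℝ a b)
  have hb := h (right_mem_segment ℝ a b)
  rw [← W.val_segPath (a := ⟨a, ha⟩) (b := ⟨b, hb⟩) h, ← hW ρ]
  symm
  refine (W.val_eq_seg (convex_segment _ _) h' _ fun t => ?_)
  refine ⟨1 - t, t, by linarith [t.2.2], t.2.1, by ring, ?_⟩
  ext i
  change _ = (AffineMap.lineMap a b (t : ℝ) : Fin N → ℂ) (ρ i)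
  simp [AffineMap.lineMap_apply_module]

/-- The configuration with imaginary parts the labels, and real parts the positions. -/
def stdConf (u : Equiv.Perm (Fin N)) : Fin N → ℂ := fun j => ⟨((u⁻¹ j : Fin N) : ℕ), (j : ℕ)⟩

theorem stdConf_mem_lexCell (u : Equiv.Perm (Fin N)) : stdConf u ∈ lexCell u := by
  intro p q hpq
  left
  simpa [stdConf] using hpq

/-- Configurations with increasing imaginary parts. -/
def imCone (N : ℕ) : Set (Fin N → ℂ) := {z | ∀ p q, p < q → (z p).im < (z q).im}

theorem convex_imCone : Convex ℝ (imCone N) := by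
  simp only [imCone, ofPred_forall]
  exact convex_iInter fun p => convex_iInter fun q => convex_iInter fun _ => convex_im_lt _ _

theorem imCone_subset : imCone N ⊆ planeConf N := by
  intro z hz a b hab
  rcases lt_trichotomy a b with h | h | h
  · exact absurd (congrArg Complex.im hab) (hz _ _ h).ne
  · exact h
  · exact absurd (congrArg Complex.im hab) (hz _ _ h).ne'

theorem stdConf_mem_imCone (u : Equiv.Perm (Fin N)) : stdConf u ∈ imCone N := by
  intro p q hpq
  simpa [stdConf] using hpq

/-- Configurations in standard order except possibly for one neighbouring pair, whose
imaginary parts increase. -/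
def swapCone (N i : ℕ) : Set (Fin N → ℂ) :=
  {z | ∀ p q : Fin N, p < q → (¬ ((p : ℕ) = i ∧ (q : ℕ) = i + 1) → LexLt (z p) (z q)) ∧
    ((p : ℕ) = i ∧ (q : ℕ) = i + 1 → (z p).im < (z q).im)}

theorem convex_swapCone (i : ℕ) : Convex ℝ (swapCone N i) := by
  simp only [swapCone, ofPred_forall, ofPred_and]
  exact convex_iInter fun p => convex_iInter fun q => convex_iInter fun _ =>
    (convex_iInter fun _ => convex_lexLt _ _).inter (convex_iInter fun _ => convex_im_lt _ _)

theorem swapCone_subset (i : ℕ) : swapCone N i ⊆ planeConf N := by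
  intro z hz
  have : ∀ p q, p < q → z p ≠ z q := by
    intro p q hpq e
    by_cases h : (p : ℕ) = i ∧ (q : ℕ) = i + 1
    · exact ((hz p q hpq).2 h).ne (by rw [e])
    · have := (hz p q hpq).1 h
      rw [e] at this
      exact this.asymm this
  intro a b hab
  rcases lt_trichotomy a b with h | h | h
  · exact absurd hab (this _ _ h)
  · exact h
  · exact absurd hab.symm (this _ _ h)

/-- The value on a half twist of two neighbouring points. -/
def genVal (W : PathHom (planeConf N) Γ) (i : ℕ) : Γ := W.seg (stdConf 1) (stdConf (adj N i))

theorem mem_swapCone_aux {i : ℕ} (hi : i + 1 < N) {u : Equiv.Perm (Fin N)} (hu : Ascent u i)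
    (v : Equiv.Perm (Fin N)) (hv : v = 1 ∨ v = adj N i) :
    stdConf (u * v) ∘ u ∈ swapCone N i := by
  intro p q hpq
  refine ⟨fun h => Or.inl ?_, fun h => ?_⟩
  · have h2 : ((v⁻¹ p : Fin N) : ℕ) < (v⁻¹ q : Fin N) := by
      rcases hv with rfl | rfl
      · simpa using hpq
      · have : (adj N i)⁻¹ = adj N i := inv_eq_of_mul_eq_one_right (adj_mul_self N i)
        rw [this, adj_val hi, adj_val hi]
        rw [Fin.lt_def] at hpq
        split_ifs <;> omega
    simpa [stdConf] using h2
  · rw [ascent_iff hi] at hu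
    have e1 : p = ⟨i, Nat.lt_of_succ_lt hi⟩ := Fin.ext h.1
    have e2 : q = ⟨i + 1, hi⟩ := Fin.ext h.2
    rw [e1, e2]
    simpa [stdConf] using hu

namespace IsBraidHom

variable {W : PathHom (planeConf N) Γ}

theorem seg_stdConf_mul_adj (hW : IsBraidHom W) {i : ℕ} {u : Equiv.Perm (Fin N)} (hu : Ascent u i) :
    W.seg (stdConf u) (stdConf (u * adj N i)) = genVal W i := by
  have hi : i + 1 < N := hu.1
  have h1 : Ascent (1 : Equiv.Perm (Fin N)) i := by rw [ascent_iff hi]; simp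
  rw [← seg_comp hW.inv u ((convex_imCone.segment_subset (stdConf_mem_imCone _)
    (stdConf_mem_imCone _)).trans imCone_subset), genVal]
  have m1 : stdConf u ∘ u ∈ swapCone N i := by
    simpa using mem_swapCone_aux hi hu 1 (Or.inl rfl)
  have m2 := mem_swapCone_aux hi hu _ (Or.inr rfl)
  have m3 : stdConf (1 : Equiv.Perm (Fin N)) ∈ swapCone N i := by
    simpa using mem_swapCone_aux hi h1 1 (Or.inl rfl)
  have m4 : stdConf (adj N i) ∈ swapCone N i := by
    simpa using mem_swapCone_aux hi h1 _ (Or.inr rfl)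
  rw [← W.seg_mul_seg (convex_swapCone i) (swapCone_subset i) m1 m3 m2,
    ← W.seg_mul_seg (convex_swapCone i) (swapCone_subset i) m3 m4 m2,
    hW.cell 1 _ (by simpa using comp_mem_lexCell (ρ := u).2 (stdConf_mem_lexCell u)) _
      (stdConf_mem_lexCell _), one_mul,
    hW.cell (adj N i) _ (stdConf_mem_lexCell _) _
      (by simpa using comp_mem_lexCell (ρ := u).2 (stdConf_mem_lexCell (u * adj N i))), mul_one]

theorem seg_stdConf_succ (hW : IsBraidHom W) {i : ℕ} {u : Equiv.Perm (Fin N)} (hu : Ascent u i) :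
    W.seg (stdConf 1) (stdConf (u * adj N i)) = W.seg (stdConf 1) (stdConf u) * genVal W i := by
  rw [← hW.seg_stdConf_mul_adj hu, W.seg_mul_seg convex_imCone imCone_subset] <;>
  exact stdConf_mem_imCone _

theorem artinFam (hW : IsBraidHom W) : ArtinFam N (genVal W) :=
  artinFam_of_fun (fun u => W.seg (stdConf 1) (stdConf u)) fun _ _ h => hW.seg_stdConf_succ h

theorem seg_stdConf (hW : IsBraidHom W) (u : Equiv.Perm (Fin N)) :
    W.seg (stdConf 1) (stdConf u) = posLift (genVal W) u := by
  have : ∀ g, PosWord (genVal W) u g → W.seg (stdConf 1) (stdConf u) = g := by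
    intro g hg
    induction hg with
    | one => exact W.seg_self
    | step _ _ _ _ h ih => rw [hW.seg_stdConf_succ h, ih]
  exact this _ (posLift_spec _ _)

theorem seg_imCone (hW : IsBraidHom W) {z e : Fin N → ℂ} (hz : z ∈ imCone N) (he : e ∈ imCone N)
    (h : lexLabel z = 1) : W.seg z e = posLift (genVal W) (lexLabel e) := by
  have hz' : z ∈ lexCell 1 := (lexLabel_eq_iff (imCone_subset hz) _).1 h
  rw [← W.seg_mul_seg convex_imCone imCone_subset hz (stdConf_mem_imCone 1) he,
    ← W.seg_mul_seg convex_imCone imCone_subset (stdConf_mem_imCone 1)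
      (stdConf_mem_imCone (lexLabel e)) he,
    hW.cell 1 _ hz' _ (stdConf_mem_lexCell _), one_mul, hW.cell _ _ (stdConf_mem_lexCell _) _
      (mem_lexCell (imCone_subset he)), mul_one, hW.seg_stdConf]

theorem seg_lexNhd_of_one (hW : IsBraidHom W) {z e : Fin N → ℂ} (hz : z ∈ lexCell 1)
    (he : e ∈ lexNhd z) : W.seg z e = posLift (genVal W) (lexLabel e) := by
  have hzF := lexCell_subset _ hz
  have heF := lexNhd_subset hzF he
  let f : (Fin N → ℂ) → Fin N → ℂ := fun x j => ⟨(x j).re, (j : ℕ)⟩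
  have key : ∀ x ∈ lexNhd z, f x ∈ imCone N ∧ f x ∈ lexNhd z ∧ f x ∈ lexCell (lexLabel x) := by
    intro x hx
    refine ⟨fun p q hpq => by simpa [f] using hpq, fun a b => ⟨fun h => (hx a b).1 h,
      fun h h' => ?_⟩, fun p q hpq => ?_⟩
    · rcases lt_trichotomy a b with hab | hab | hab
      · simpa [f] using hab
      · subst hab; exact absurd h' (lt_irrefl _)
      · rcases hz b a hab with h2 | h2
        · exact absurd h h2.ne'
        · exact absurd h2.2 h'.le.not_gt
    · have h1 := mem_lexCell (lexNhd_subset hzF hx) p q hpq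
      rcases h1 with h1 | ⟨h1, h2⟩
      · exact Or.inl h1
      · refine Or.inr ⟨h1, ?_⟩
        set a := lexLabel x p
        set b := lexLabel x q
        suffices a < b by simpa [f] using this
        rcases lt_trichotomy a b with hab | hab | hab
        · exact hab
        · rw [hab] at h2; exact absurd h2 (lt_irrefl _)
        · rcases hz b a hab with h3 | h3
          · exact absurd ((hx _ _).1 h3) h1.le.not_gt
          · exact absurd ((hx _ _).2 h3.1 h3.2) h2.le.not_gt
  obtain ⟨z1, z2, z3⟩ := key z (self_mem_lexNhd z)
  obtain ⟨e1, e2, e3⟩ := key e he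
  rw [lexLabel_of_mem hz] at z3
  have c := convex_lexNhd z
  have s := lexNhd_subset hzF
  rw [← W.seg_mul_seg c s (self_mem_lexNhd z) z2 he, ← W.seg_mul_seg c s z2 e2 he,
    hW.cell 1 _ hz _ z3, one_mul, hW.cell _ _ e3 _ (mem_lexCell heF), mul_one,
    hW.seg_imCone z1 e1 (lexLabel_of_mem z3), lexLabel_of_mem e3]

theorem seg_lexNhd (hW : IsBraidHom W) {z e : Fin N → ℂ} (hz : z ∈ planeConf N)
    (he : e ∈ lexNhd z) : W.seg z e = posLift (genVal W) ((lexLabel z)⁻¹ * lexLabel e) := by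
  have hs := ((convex_lexNhd z).segment_subset (self_mem_lexNhd z) he).trans (lexNhd_subset hz)
  rw [← seg_comp hW.inv (lexLabel z) hs, hW.seg_lexNhd_of_one
    (by simpa using comp_mem_lexCell (ρ := lexLabel z).2 (mem_lexCell hz))
    ((comp_mem_lexNhd _).2 he), lexLabel_comp (lexNhd_subset hz he)]

/-- The braid functor is universal. -/
theorem val_eq (hW : IsBraidHom W) {G : Type*} [Group G] {b : ℕ → G} {Ψ : PathHom (planeConf N) G}
    (hΨ : ∀ (x : planeConf N) {y z : planeConf N} (p : Path y z),
      (∀ t, (p t : Fin N → ℂ) ∈ lexNhd (x : Fin N → ℂ)) →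
      Ψ.val p = (posLift b ((lexLabel (x : Fin N → ℂ))⁻¹ * lexLabel (y : Fin N → ℂ)))⁻¹ *
        posLift b ((lexLabel (x : Fin N → ℂ))⁻¹ * lexLabel (z : Fin N → ℂ)))
    (φ : G →* Γ) (hφ : ∀ u : Equiv.Perm (Fin N), φ (posLift b u) = posLift (genVal W) u)
    {y z : planeConf N} (p : Path y z) : W.val p = φ (Ψ.val p) := by
  rw [← Ψ.push_val]
  refine PathHom.ext_of_local (fun x => Subtype.val ⁻¹' lexNhd (x : Fin N → ℂ))
    (fun x => ((isOpen_lexNhd _).preimage continuous_subtype_val).mem_nhds (self_mem_lexNhd _))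
    (fun x y z p hp => ?_) p
  have hp' := range_subset_iff.1 hp
  have c := convex_lexNhd (x : Fin N → ℂ)
  have s := lexNhd_subset x.2
  have hy : (y : Fin N → ℂ) ∈ lexNhd x := by simpa using hp' 0
  have hz : (z : Fin N → ℂ) ∈ lexNhd x := by simpa using hp' 1
  rw [Ψ.push_val, hΨ x p hp', W.val_eq_seg c s p hp', map_mul, map_inv, hφ, hφ,
    ← hW.seg_lexNhd x.2 hy, ← hW.seg_lexNhd x.2 hz, eq_inv_mul_iff_mul_eq,
    W.seg_mul_seg c s (self_mem_lexNhd _) hy hz]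

end IsBraidHom

/-- A label-independent functor becomes a braid functor after a change of trivialization. -/
theorem isBraidHom_gauge {W : PathHom (planeConf N) Γ}
    (hW : ∀ (ρ : Equiv.Perm (Fin N)) {a b : planeConf N} (p : Path a b),
      W.val (p.map (permuteLabels ρ).continuous) = W.val p) :
    IsBraidHom (W.gauge fun a => W.seg (stdConf 1) ((a : Fin N → ℂ) ∘ lexLabel (a : Fin N → ℂ)))
    where
  inv ρ a b p := by
    rw [PathHom.gauge_val, PathHom.gauge_val, hW]
    have : ∀ a : planeConf N,
        (permuteLabels ρ a : Fin N → ℂ) ∘ lexLabel (permuteLabels ρ a : Fin N → ℂ) =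
        (a : Fin N → ℂ) ∘ lexLabel (a : Fin N → ℂ) := by
      intro a
      rw [permuteLabels_coe, lexLabel_comp a.2]
      ext i
      simp
    rw [this, this]
  cell π a ha b hb := by
    have hs := ((convex_lexCell π).segment_subset ha hb).trans (lexCell_subset π)
    have ha' := lexCell_subset π ha
    have hb' := lexCell_subset π hb
    rw [← PathHom.val_segPath (a := ⟨a, ha'⟩) (b := ⟨b, hb'⟩) _ hs, PathHom.gauge_val,
      PathHom.val_segPath]
    simp only [lexLabel_of_mem ha, lexLabel_of_mem hb]
    have ha2 : a ∘ π ∈ lexCell 1 := by simpa using comp_mem_lexCell (ρ := π).2 ha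
    have hb2 : b ∘ π ∈ lexCell 1 := by simpa using comp_mem_lexCell (ρ := π).2 hb
    rw [← seg_comp hW π hs, W.seg_mul_seg (convex_lexCell 1) (lexCell_subset 1)
      (stdConf_mem_lexCell 1) ha2 hb2, mul_inv_cancel]

end BraidHom

section Universal

variable {N : ℕ} {G Γ : Type*} [Group G] [Group Γ]

theorem posLift_congr {a a' : ℕ → G} (ha : ArtinFam N a') (h : ∀ i, i + 1 < N → a i = a' i)
    (u : Equiv.Perm (Fin N)) : posLift a u = posLift a' u := by
  have : ∀ g, PosWord a u g → PosWord a' u g := by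
    intro g hg
    induction hg with
    | one => exact .one
    | step u g i _ hu ih => rw [h i hu.1]; exact .step u g i ih hu
  exact (this _ (posLift_spec a u)).eq ha

/-- The defining local property of the universal braid functor. -/
def IsUniversalBraid (b : ℕ → G) (Ψ : PathHom (planeConf N) G) : Prop :=
  ∀ (x : planeConf N) {y z : planeConf N} (p : Path y z),
      (∀ t, (p t : Fin N → ℂ) ∈ lexNhd (x : Fin N → ℂ)) →
      Ψ.val p = (posLift b ((lexLabel (x : Fin N → ℂ))⁻¹ * lexLabel (y : Fin N → ℂ)))⁻¹ *
        posLift b ((lexLabel (x : Fin N → ℂ))⁻¹ * lexLabel (z : Fin N → ℂ))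

namespace IsUniversalBraid

variable {b : ℕ → G} {Ψ : PathHom (planeConf N) G}

theorem isBraidHom (hΨ : IsUniversalBraid b Ψ) : IsBraidHom Ψ where
  inv ρ y z p := by
    rw [← Ψ.comap_val]
    refine PathHom.ext_of_local (fun x => Subtype.val ⁻¹' lexNhd (x : Fin N → ℂ))
      (fun x => ((isOpen_lexNhd _).preimage continuous_subtype_val).mem_nhds (self_mem_lexNhd _))
      (fun x y z p hp => ?_) p
    have hp' := range_subset_iff.1 hp
    rw [Ψ.comap_val, hΨ x p hp',
      hΨ (permuteLabels ρ x) (p.map (permuteLabels ρ).continuous)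
        fun t => (comp_mem_lexNhd ρ).2 (hp' t)]
    simp only [permuteLabels_coe, lexLabel_comp x.2, lexLabel_comp y.2, lexLabel_comp z.2]
    simp only [mul_inv_rev, inv_inv, mul_assoc, mul_inv_cancel_left]
  cell π a ha c hc := by
    let f : C(lexCell π, planeConf N) := ⟨fun x => ⟨x, lexCell_subset π x.2⟩, by fun_prop⟩
    have key : ∀ {y z : lexCell π} (p : Path y z), (Ψ.comap f).val p =
        ((Ψ.push (1 : G →* G)).comap f).val p := by
      refine PathHom.ext_of_local (fun x => f ⁻¹' (Subtype.val ⁻¹' lexNhd (x : Fin N → ℂ)))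
        (fun x => (((isOpen_lexNhd _).preimage continuous_subtype_val).preimage
          f.continuous).mem_nhds (self_mem_lexNhd _)) (fun x y z p hp => ?_)
      have hp' := range_subset_iff.1 hp
      rw [Ψ.comap_val, hΨ (f x) (p.map f.continuous) hp']
      have hy : lexLabel (f y : Fin N → ℂ) = π := lexLabel_of_mem y.2
      have hz : lexLabel (f z : Fin N → ℂ) = π := lexLabel_of_mem z.2
      rw [hy, hz, inv_mul_cancel, PathHom.comap_val, PathHom.push_val, MonoidHom.one_apply]
    have hs := (convex_lexCell π).segment_subset ha hc
    have k := key (segPath ⟨a, ha⟩ ⟨c, hc⟩ hs)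
    rw [PathHom.comap_val, PathHom.comap_val, PathHom.push_val, MonoidHom.one_apply] at k
    exact (Ψ.val_eq_seg (convex_lexCell π) (lexCell_subset π)
      ((segPath ⟨a, ha⟩ ⟨c, hc⟩ hs).map f.continuous)
      fun t => (segPath ⟨a, ha⟩ ⟨c, hc⟩ hs t).2).symm.trans k

theorem genVal_eq (hΨ : IsUniversalBraid b Ψ) (hb : ArtinFam N b) {i : ℕ} (hi : i + 1 < N) :
    genVal Ψ i = b i := by
  let x : Fin N → ℂ := fun j => ⟨if (j : ℕ) = i + 1 then i else (j : ℕ), (j : ℕ)⟩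
  have hx : x ∈ lexCell 1 := by
    intro p q hpq
    rw [Fin.lt_def] at hpq
    change LexLt (x p) (x q)
    simp only [x, LexLt]
    by_cases h : (p : ℕ) = i ∧ (q : ℕ) = i + 1
    · right
      rw [if_neg (by omega), if_pos h.2, h.1, h.2]
      simp
    · left
      split_ifs <;> norm_cast <;> omega
  have hstd : ∀ v : Equiv.Perm (Fin N), v = 1 ∨ v = adj N i → stdConf v ∈ lexNhd x := by
    intro v hv p q
    have e : (v⁻¹ : Equiv.Perm (Fin N)) = v := by
      rcases hv with rfl | rfl
      · simp
      · exact inv_eq_of_mul_eq_one_right (adj_mul_self N i)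
    simp only [x, stdConf, e]
    constructor
    · intro h
      rcases hv with rfl | rfl
      · simp only [Equiv.Perm.one_apply]
        split_ifs at h <;> norm_cast at * <;> omega
      · rw [adj_val hi, adj_val hi]
        split_ifs at * <;> norm_cast at * <;> omega
    · intro _ h
      exact h
  have h1 := hstd 1 (Or.inl rfl)
  have h2 := hstd _ (Or.inr rfl)
  have hxF := lexCell_subset _ hx
  have hs := ((convex_lexNhd x).segment_subset h1 h2).trans (lexNhd_subset hxF)
  rw [genVal, ← Ψ.val_segPath (a := ⟨_, lexNhd_subset hxF h1⟩) (b := ⟨_, lexNhd_subset hxF h2⟩) hs,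
    hΨ ⟨x, hxF⟩ _ fun t => segPath_mem _ _ _ (convex_lexNhd x) h1 h2 t]
  simp only [lexLabel_of_mem hx, lexLabel_of_mem (stdConf_mem_lexCell _)]
  simp [posLift_one hb, posLift_adj hb hi]

/-- Any braid functor factors through the universal one. -/
theorem factor (hΨ : IsUniversalBraid b Ψ) {W : PathHom (planeConf N) Γ} (hW : IsBraidHom W)
    (φ : G →* Γ) (hφ : ∀ i, i + 1 < N → φ (b i) = genVal W i)
    {y z : planeConf N} (p : Path y z) : W.val p = φ (Ψ.val p) := by
  have hφ' : ArtinFam N fun i => φ (b i) := by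
    have h := hW.artinFam
    refine ⟨fun i j hij hj => ?_, fun i hi => ?_⟩
    · simpa only [hφ i (by omega), hφ j (by omega)] using h.comm i j hij hj
    · simpa only [hφ i (by omega), hφ (i + 1) (by omega)] using h.braid i hi
  refine hW.val_eq hΨ φ (fun u => ?_) p
  rw [posLift_map φ hφ', posLift_congr hW.artinFam hφ]

end IsUniversalBraid

end Universal

section Rotation

variable {N : ℕ} {Γ : Type*} [Group Γ]

/-- The standard configuration. -/
def baseConf (N : ℕ) : planeConf N := ⟨stdConf 1, lexCell_subset 1 (stdConf_mem_lexCell 1)⟩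

theorem smul_mem_planeConf {c : ℂ} (hc : c ≠ 0) {z : Fin N → ℂ} (hz : z ∈ planeConf N) :
    c • z ∈ planeConf N := fun _ _ h => hz (mul_left_cancel₀ hc h)

/-- Rotated standard configurations. -/
def rotConf (N : ℕ) : C(ℝ, planeConf N) where
  toFun θ := ⟨Complex.exp (θ * Complex.I) • (baseConf N : Fin N → ℂ),
    smul_mem_planeConf (Complex.exp_ne_zero _) (baseConf N).2⟩
  continuous_toFun := by
    refine Continuous.subtype_mk ?_ _
    fun_prop

theorem rotConf_coe (θ : ℝ) : (rotConf N θ : Fin N → ℂ) =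
    Complex.exp (θ * Complex.I) • (baseConf N : Fin N → ℂ) := rfl

theorem rotConf_re (θ : ℝ) (j : Fin N) :
    ((rotConf N θ : Fin N → ℂ) j).re = (j : ℕ) * (Real.cos θ - Real.sin θ) := by
  simp [rotConf_coe, baseConf, stdConf, Complex.exp_mul_I, ← Complex.ofReal_cos,
    ← Complex.ofReal_sin]
  ring

theorem rotConf_im (θ : ℝ) (j : Fin N) :
    ((rotConf N θ : Fin N → ℂ) j).im = (j : ℕ) * (Real.cos θ + Real.sin θ) := by
  simp [rotConf_coe, baseConf, stdConf, Complex.exp_mul_I, ← Complex.ofReal_cos,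
    ← Complex.ofReal_sin]
  ring

theorem rotConf_add_int (θ : ℝ) (m : ℤ) : rotConf N (θ + m * (2 * Real.pi)) = rotConf N θ := by
  ext1
  rw [rotConf_coe, rotConf_coe]
  congr 1
  rw [Complex.exp_eq_exp_iff_exists_int]
  exact ⟨m, by push_cast; ring⟩

/-- The straight path on the real line. -/
def linePath (a b : ℝ) : Path a b where
  toFun t := a + t * (b - a)
  continuous_toFun := by fun_prop
  source' := by simp
  target' := by simp

theorem val_real_trans (W : PathHom ℝ Γ) (a b c : ℝ) :
    W.val (linePath a c) = W.val (linePath a b) * W.val (linePath b c) := by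
  rw [← W.val_trans]
  exact W.val_homotopic (SimplyConnectedSpace.paths_homotopic _ _)

theorem val_linePath_rot (W : PathHom (planeConf N) Γ) {S : Set (Fin N → ℂ)} (hS : Convex ℝ S)
    (hSF : S ⊆ planeConf N) {a b : ℝ} (hab : a ≤ b)
    (h : ∀ θ, a ≤ θ → θ ≤ b → (rotConf N θ : Fin N → ℂ) ∈ S) :
    (W.comap (rotConf N)).val (linePath a b) = W.seg (rotConf N a) (rotConf N b) := by
  rw [W.comap_val]
  refine W.val_eq_seg hS hSF _ fun t => ?_
  refine h _ ?_ ?_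
  · change a ≤ a + t * (b - a)
    nlinarith [t.2.1]
  · change a + t * (b - a) ≤ b
    nlinarith [t.2.2]

theorem garside_adj_inv : (garside (adj N) N)⁻¹ = garside (adj N) N := by
  refine inv_eq_of_mul_eq_one_right ?_
  ext p
  rw [Equiv.Perm.mul_apply, garside_adj_val le_rfl, garside_adj_val le_rfl, Equiv.Perm.one_apply]
  split_ifs <;> omega

theorem cast_mul_lt {p q : Fin N} (h : p < q) {x : ℝ} (hx : 0 < x) :
    ((p : ℕ) : ℝ) * x < ((q : ℕ) : ℝ) * x :=
  mul_lt_mul_of_pos_right (by exact_mod_cast h) hx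

theorem rotConf_mem_imCone {θ : ℝ} (h : 0 < Real.cos θ + Real.sin θ) :
    (rotConf N θ : Fin N → ℂ) ∈ imCone N := by
  intro p q hpq
  rw [rotConf_im, rotConf_im]
  exact cast_mul_lt hpq h

theorem rotConf_mem_lexCell_one {θ : ℝ} (h : 0 < Real.cos θ - Real.sin θ) :
    (rotConf N θ : Fin N → ℂ) ∈ lexCell 1 := by
  intro p q hpq
  left
  rw [Equiv.Perm.one_apply, Equiv.Perm.one_apply, rotConf_re, rotConf_re]
  exact cast_mul_lt hpq h

theorem garside_adj_lt {p q : Fin N} (h : p < q) :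
    garside (adj N) N q < garside (adj N) N p := by
  rw [Fin.lt_def] at *
  rw [garside_adj_val le_rfl, garside_adj_val le_rfl]
  split_ifs <;> omega

theorem rotConf_mem_lexCell_rev {θ : ℝ} (h : Real.cos θ - Real.sin θ < 0) :
    (rotConf N θ : Fin N → ℂ) ∈ lexCell (garside (adj N) N) := by
  intro p q hpq
  left
  rw [rotConf_re, rotConf_re]
  have := cast_mul_lt (garside_adj_lt hpq) (neg_pos.2 h)
  linarith

theorem rotConf_comp_mem_imCone {θ : ℝ} (h : Real.cos θ + Real.sin θ < 0) :
    (rotConf N θ : Fin N → ℂ) ∘ ⇑(garside (adj N) N) ∈ imCone N := by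
  intro p q hpq
  simp only [Function.comp]
  rw [rotConf_im, rotConf_im]
  have := cast_mul_lt (garside_adj_lt hpq) (neg_pos.2 h)
  linarith

theorem IsBraidHom.val_rot {W : PathHom (planeConf N) Γ} (hW : IsBraidHom W) :
    (W.comap (rotConf N)).val (linePath 0 (2 * Real.pi)) = garside (genVal W) N ^ 2 := by
  have hpi := Real.pi_pos
  rw [val_real_trans _ 0 (Real.pi / 2), val_real_trans _ (Real.pi / 2) Real.pi,
    val_real_trans _ Real.pi (3 * Real.pi / 2)]
  have cs : ∀ θ : ℝ, Real.cos θ ^ 2 + Real.sin θ ^ 2 = 1 := Real.cos_sq_add_sin_sq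
  have s3 : ∀ θ, Real.pi ≤ θ → θ ≤ 2 * Real.pi → Real.sin θ ≤ 0 := by
    intro θ h1 h2
    rw [← Real.sin_sub_two_pi]
    exact Real.sin_nonpos_of_nonpos_of_neg_pi_le (by linarith) (by linarith)
  have c4 : ∀ θ, 3 * Real.pi / 2 ≤ θ → θ ≤ 2 * Real.pi → 0 ≤ Real.cos θ := by
    intro θ h1 h2
    rw [← Real.cos_sub_two_pi]
    exact Real.cos_nonneg_of_mem_Icc ⟨by linarith, by linarith⟩
  have q1 : ∀ θ, 0 ≤ θ → θ ≤ Real.pi / 2 → 0 < Real.cos θ + Real.sin θ := by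
    intro θ h1 h2
    have := Real.sin_nonneg_of_mem_Icc (x := θ) ⟨h1, by linarith⟩
    have := Real.cos_nonneg_of_mem_Icc (x := θ) ⟨by linarith, h2⟩
    nlinarith [cs θ]
  have q2 : ∀ θ, Real.pi / 2 ≤ θ → θ ≤ Real.pi → Real.cos θ - Real.sin θ < 0 := by
    intro θ h1 h2
    have := Real.sin_nonneg_of_mem_Icc (x := θ) ⟨by linarith, h2⟩
    have := Real.cos_nonpos_of_pi_div_two_le_of_le h1 (by linarith)
    nlinarith [cs θ]
  have q3 : ∀ θ, Real.pi ≤ θ → θ ≤ 3 * Real.pi / 2 → Real.cos θ + Real.sin θ < 0 := by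
    intro θ h1 h2
    have := s3 θ h1 (by linarith)
    have := Real.cos_nonpos_of_pi_div_two_le_of_le (x := θ) (by linarith) (by linarith)
    nlinarith [cs θ]
  have q4 : ∀ θ, 3 * Real.pi / 2 ≤ θ → θ ≤ 2 * Real.pi → 0 < Real.cos θ - Real.sin θ := by
    intro θ h1 h2
    have := s3 θ (by linarith) h2
    have := c4 θ h1 h2
    nlinarith [cs θ]
  have e1 : (W.comap (rotConf N)).val (linePath 0 (Real.pi / 2)) = garside (genVal W) N := by
    rw [val_linePath_rot W convex_imCone imCone_subset (by linarith) fun θ h1 h2 =>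
      rotConf_mem_imCone (q1 θ h1 h2), hW.seg_imCone (rotConf_mem_imCone (q1 _ (by linarith)
      (by linarith))) (rotConf_mem_imCone (q1 _ (by linarith) (by linarith)))
      (lexLabel_of_mem (rotConf_mem_lexCell_one (by simp))),
      lexLabel_of_mem (rotConf_mem_lexCell_rev (by simp)), posLift_garside hW.artinFam le_rfl]
  have e2 : (W.comap (rotConf N)).val (linePath (Real.pi / 2) Real.pi) = 1 := by
    rw [val_linePath_rot W (convex_lexCell _) (lexCell_subset _) (by linarith) fun θ h1 h2 =>
      rotConf_mem_lexCell_rev (q2 θ h1 h2)]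
    exact hW.cell _ _ (rotConf_mem_lexCell_rev (q2 _ (by linarith) (by linarith))) _
      (rotConf_mem_lexCell_rev (q2 _ (by linarith) (by linarith)))
  have e3 : (W.comap (rotConf N)).val (linePath Real.pi (3 * Real.pi / 2)) =
      garside (genVal W) N := by
    rw [W.comap_val, ← hW.inv (garside (adj N) N)]
    rw [W.val_eq_seg convex_imCone imCone_subset _ fun t => ?_]
    · have m3 := fun θ h1 h2 => rotConf_comp_mem_imCone (N := N) (q3 θ h1 h2)
      simp only [permuteLabels_coe]
      rw [hW.seg_imCone (m3 _ (by linarith) (by linarith)) (m3 _ (by linarith) (by linarith)),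
        lexLabel_comp (rotConf N _).2, lexLabel_of_mem
        (rotConf_mem_lexCell_one (q4 _ (by linarith) (by linarith))), mul_one, garside_adj_inv,
        posLift_garside hW.artinFam le_rfl]
      rw [lexLabel_comp (rotConf N _).2, lexLabel_of_mem (rotConf_mem_lexCell_rev (by simp)),
        inv_mul_cancel]
    · refine rotConf_comp_mem_imCone (q3 _ ?_ ?_)
      · change Real.pi ≤ Real.pi + t * (3 * Real.pi / 2 - Real.pi)
        nlinarith [t.2.1]
      · change Real.pi + t * (3 * Real.pi / 2 - Real.pi) ≤ 3 * Real.pi / 2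
        nlinarith [t.2.2]
  have e4 : (W.comap (rotConf N)).val (linePath (3 * Real.pi / 2) (2 * Real.pi)) = 1 := by
    rw [val_linePath_rot W (convex_lexCell _) (lexCell_subset _) (by linarith) fun θ h1 h2 =>
      rotConf_mem_lexCell_one (q4 θ h1 h2)]
    exact hW.cell _ _ (rotConf_mem_lexCell_one (q4 _ (by linarith) (by linarith))) _
      (rotConf_mem_lexCell_one (q4 _ (by linarith) (by linarith)))
  rw [e1, e2, e3, e4, one_mul, mul_one, pow_two]

theorem val_rot_int (W : PathHom (planeConf N) Γ) (m : ℤ) :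
    (W.comap (rotConf N)).val (linePath 0 (m * (2 * Real.pi))) =
      (W.comap (rotConf N)).val (linePath 0 (2 * Real.pi)) ^ m := by
  have step : ∀ m : ℤ, (W.comap (rotConf N)).val (linePath (m * (2 * Real.pi))
      ((m + 1 : ℤ) * (2 * Real.pi))) = (W.comap (rotConf N)).val (linePath 0 (2 * Real.pi)) := by
    intro m
    rw [W.comap_val, W.comap_val]
    refine W.val_congr _ _ fun t => ?_
    change rotConf N (m * (2 * Real.pi) + t * ((m + 1 : ℤ) * (2 * Real.pi) - m * (2 * Real.pi))) =
      rotConf N (0 + t * (2 * Real.pi - 0))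
    rw [← rotConf_add_int (0 + t * (2 * Real.pi - 0)) m]
    congr 1
    push_cast
    ring
  induction m using Int.induction_on with
  | zero =>
    rw [zpow_zero]
    have : (W.comap (rotConf N)).val (linePath 0 ((0 : ℤ) * (2 * Real.pi))) =
      (W.comap (rotConf N)).val (Path.refl 0) :=
      PathHom.val_congr _ _ _ fun t => by simp [linePath]
    rw [this, PathHom.val_refl]
  | succ m ih =>
    rw [val_real_trans _ 0 (((m : ℤ) : ℝ) * (2 * Real.pi)), ih, zpow_add_one, step]
  | pred m ih =>
    have := val_real_trans (W.comap (rotConf N)) 0 (((-(m : ℤ) - 1 : ℤ) : ℝ) * (2 * Real.pi))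
      (((-(m : ℤ) : ℤ) : ℝ) * (2 * Real.pi))
    rw [ih] at this
    have s := step (-(m : ℤ) - 1)
    rw [sub_add_cancel] at s
    rw [s] at this
    rw [zpow_sub_one, this, mul_inv_cancel_right]

end Rotation

section Realize

variable {N : ℕ} {G Γ : Type*} [Group G] [Group Γ]

theorem exists_realization {b : ℕ → G} {Ψ : PathHom (planeConf N) G} (hΨ : IsUniversalBraid b Ψ)
    (hb : ArtinFam N b) (P : G →* Equiv.Perm (Fin N)) (hP : ∀ i, i + 1 < N → P (b i) = adj N i)
    {g : G} (hg : g ∈ Subgroup.closure (b '' {i | i + 1 < N})) :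
    ∃ (c : planeConf N) (γ : Path (baseConf N) c), c = permuteLabels (P g)⁻¹ (baseConf N) ∧
      Ψ.val γ = g := by
  have hW := hΨ.isBraidHom
  induction hg using Subgroup.closure_induction with
  | mem x hx =>
    obtain ⟨i, hi, rfl⟩ := hx
    have h1 := stdConf_mem_imCone (1 : Equiv.Perm (Fin N))
    have h2 := stdConf_mem_imCone (adj N i)
    have hs : segment ℝ (baseConf N : Fin N → ℂ) (stdConf (adj N i)) ⊆ planeConf N :=
      (convex_imCone.segment_subset h1 h2).trans imCone_subset
    have h3 := stdConf_mem_lexCell (adj N i)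
    have h4 : (permuteLabels (P (b i))⁻¹ (baseConf N) : Fin N → ℂ) ∈ lexCell (adj N i) := by
      have := (comp_mem_lexCell (ρ := (P (b i))⁻¹)).2 (stdConf_mem_lexCell (1 : Equiv.Perm (Fin N)))
      rw [inv_inv, mul_one, hP i hi] at this
      rwa [hP i hi]
    have hs' := ((convex_lexCell _).segment_subset h3 h4).trans (lexCell_subset _)
    refine ⟨_, (segPath (baseConf N) ⟨_, imCone_subset h2⟩ hs).trans
      (segPath _ (permuteLabels (P (b i))⁻¹ (baseConf N)) hs'), rfl, ?_⟩
    have e1 : Ψ.val (segPath (baseConf N) ⟨_, imCone_subset h2⟩ hs) = b i :=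
      (Ψ.val_segPath _).trans (hΨ.genVal_eq hb hi)
    have e2 : Ψ.val (segPath ⟨_, imCone_subset h2⟩
        (permuteLabels (P (b i))⁻¹ (baseConf N)) hs') = 1 :=
      (Ψ.val_segPath _).trans (hW.cell _ _ h3 _ h4)
    rw [Ψ.val_trans, e1, e2, mul_one]
  | one =>
    exact ⟨_, Path.refl _, by ext; simp [permuteLabels], Ψ.val_refl _⟩
  | mul x y _ _ ihx ihy =>
    obtain ⟨c, γ, rfl, e1⟩ := ihx
    obtain ⟨d, δ, rfl, e2⟩ := ihy
    refine ⟨_, γ.trans (δ.map (permuteLabels (P x)⁻¹).continuous), ?_, ?_⟩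
    · ext; simp [permuteLabels]
    · rw [Ψ.val_trans, hW.inv, e1, e2]
  | inv x _ ih =>
    obtain ⟨c, γ, rfl, e1⟩ := ih
    refine ⟨_, (γ.symm.map (permuteLabels (P x)).continuous).cast ?_ rfl, ?_, ?_⟩
    · ext; simp [permuteLabels]
    · simp
    · rw [Ψ.val_cast, hW.inv, Ψ.val_symm, e1]

end Realize

section Normalize

variable {N : ℕ} {Γ : Type*} [Group Γ]

theorem exists_log_path (f : C(I, ℂ)) (hf : ∀ t, f t ≠ 0) (h0 : f 0 = 1) :
    ∃ c : C(I, ℂ), c 0 = 0 ∧ ∀ t, Complex.exp (c t) = f t := by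
  let g : C(I, {z : ℂ // z ≠ 0}) := ⟨fun t => ⟨f t, hf t⟩, by fun_prop⟩
  have hg : g 0 = ⟨Complex.exp 0, Complex.exp_ne_zero 0⟩ := by
    ext; simpa [g] using h0
  refine ⟨Complex.isCoveringMap_exp.liftPath g 0 hg,
    Complex.isCoveringMap_exp.liftPath_zero g 0 hg, fun t => ?_⟩
  have := congrFun (Complex.isCoveringMap_exp.liftPath_lifts g 0 hg) t
  exact congrArg Subtype.val this

/-- The action of complex affine maps on configurations. -/
def affConf (N : ℕ) : C((ℂ × ℂ) × planeConf N, planeConf N) where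
  toFun x := ⟨fun j => Complex.exp x.1.1 * (x.2 : Fin N → ℂ) j + x.1.2, fun _ _ h =>
    x.2.2 (mul_left_cancel₀ (Complex.exp_ne_zero _) (add_right_cancel h))⟩
  continuous_toFun := by
    refine Continuous.subtype_mk (continuous_pi fun j => ?_) _
    have : Continuous fun x : (ℂ × ℂ) × planeConf N => (x.2 : Fin N → ℂ) j :=
      (continuous_apply j).comp (continuous_subtype_val.comp continuous_snd)
    fun_prop

/-- A loop of configurations which is trivial modulo affine maps is a rotation. -/
theorem IsBraidHom.val_affine {W : PathHom (planeConf N) Γ} (hW : IsBraidHom W)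
    (γ δ : Path (baseConf N) (baseConf N)) (hδ : δ.Homotopic (Path.refl _))
    (f : C(I, ℂ)) (hf : ∀ t, f t ≠ 0) (h0 : f 0 = 1) (h1 : f 1 = 1)
    (b : C(I, ℂ)) (hb0 : b 0 = 0) (hb1 : b 1 = 0)
    (h : ∀ t j, (γ t : Fin N → ℂ) j = f t * (δ t : Fin N → ℂ) j + b t) :
    ∃ m : ℤ, W.val γ = (garside (genVal W) N ^ 2) ^ m := by
  obtain ⟨c, hc0, hc⟩ := exists_log_path f hf h0
  obtain ⟨m, hm⟩ := Complex.exp_eq_one_iff.1 ((hc 1).trans h1)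
  refine ⟨m, ?_⟩
  let p : Path ((0, 0) : ℂ × ℂ) (m * (2 * Real.pi * Complex.I), 0) :=
    ⟨⟨fun t => (c t, b t), by fun_prop⟩, by simp [hc0, hb0], by simp [hm, hb1]⟩
  have e1 : W.val γ = (W.comap (affConf N)).val (p.prod δ) := by
    rw [W.comap_val]
    refine W.val_congr _ _ fun t => ?_
    ext j
    rw [h, ← hc]
    rfl
  have hcont : Continuous fun θ : ℝ => ((θ * Complex.I, 0) : ℂ × ℂ) := by fun_prop
  let p' : Path ((0, 0) : ℂ × ℂ) (m * (2 * Real.pi * Complex.I), 0) :=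
    ((linePath 0 (m * (2 * Real.pi))).map hcont).cast (by simp) (by push_cast; simp [mul_assoc])
  have e2 : (p.prod δ).Homotopic (p'.prod (Path.refl _)) :=
    Nonempty.map2 Path.Homotopic.prodHomotopy (SimplyConnectedSpace.paths_homotopic p p') hδ
  rw [e1, PathHom.val_homotopic _ e2, ← hW.val_rot, ← val_rot_int, PathHom.comap_val,
    PathHom.comap_val]
  refine W.val_congr _ _ fun t => ?_
  ext j
  change Complex.exp _ * _ + 0 = Complex.exp _ • _
  rw [add_zero]
  rfl

end Normalize

section Frames

variable {ι : Type*}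

/-- The coordinates of `a ∧ b`. -/
def wedge (a b : ι → ℂ) (i j : ι) : ℂ := a i * b j - a j * b i

theorem wedge_comb (u v : ι → ℂ) (a b c d : ℂ) (i j : ι) :
    wedge (a • u + b • v) (c • u + d • v) i j = (a * d - b * c) * wedge u v i j := by
  simp only [wedge, Pi.add_apply, Pi.smul_apply, smul_eq_mul]
  ring

variable [Fintype ι]

/-- The Hermitian pairing of `a ∧ b` and `c ∧ d`. -/
def wedgePairing (a b c d : ι → ℂ) : ℂ := ∑ i, ∑ j, wedge a b i j * star (wedge c d i j)

theorem wedgePairing_comb (u v : ι → ℂ) (a b c d a' b' c' d' : ℂ) :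
    wedgePairing (a • u + b • v) (c • u + d • v) (a' • u + b' • v) (c' • u + d' • v) =
      (a * d - b * c) * star (a' * d' - b' * c') * wedgePairing u v u v := by
  simp only [wedgePairing, wedge_comb, star_mul', Finset.mul_sum]
  refine Finset.sum_congr rfl fun i _ => Finset.sum_congr rfl fun j _ => ?_
  ring

theorem wedgePairing_self_ne_zero_iff {u v : ι → ℂ} :
    wedgePairing u v u v ≠ 0 ↔ ∃ i j, wedge u v i j ≠ 0 := by
  have h : wedgePairing u v u v = ((∑ i, ∑ j, ‖wedge u v i j‖ ^ 2 : ℝ) : ℂ) := by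
    simp only [wedgePairing, Complex.ofReal_sum, Complex.ofReal_pow]
    refine Finset.sum_congr rfl fun i _ => Finset.sum_congr rfl fun j _ => ?_
    exact Complex.mul_conj' _
  have h' : ∀ i, ∑ j, ‖wedge u v i j‖ ^ 2 = 0 ↔ ∀ j, wedge u v i j = 0 := fun i => by
    rw [Finset.sum_eq_zero_iff_of_nonneg fun _ _ => by positivity]
    simp
  rw [h, Complex.ofReal_ne_zero, Ne, Finset.sum_eq_zero_iff_of_nonneg fun _ _ => by positivity]
  simp [h']

theorem wedgePairing_self_ne_zero_iff_linearIndependent {u v : ι → ℂ} :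
    wedgePairing u v u v ≠ 0 ↔ LinearIndependent ℂ ![u, v] := by
  rw [wedgePairing_self_ne_zero_iff, LinearIndependent.pair_iff]
  constructor
  · rintro ⟨i, j, h⟩ s t hst
    have hi := congrFun hst i
    have hj := congrFun hst j
    simp only [Pi.add_apply, Pi.smul_apply, smul_eq_mul, Pi.zero_apply] at hi hj
    unfold wedge at h
    constructor
    · refine (mul_eq_zero.1 (?_ : s * (u i * v j - u j * v i) = 0)).resolve_right h
      linear_combination v j * hi - v i * hj
    · refine (mul_eq_zero.1 (?_ : t * (u i * v j - u j * v i) = 0)).resolve_right h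
      linear_combination u i * hj - u j * hi
  · intro h
    by_contra! h0
    by_cases hu : u = 0
    · exact one_ne_zero (h 1 0 (by simp [hu])).1
    · obtain ⟨i, hi⟩ := Function.ne_iff.1 hu
      refine hi (h (-v i) (u i) ?_).2
      ext j
      have := h0 i j
      simp only [wedge] at this
      simp only [Pi.add_apply, Pi.smul_apply, smul_eq_mul, Pi.zero_apply]
      linear_combination this

variable (ι) in
/-- The space of pairs of linearly independent vectors. -/
def frames : Set ((ι → ℂ) × (ι → ℂ)) := {f | wedgePairing f.1 f.2 f.1 f.2 ≠ 0}

theorem mem_frames {f : (ι → ℂ) × (ι → ℂ)} : f ∈ frames ι ↔ LinearIndependent ℂ ![f.1, f.2] :=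
  wedgePairing_self_ne_zero_iff_linearIndependent

theorem continuous_wedgePairing {T : Type*} [TopologicalSpace T] {a b c d : T → ι → ℂ}
    (ha : Continuous a) (hb : Continuous b) (hc : Continuous c) (hd : Continuous d) :
    Continuous fun t => wedgePairing (a t) (b t) (c t) (d t) := by
  unfold wedgePairing wedge
  fun_prop

theorem isOpen_frames : IsOpen (frames ι) :=
  isOpen_ne_fun (continuous_wedgePairing continuous_fst continuous_snd continuous_fst
    continuous_snd) continuous_const

theorem comb_mem_frames {u v : ι → ℂ} (h : (u, v) ∈ frames ι) {a b c d : ℂ}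
    (hd : a * d - b * c ≠ 0) : (a • u + b • v, c • u + d • v) ∈ frames ι := by
  change wedgePairing _ _ _ _ ≠ 0
  rw [wedgePairing_comb]
  exact mul_ne_zero (mul_ne_zero hd (star_ne_zero.2 hd)) h

/-- The set of points lying on the plane of some frame along one of countably many lines is
negligible. -/
theorem exists_notMem_planes (hι : 3 ≤ Fintype.card ι)
    {S : Set (((ι → ℂ) × (ι → ℂ)) × ((ι → ℂ) × (ι → ℂ)))} (hS : S.Countable) :
    ∃ b : ι → ℂ, ∀ s ∈ S, ∀ (r : ℝ) (α β : ℂ),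
      b ≠ α • (s.1.1 + r • s.2.1) + β • (s.1.2 + r • s.2.2) := by
  let g (s : ((ι → ℂ) × (ι → ℂ)) × ((ι → ℂ) × (ι → ℂ))) (x : ℝ × ℂ × ℂ) : ι → ℂ :=
    x.2.1 • (s.1.1 + x.1 • s.2.1) + x.2.2 • (s.1.2 + x.1 • s.2.2)
  have hg : ∀ s, dimH (range (g s)) ≤ 5 := by
    intro s
    have : ContDiff ℝ 1 (g s) := by
      have h1 : ContDiff ℝ 1 fun x : ℝ × ℂ × ℂ => x.1 := contDiff_fst
      have h2 : ContDiff ℝ 1 fun x : ℝ × ℂ × ℂ => x.2.1 := contDiff_fst.comp contDiff_snd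
      have h3 : ContDiff ℝ 1 fun x : ℝ × ℂ × ℂ => x.2.2 := contDiff_snd.comp contDiff_snd
      exact (h2.smul (contDiff_const.add (h1.smul contDiff_const))).add
        (h3.smul (contDiff_const.add (h1.smul contDiff_const)))
    refine this.dimH_range_le.trans ?_
    rw [finrank_prod, finrank_prod, Complex.finrank_real_complex, finrank_self]
    norm_num
  have hd : dimH (⋃ s ∈ S, range (g s)) < finrank ℝ (ι → ℂ) := by
    rw [dimH_bUnion hS]
    refine (iSup₂_le fun s _ => hg s).trans_lt ?_
    rw [finrank_pi_fintype, Finset.sum_const, Complex.finrank_real_complex, Finset.card_univ,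
      smul_eq_mul]
    have : 5 < Fintype.card ι * 2 := by omega
    exact_mod_cast this
  obtain ⟨b, hb⟩ := (dense_compl_of_dimH_lt_finrank hd).nonempty
  refine ⟨b, fun s hs r α β h => hb ?_⟩
  exact mem_biUnion hs ⟨(r, α, β), h.symm⟩

/-- A path homotopic to one running along countably many lines. -/
theorem exists_homotopic_lines {x y : frames ι} (p : Path x y) :
    ∃ q : Path x y, p.Homotopic q ∧
      ∃ S : Set (((ι → ℂ) × (ι → ℂ)) × ((ι → ℂ) × (ι → ℂ))), S.Countable ∧
        ∀ t, ∃ s ∈ S, ∃ r : ℝ, (q t : (ι → ℂ) × (ι → ℂ)) = s.1 + r • s.2 := by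
  have hball : ∀ x : frames ι, ∃ ε > 0, Metric.ball (x : (ι → ℂ) × (ι → ℂ)) ε ⊆ frames ι :=
    fun x => Metric.isOpen_iff.1 isOpen_frames x.1 x.2
  choose ε hε hsub using hball
  induction p using path_induction with
  | htrans p q hp hq =>
    obtain ⟨p', h1, S, hS, hp⟩ := hp
    obtain ⟨q', h2, T, hT, hq⟩ := hq
    refine ⟨p'.trans q', h1.hcomp h2, S ∪ T, hS.union hT, fun t => ?_⟩
    have : p'.trans q' t ∈ range p' ∪ range q' := by
      rw [← Path.trans_range]; exact mem_range_self t
    rcases this with ⟨t', e⟩ | ⟨t', e⟩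
    · obtain ⟨s, hs, r, h⟩ := hp t'
      exact ⟨s, .inl hs, r, by rw [← e, h]⟩
    · obtain ⟨s, hs, r, h⟩ := hq t'
      exact ⟨s, .inr hs, r, by rw [← e, h]⟩
  | hhom p q hpq hp =>
    obtain ⟨p', h1, h⟩ := hp
    exact ⟨p', hpq.symm.trans h1, h⟩
  | U => exact Subtype.val ⁻¹' Metric.ball (‹frames ι› : (ι → ℂ) × (ι → ℂ)) (ε ‹_›)
  | hU x =>
    exact (Metric.isOpen_ball.preimage continuous_subtype_val).mem_nhds
      (Metric.mem_ball_self (hε x))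
  | hloc x p hp =>
    rename_i a b
    have hp' : ∀ t, (p t : (ι → ℂ) × (ι → ℂ)) ∈ Metric.ball (x : (ι → ℂ) × (ι → ℂ)) (ε x) :=
      fun t => hp (mem_range_self t)
    have ha : (a : (ι → ℂ) × (ι → ℂ)) ∈ Metric.ball (x : (ι → ℂ) × (ι → ℂ)) (ε x) := by
      simpa using hp' 0
    have hb : (b : (ι → ℂ) × (ι → ℂ)) ∈ Metric.ball (x : (ι → ℂ) × (ι → ℂ)) (ε x) := by
      simpa using hp' 1
    have hc := convex_ball (x : (ι → ℂ) × (ι → ℂ)) (ε x)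
    have hs := (hc.segment_subset ha hb).trans (hsub x)
    refine ⟨segPath a b hs, homotopic_of_convex hc (hsub x) _ _ hp'
      (segPath_mem a b hs hc ha hb), {(a.1, b.1 - a.1)}, countable_singleton _,
      fun t => ⟨_, rfl, t, ?_⟩⟩
    rw [segPath_coe]
    exact AffineMap.lineMap_apply_module' _ _ _ |>.trans (add_comm _ _)

theorem frames_loop_homotopic_refl (hι : 3 ≤ Fintype.card ι) {x : frames ι} (p : Path x x) :
    p.Homotopic (Path.refl x) := by
  obtain ⟨q, hpq, S, hS, hq⟩ := exists_homotopic_lines p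
  refine hpq.trans ?_
  obtain ⟨b, hb⟩ := exists_notMem_planes hι hS
  obtain ⟨a, ha⟩ := exists_notMem_planes hι
    (hS.image fun s => (((s.1.1, b), (s.2.1, 0)) : ((ι → ℂ) × (ι → ℂ)) × ((ι → ℂ) × (ι → ℂ))))
  have h1 : ∀ t (α β : ℂ), b ≠ α • (q t).1.1 + β • (q t).1.2 := by
    intro t α β
    obtain ⟨s, hs, r, e⟩ := hq t
    rw [e]
    exact hb s hs r α β
  have h2 : ∀ t (α β : ℂ), a ≠ α • (q t).1.1 + β • b := by
    intro t α β
    obtain ⟨s, hs, r, e⟩ := hq t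
    rw [e]
    simpa using ha _ (mem_image_of_mem _ hs) r α β
  have h3 : ∀ t (s : ℝ), ((q t).1.1, (1 - s) • (q t).1.2 + s • b) ∈ frames ι := by
    intro t s
    have h := LinearIndependent.pair_iff.1 (mem_frames.1 (q t).2)
    rw [mem_frames, LinearIndependent.pair_iff]
    intro α β e
    simp only [smul_add] at e
    by_cases h0 : β * s = 0
    · have e' : α • (q t).1.1 + (β * (1 - s)) • (q t).1.2 = 0 := by
        rw [← e]
        ext i
        simp only [Pi.add_apply, Pi.smul_apply, smul_eq_mul, Complex.real_smul]
        push_cast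
        linear_combination (-b i) * h0
      obtain ⟨h4, h5⟩ := h _ _ e'
      exact ⟨h4, by linear_combination h5 + h0⟩
    · refine absurd ?_ (h1 t (-α / (β * s)) (-(β * (1 - s)) / (β * s)))
      ext i
      have := congrFun e i
      simp only [Pi.add_apply, Pi.smul_apply, smul_eq_mul, Complex.real_smul, Pi.zero_apply] at *
      push_cast at this
      have hβ := left_ne_zero_of_mul h0
      have hs := right_ne_zero_of_mul h0
      field_simp
      linear_combination this
  have h4 : ∀ t (s : ℝ), ((1 - s) • (q t).1.1 + s • a, b) ∈ frames ι := by
    intro t s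
    have h := LinearIndependent.pair_iff.1 (mem_frames.1 (h3 t 1))
    simp only [sub_self, zero_smul, zero_add, one_smul] at h
    rw [mem_frames, LinearIndependent.pair_iff]
    intro α β e
    simp only [smul_add] at e
    by_cases h0 : α * s = 0
    · have e' : (α * (1 - s)) • (q t).1.1 + β • b = 0 := by
        rw [← e]
        ext i
        simp only [Pi.add_apply, Pi.smul_apply, smul_eq_mul, Complex.real_smul]
        push_cast
        linear_combination (-a i) * h0
      obtain ⟨h4, h5⟩ := h _ _ e'
      exact ⟨by linear_combination h4 + h0, h5⟩
    · refine absurd ?_ (h2 t (-(α * (1 - s)) / (α * s)) (-β / (α * s)))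
      ext i
      have := congrFun e i
      simp only [Pi.add_apply, Pi.smul_apply, smul_eq_mul, Complex.real_smul, Pi.zero_apply] at *
      push_cast at this
      have hβ := left_ne_zero_of_mul h0
      have hs := right_ne_zero_of_mul h0
      field_simp
      linear_combination this
  let m (s : I) : ℝ := min (2 * s) 1
  let M (s : I) : ℝ := max (2 * s - 1) 0
  have hcq1 : Continuous fun t => (q t).1.1 := by fun_prop
  have hcq2 : Continuous fun t => (q t).1.2 := by fun_prop
  let H : C(I × I, frames ι) := ⟨fun x => ⟨((1 - M x.1) • (q x.2).1.1 + M x.1 • a,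
      (1 - m x.1) • (q x.2).1.2 + m x.1 • b), by
    rcases le_total (2 * (x.1 : ℝ)) 1 with h | h
    · have : M x.1 = 0 := max_eq_right (by linarith)
      rw [this]
      simpa using h3 x.2 (m x.1)
    · have : m x.1 = 1 := min_eq_right h
      rw [this]
      simpa using h4 x.2 (M x.1)⟩, by
    have hm : Continuous m := by fun_prop
    have hM : Continuous M := by fun_prop
    fun_prop⟩
  refine homotopic_refl_of_free q H (fun t => ?_) (fun s => ?_) (fun t => ?_)
  · ext <;> simp [H, m, M]
  · simp [H]
  · ext <;> norm_num [H, m, M]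

end Frames

section Projective

variable {n : ℕ}

/-- The quotient map from nonzero vectors to projective space. -/
def toCP (v : {v : Fin (n + 1) → ℂ // v ≠ 0}) : CP n := Projectivization.mk ℂ v.1 v.2

theorem toCP_surjective : Function.Surjective (toCP (n := n)) := fun p =>
  ⟨⟨p.rep, p.rep_nonzero⟩, p.mk_rep⟩

theorem toCP_eq_iff {v w : {v : Fin (n + 1) → ℂ // v ≠ 0}} :
    toCP v = toCP w ↔ ∃ a : ℂ, a • w.1 = v.1 := Projectivization.mk_eq_mk_iff' ..

theorem isOpenQuotientMap_toCP : IsOpenQuotientMap (toCP (n := n)) where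
  surjective := toCP_surjective
  continuous := continuous_quotient_mk'
  isOpenMap O hO := by
    have hq : IsQuotientMap (toCP (n := n)) := isQuotientMap_quotient_mk'
    rw [← hq.isOpen_preimage]
    have : toCP ⁻¹' (toCP '' O) = ⋃ a : ℂˣ, (fun v : {v : Fin (n + 1) → ℂ // v ≠ 0} =>
        (⟨a • v.1, (smul_ne_zero_iff_ne a).2 v.2⟩ : {v : Fin (n + 1) → ℂ // v ≠ 0})) ⁻¹' O := by
      ext v
      simp only [mem_preimage, mem_image, mem_iUnion]
      constructor
      · rintro ⟨w, hw, e⟩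
        obtain ⟨a, ha⟩ := (Projectivization.mk_eq_mk_iff ℂ _ _ w.2 v.2).1 e
        exact ⟨a, by convert hw⟩
      · rintro ⟨a, ha⟩
        exact ⟨_, ha, (Projectivization.mk_eq_mk_iff ℂ _ _ _ v.2).2 ⟨a, rfl⟩⟩
    rw [this]
    exact isOpen_iUnion fun a => hO.preimage (by fun_prop)

theorem toCP_ne_iff {v w : {v : Fin (n + 1) → ℂ // v ≠ 0}} :
    toCP v ≠ toCP w ↔ (w.1, v.1) ∈ frames (Fin (n + 1)) := by
  rw [mem_frames, LinearIndependent.pair_iff' w.2, Ne, toCP_eq_iff, not_exists]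

instance : T2Space (CP n) := by
  rw [t2Space_iff_of_isOpenQuotientMap isOpenQuotientMap_toCP]
  have : {q : {v : Fin (n + 1) → ℂ // v ≠ 0} × {v : Fin (n + 1) → ℂ // v ≠ 0} |
      toCP q.1 = toCP q.2} = (fun q => (q.2.1, q.1.1)) ⁻¹' (frames (Fin (n + 1)))ᶜ := by
    ext q
    have := @toCP_ne_iff n q.1 q.2
    simp only [mem_preimage, mem_compl_iff, ← this]
    exact not_not.symm
  rw [this]
  exact isOpen_frames.isClosed_compl.preimage (by fun_prop)

theorem exists_local_section (p : CP n) : ∃ s : CP n → (Fin (n + 1) → ℂ), ∃ O : Set (CP n),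
    IsOpen O ∧ p ∈ O ∧ (∀ y ∈ O, ContinuousAt s y) ∧ ∀ y ∈ O, ∃ h : s y ≠ 0, toCP ⟨s y, h⟩ = y := by
  obtain ⟨i, hi⟩ := Function.ne_iff.1 p.rep_nonzero
  have hrep : ∀ v : {v : Fin (n + 1) → ℂ // v ≠ 0}, ∃ a : ℂ, a ≠ 0 ∧ (toCP v).rep = a • v.1 := by
    intro v
    obtain ⟨a, ha⟩ := Projectivization.exists_smul_eq_mk_rep ℂ v.1 v.2
    exact ⟨a, a.ne_zero, ha.symm⟩
  refine ⟨fun y => (y.rep i)⁻¹ • y.rep, {y | y.rep i ≠ 0}, ?_, hi, fun y hy => ?_, fun y hy => ?_⟩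
  · rw [← isOpenQuotientMap_toCP.isQuotientMap.isOpen_preimage]
    have : toCP ⁻¹' {y : CP n | y.rep i ≠ 0} = {v | v.1 i ≠ 0} := by
      ext v
      obtain ⟨a, ha, e⟩ := hrep v
      simp [e, ha]
    rw [this]
    exact isOpen_ne_fun ((continuous_apply i).comp continuous_subtype_val) continuous_const
  · obtain ⟨v, rfl⟩ := toCP_surjective y
    rw [← isOpenQuotientMap_toCP.continuousAt_comp_iff]
    have : (fun y : CP n => (y.rep i)⁻¹ • y.rep) ∘ toCP = fun v => (v.1 i)⁻¹ • v.1 := by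
      ext1 v
      obtain ⟨a, ha, e⟩ := hrep v
      simp only [Function.comp, e, Pi.smul_apply, smul_eq_mul, mul_inv, smul_smul]
      congr 1
      field_simp
    rw [this]
    obtain ⟨a, ha, e⟩ := hrep v
    have hv : v.1 i ≠ 0 := fun h => hy (by rw [e]; simp [h])
    have h1 : ContinuousAt (fun v : {v : Fin (n + 1) → ℂ // v ≠ 0} => v.1 i) v :=
      ((continuous_apply i).comp continuous_subtype_val).continuousAt
    exact (h1.inv₀ hv).smul (by fun_prop)
  · refine ⟨smul_ne_zero (inv_ne_zero hy) y.rep_nonzero, ?_⟩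
    conv_rhs => rw [← y.mk_rep]
    exact (Projectivization.mk_eq_mk_iff' ..).2 ⟨(y.rep i)⁻¹, rfl⟩

theorem span_range_rep {N : ℕ} {x : Fin N → CP n} {r : Fin N → {v : Fin (n + 1) → ℂ // v ≠ 0}}
    (h : ∀ j, toCP (r j) = x j) :
    span ℂ (range fun j => (x j).rep) = span ℂ (range fun j => (r j).1) := by
  have h' : ∀ j, ∃ a : ℂˣ, a • (r j).1 = (x j).rep := fun j => by
    rw [← h]; exact Projectivization.exists_smul_eq_mk_rep ..
  apply le_antisymm <;> rw [span_le] <;> rintro _ ⟨j, rfl⟩ <;> obtain ⟨a, ha⟩ := h' j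
  · simp only [← ha]
    exact smul_mem _ (a : ℂ) (subset_span ⟨j, rfl⟩)
  · have : (r j).1 = a⁻¹ • (x j).rep := by rw [← ha, inv_smul_smul]
    simp only [this]
    exact smul_mem _ ((a⁻¹ : ℂˣ) : ℂ) (subset_span ⟨j, rfl⟩)

/-- The determinant of two vectors in the plane. -/
def det2 (c d : ℂ × ℂ) : ℂ := c.1 * d.2 - c.2 * d.1

/-- Configurations of pairwise independent vectors in the plane. -/
def coefConf (N : ℕ) : Set (Fin N → ℂ × ℂ) := {c | ∀ i j, i ≠ j → det2 (c i) (c j) ≠ 0}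

/-- The linear combination of a frame with given coefficients. -/
def comb (f : (Fin (n + 1) → ℂ) × (Fin (n + 1) → ℂ)) (c : ℂ × ℂ) : Fin (n + 1) → ℂ :=
  c.1 • f.1 + c.2 • f.2

theorem comb_pair_mem_frames {f : (Fin (n + 1) → ℂ) × (Fin (n + 1) → ℂ)}
    (hf : f ∈ frames (Fin (n + 1))) {c d : ℂ × ℂ} (h : det2 c d ≠ 0) :
    (comb f c, comb f d) ∈ frames (Fin (n + 1)) :=
  comb_mem_frames (u := f.1) (v := f.2) hf h

theorem ne_zero_of_mem_frames {f : (Fin (n + 1) → ℂ) × (Fin (n + 1) → ℂ)}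
    (hf : f ∈ frames (Fin (n + 1))) : f.1 ≠ 0 :=
  (mem_frames.1 hf).ne_zero 0

theorem finrank_span_pair {f : (Fin (n + 1) → ℂ) × (Fin (n + 1) → ℂ)}
    (hf : f ∈ frames (Fin (n + 1))) : finrank ℂ (span ℂ {f.1, f.2}) = 2 := by
  have := finrank_span_eq_card (mem_frames.1 hf)
  rwa [Matrix.range_cons, Matrix.range_cons, Matrix.range_empty, union_empty, singleton_union,
    Fintype.card_fin] at this

theorem comb_ne_zero {N : ℕ} [Nontrivial (Fin N)] (f : frames (Fin (n + 1))) (c : coefConf N)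
    (j : Fin N) : comb f.1 (c.1 j) ≠ 0 := by
  obtain ⟨i, hi⟩ := exists_ne j
  exact ne_zero_of_mem_frames (comb_pair_mem_frames f.2 (c.2 j i hi.symm))

/-- The configuration of points on a projective line with given homogeneous coordinates. -/
def projConf (n N : ℕ) [Nontrivial (Fin N)] :
    C(frames (Fin (n + 1)) × coefConf N, Fconf N 1 n) where
  toFun x := ⟨fun j => toCP ⟨comb x.1.1 (x.2.1 j), comb_ne_zero x.1 x.2 j⟩, by
    have hinj : ∀ i j, i ≠ j → toCP ⟨comb x.1.1 (x.2.1 i), comb_ne_zero x.1 x.2 i⟩ ≠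
        toCP ⟨comb x.1.1 (x.2.1 j), comb_ne_zero x.1 x.2 j⟩ := fun i j hij =>
      toCP_ne_iff.2 (comb_pair_mem_frames x.1.2 (x.2.2 j i hij.symm))
    refine ⟨fun i j => not_imp_not.1 (hinj i j), ?_⟩
    rw [span_range_rep (r := fun j => ⟨comb x.1.1 (x.2.1 j), comb_ne_zero x.1 x.2 j⟩)
      fun _ => rfl]
    apply le_antisymm
    · rw [one_add_one_eq_two, ← finrank_span_pair x.1.2]
      refine Submodule.finrank_mono (span_le.2 ?_)
      rintro _ ⟨j, rfl⟩
      exact mem_span_pair.2 ⟨_, _, rfl⟩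
    · obtain ⟨i, j, hij⟩ := exists_pair_ne (Fin N)
      rw [one_add_one_eq_two,
        ← finrank_span_pair (comb_pair_mem_frames x.1.2 (x.2.2 i j hij))]
      refine Submodule.finrank_mono (span_le.2 ?_)
      rintro _ (rfl | rfl)
      · exact subset_span ⟨i, rfl⟩
      · exact subset_span ⟨j, rfl⟩⟩
  continuous_toFun := by
    refine Continuous.subtype_mk (continuous_pi fun j => ?_) _
    refine isOpenQuotientMap_toCP.continuous.comp (Continuous.subtype_mk ?_ _)
    unfold comb
    have h1 : Continuous fun x : frames (Fin (n + 1)) × coefConf N => x.2.1 j :=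
      (continuous_apply j).comp (continuous_subtype_val.comp continuous_snd)
    fun_prop

end Projective

section Infinity

variable {n k : ℕ}

/-- Homogeneous coordinates of finitely many points of the affine line and one further point. -/
def snocCoef (z : Fin k → ℂ) (e : ℂ × ℂ) : Fin (k + 1) → ℂ × ℂ :=
  Fin.snoc (α := fun _ => ℂ × ℂ) (fun j => (z j, 1)) e

@[simp] theorem snocCoef_castSucc (z : Fin k → ℂ) (e : ℂ × ℂ) (j : Fin k) :
    snocCoef z e j.castSucc = (z j, 1) := Fin.snoc_castSucc (α := fun _ => ℂ × ℂ) ..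

@[simp] theorem snocCoef_last (z : Fin k → ℂ) (e : ℂ × ℂ) :
    snocCoef z e (Fin.last k) = e := Fin.snoc_last (α := fun _ => ℂ × ℂ) ..

theorem snocCoef_mem {z : Fin k → ℂ} (hz : z ∈ planeConf k) {e : ℂ × ℂ}
    (he : ∀ j, e.1 - e.2 * z j ≠ 0) : snocCoef z e ∈ coefConf (k + 1) := by
  intro i j hij
  induction i using Fin.lastCases with
  | last =>
    induction j using Fin.lastCases with
    | last => exact absurd rfl hij
    | cast j => simpa [det2] using he j
  | cast i =>
    induction j using Fin.lastCases with
    | last =>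
      intro h
      simp only [snocCoef_last, snocCoef_castSucc, det2] at h
      exact he i (by linear_combination -h)
    | cast j =>
      simp only [snocCoef_castSucc, det2, mul_one, one_mul]
      exact sub_ne_zero.2 fun h => hij (congrArg Fin.castSucc (hz h))

theorem continuous_snocCoef {T : Type*} [TopologicalSpace T] {z : T → Fin k → ℂ} {e : T → ℂ × ℂ}
    (hz : Continuous z) (he : Continuous e) : Continuous fun t => snocCoef (z t) (e t) := by
  refine continuous_pi fun j => ?_
  induction j using Fin.lastCases with
  | last => simpa using he
  | cast j =>
    simp only [snocCoef_castSucc]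
    fun_prop

variable [Nontrivial (Fin (k + 1))]

/-- The configuration of `k` points of an affine line, together with its point at infinity. -/
def inftyConf (n k : ℕ) [Nontrivial (Fin (k + 1))] :
    C(frames (Fin (n + 1)) × planeConf k, Fconf (k + 1) 1 n) :=
  (projConf n (k + 1)).comp ⟨fun x => (x.1, ⟨snocCoef x.2.1 (1, 0), snocCoef_mem x.2.2 (by simp)⟩),
    by
      refine continuous_fst.prodMk (Continuous.subtype_mk ?_ _)
      exact continuous_snocCoef (by fun_prop) (by fun_prop)⟩

theorem inftyConf_apply (f : frames (Fin (n + 1))) (z : planeConf k) (j : Fin (k + 1)) :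
    (inftyConf n k (f, z)).1 j = toCP ⟨comb f.1 (snocCoef z.1 (1, 0) j),
      comb_ne_zero f ⟨_, snocCoef_mem z.2 (by simp)⟩ j⟩ := rfl

@[simp] theorem comb_one_zero (f : (Fin (n + 1) → ℂ) × (Fin (n + 1) → ℂ)) :
    comb f (1, 0) = f.1 := by simp [comb]

theorem smul_comb (f : (Fin (n + 1) → ℂ) × (Fin (n + 1) → ℂ)) (a : ℂ) (c : ℂ × ℂ) :
    a • comb f c = comb f (a * c.1, a * c.2) := by simp [comb, smul_smul]

theorem comb_injective (f : frames (Fin (n + 1))) : Function.Injective (comb f.1) := by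
  intro c d h
  have := LinearIndependent.pair_iff.1 (mem_frames.1 f.2) (c.1 - d.1) (c.2 - d.2) (by
    simp only [comb] at h
    rw [sub_smul, sub_smul, sub_add_sub_comm, h, sub_self])
  exact Prod.ext (sub_eq_zero.1 this.1) (sub_eq_zero.1 this.2)

theorem inftyConf_eq_of {f f' : frames (Fin (n + 1))} {z z' : planeConf k}
    (h1 : ∀ j, ∃ a : ℂ, a • comb f'.1 (z'.1 j, 1) = comb f.1 (z.1 j, 1))
    (h2 : ∃ a : ℂ, a • f'.1.1 = f.1.1) : inftyConf n k (f, z) = inftyConf n k (f', z') := by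
  refine Subtype.ext (funext fun j => ?_)
  rw [inftyConf_apply, inftyConf_apply, toCP_eq_iff]
  induction j using Fin.lastCases with
  | last => simpa using h2
  | cast j => simpa using h1 j

/-- Any configuration is affine in the frame given by representatives of its last point
and its first point. -/
theorem exists_eq_inftyConf [NeZero k] (x : Fconf (k + 1) 1 n) {r₀ r : Fin (n + 1) → ℂ}
    (h₀ : r₀ ≠ 0)
    (h : r ≠ 0) (e₀ : toCP ⟨r₀, h₀⟩ = x.1 (0 : Fin k).castSucc)
    (e : toCP ⟨r, h⟩ = x.1 (Fin.last k)) :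
    ∃ hf : (r, r₀) ∈ frames (Fin (n + 1)), ∃ z : planeConf k, z.1 0 = 0 ∧
      inftyConf n k (⟨(r, r₀), hf⟩, z) = x := by
  have hf : (r, r₀) ∈ frames (Fin (n + 1)) := by
    have : toCP ⟨r₀, h₀⟩ ≠ toCP ⟨r, h⟩ := by
      rw [e₀, e]
      exact fun h => (Fin.castSucc_lt_last _).ne (x.2.1 h)
    exact (toCP_ne_iff (v := ⟨r₀, h₀⟩) (w := ⟨r, h⟩)).1 this
  choose s hs using fun j => toCP_surjective (x.1 j)
  have hspan : ∀ j, (s j).1 ∈ span ℂ {r, r₀} := by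
    have hle : span ℂ {r, r₀} ≤ span ℂ (range fun j => (s j).1) := by
      have h1 : ∃ a : ℂ, a • (s (Fin.last k)).1 = r := toCP_eq_iff.1 (e.trans (hs _).symm)
      have h2 : ∃ a : ℂ, a • (s (0 : Fin k).castSucc).1 = r₀ :=
        toCP_eq_iff.1 (e₀.trans (hs _).symm)
      obtain ⟨a, ha⟩ := h1
      obtain ⟨b, hb⟩ := h2
      rw [span_le, insert_subset_iff, singleton_subset_iff, ← ha, ← hb]
      exact ⟨smul_mem _ a (subset_span (mem_range_self _)),
        smul_mem _ b (subset_span (mem_range_self _))⟩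
    have := Submodule.eq_of_le_of_finrank_eq hle (by
      rw [finrank_span_pair hf, ← span_range_rep hs, x.2.2])
    rw [this]
    exact fun j => subset_span ⟨j, rfl⟩
  choose a b hab using fun j => mem_span_pair.1 (hspan j)
  have hb : ∀ j : Fin k, b j.castSucc ≠ 0 := by
    intro j hj
    refine (Fin.castSucc_lt_last j).ne (x.2.1 ?_)
    rw [← e, ← hs, toCP_eq_iff]
    exact ⟨a j.castSucc, by simp [← hab, hj]⟩
  have hcomb : ∀ j : Fin k, (s j.castSucc).1 =
      b j.castSucc • comb (r, r₀) (a j.castSucc / b j.castSucc, 1) := by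
    intro j
    rw [smul_comb, ← hab, comb, mul_div_cancel₀ _ (hb j), mul_one]
  refine ⟨hf, ⟨fun j => a j.castSucc / b j.castSucc, fun i j hij => ?_⟩, ?_, ?_⟩
  · apply Fin.castSucc_injective
    apply x.2.1
    rw [← hs, ← hs, toCP_eq_iff]
    refine ⟨b i.castSucc / b j.castSucc, ?_⟩
    simp only at hij
    rw [hcomb, hcomb, hij, smul_smul, div_mul_cancel₀ _ (hb j)]
  · obtain ⟨c, hc⟩ := toCP_eq_iff.1 ((hs _).trans e₀.symm)
    have : comb (r, r₀) (a (0 : Fin k).castSucc, b (0 : Fin k).castSucc) = comb (r, r₀) (0, c) := by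
      simp only [comb, hab, ← hc, zero_smul, zero_add]
    have := comb_injective ⟨_, hf⟩ this
    have h1 : a (0 : Fin k).castSucc = 0 := congrArg Prod.fst this
    simp only [h1, zero_div]
  · refine Subtype.ext (funext fun j => ?_)
    rw [inftyConf_apply]
    induction j using Fin.lastCases with
    | last => simpa using e
    | cast j =>
      rw [← hs, toCP_eq_iff]
      refine ⟨(b j.castSucc)⁻¹, ?_⟩
      rw [hcomb, smul_smul, inv_mul_cancel₀ (hb j), one_smul]
      simp

end Infinity

section CrossRatio

variable {n m : ℕ}

theorem wedgePairing_div (f : frames (Fin (n + 1))) (a b c d : ℂ × ℂ) (h : det2 c d ≠ 0) :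
    wedgePairing (comb f.1 a) (comb f.1 b) (comb f.1 c) (comb f.1 d) /
      wedgePairing (comb f.1 c) (comb f.1 d) (comb f.1 c) (comb f.1 d) = det2 a b / det2 c d := by
  have hf : wedgePairing f.1.1 f.1.2 f.1.1 f.1.2 ≠ 0 := f.2
  unfold comb
  rw [wedgePairing_comb, wedgePairing_comb, mul_assoc, mul_assoc]
  exact mul_div_mul_right _ _ (mul_ne_zero (star_ne_zero.2 h) hf)

/-- The cross ratio of four vectors in a plane, normalized to be `1 + i` at `r = r₁`. -/
def crossRatio (r₀ r₁ r' r : Fin (n + 1) → ℂ) : ℂ :=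
  (1 + Complex.I) * (wedgePairing r r₀ r r' / wedgePairing r r' r r' *
    (wedgePairing r₁ r' r₁ r₀ / wedgePairing r₁ r₀ r₁ r₀))

theorem crossRatio_eq (f : frames (Fin (n + 1))) (z : planeConf (m + 2))
    {r : Fin (m + 2 + 1) → {v : Fin (n + 1) → ℂ // v ≠ 0}}
    (hr : ∀ j, toCP (r j) = (inftyConf n (m + 2) (f, z)).1 j) (j : Fin (m + 2)) :
    crossRatio (r (Fin.castSucc 0)).1 (r (Fin.castSucc 1)).1 (r (Fin.last _)).1 (r j.castSucc).1 =
      (1 + Complex.I) * ((z.1 j - z.1 0) / (z.1 1 - z.1 0)) := by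
  have h : ∀ j, ∃ a : ℂ, a ≠ 0 ∧ (r j).1 = a • comb f.1 (snocCoef z.1 (1, 0) j) := by
    intro j
    obtain ⟨a, ha⟩ := toCP_eq_iff.1 ((hr j).trans (inftyConf_apply f z j))
    refine ⟨a, ?_, ha.symm⟩
    rintro rfl
    exact (r j).2 (by simpa using ha.symm)
  choose a ha hra using h
  have h01 : z.1 1 - z.1 0 ≠ 0 := sub_ne_zero.2 fun h => absurd (z.2 h) (by simp)
  simp only [crossRatio, hra, smul_comb, snocCoef_castSucc, snocCoef_last]
  rw [wedgePairing_div, wedgePairing_div]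
  · simp only [det2]
    have h0 := ha (Fin.castSucc 0)
    have h1 := ha (Fin.castSucc 1)
    have h2 := ha (Fin.last _)
    have h3 := ha j.castSucc
    have : a (Fin.castSucc 1) * z.1 1 * (a (Fin.castSucc 0) * 1) -
      a (Fin.castSucc 1) * 1 * (a (Fin.castSucc 0) * z.1 0) =
      a (Fin.castSucc 1) * a (Fin.castSucc 0) * (z.1 1 - z.1 0) := by ring
    rw [this]
    simp only [mul_one, mul_zero, zero_sub, Fin.castSucc_zero, Fin.castSucc_one] at *
    field_simp
  · have : det2 (a (Fin.castSucc 1) * z.1 1, a (Fin.castSucc 1) * 1)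
      (a (Fin.castSucc 0) * z.1 0, a (Fin.castSucc 0) * 1) =
      a (Fin.castSucc 1) * a (Fin.castSucc 0) * (z.1 1 - z.1 0) := by simp only [det2]; ring
    rw [this]
    exact mul_ne_zero (mul_ne_zero (ha _) (ha _)) h01
  · have : det2 (a j.castSucc * z.1 j, a j.castSucc * 1)
      (a (Fin.last _) * 1, a (Fin.last _) * 0) = -(a j.castSucc * a (Fin.last _)) := by
      simp only [det2]; ring
    rw [this]
    exact neg_ne_zero.2 (mul_ne_zero (ha _) (ha _))

theorem one_add_I_ne_zero : (1 + Complex.I) ≠ 0 := by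
  intro h
  simpa using congrArg Complex.re h

theorem exists_eq_inftyConf' (x : Fconf (m + 2 + 1) 1 n) :
    ∃ f z, inftyConf n (m + 2) (f, z) = x := by
  obtain ⟨hf, z, -, h⟩ := exists_eq_inftyConf (k := m + 2) x (x.1 _).rep_nonzero (x.1 _).rep_nonzero
    (Projectivization.mk_rep _) (Projectivization.mk_rep _)
  exact ⟨_, z, h⟩

theorem crossRatio_mem_planeConf (x : Fconf (m + 2 + 1) 1 n) :
    (fun j : Fin (m + 2) => crossRatio (x.1 (Fin.castSucc 0)).rep (x.1 (Fin.castSucc 1)).rep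
      (x.1 (Fin.last _)).rep (x.1 j.castSucc).rep) ∈ planeConf (m + 2) := by
  obtain ⟨f, z, h⟩ := exists_eq_inftyConf' x
  have := crossRatio_eq f z (r := fun j => ⟨(x.1 j).rep, (x.1 j).rep_nonzero⟩)
    fun j => (Projectivization.mk_rep _).trans (by rw [h])
  simp only at this
  intro i j hij
  simp only [this] at hij
  have h01 : z.1 1 - z.1 0 ≠ 0 := sub_ne_zero.2 fun h => absurd (z.2 h) (by simp)
  have h1 := mul_left_cancel₀ one_add_I_ne_zero hij
  rw [div_left_inj' h01, sub_left_inj] at h1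
  exact z.2 h1

/-- The affine coordinates of the points of a configuration on a projective line, normalized
by sending the first two points to `0`, `1 + i` and the last one to `∞`. -/
def affineCoord (n m : ℕ) : C(Fconf (m + 2 + 1) 1 n, planeConf (m + 2)) where
  toFun x := ⟨_, crossRatio_mem_planeConf x⟩
  continuous_toFun := by
    refine Continuous.subtype_mk
      (continuous_pi fun j => continuous_iff_continuousAt.2 fun x => ?_) _
    choose s O hO hmem hc hs using fun j => exists_local_section (x.1 j)
    have hev : ∀ᶠ y : Fconf (m + 2 + 1) 1 n in 𝓝 x, ∀ j, y.1 j ∈ O j := by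
      refine eventually_all.2 fun j => ?_
      exact ((hO j).preimage ((continuous_apply j).comp continuous_subtype_val)).mem_nhds (hmem j)
    have hcs : ∀ j, ContinuousAt (fun y : Fconf (m + 2 + 1) 1 n => s j (y.1 j)) x := fun j =>
      ContinuousAt.comp (f := fun y : Fconf (m + 2 + 1) 1 n => y.1 j) (hc j _ (hmem j))
        ((continuous_apply j).comp continuous_subtype_val).continuousAt
    obtain ⟨f, z, h⟩ := exists_eq_inftyConf' x
    have hne : ∀ i j, i ≠ j → wedgePairing (s i (x.1 i)) (s j (x.1 j)) (s i (x.1 i))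
        (s j (x.1 j)) ≠ 0 := by
      intro i j hij
      obtain ⟨h1, e1⟩ := hs i _ (hmem i)
      obtain ⟨h2, e2⟩ := hs j _ (hmem j)
      have h3 : toCP ⟨_, h2⟩ ≠ toCP ⟨_, h1⟩ := by
        rw [e1, e2]; exact fun h => hij (x.2.1 h).symm
      exact (toCP_ne_iff (v := ⟨_, h2⟩) (w := ⟨_, h1⟩)).1 h3
    have hcW : ∀ a b c d, ContinuousAt (fun y : Fconf (m + 2 + 1) 1 n =>
        wedgePairing (s a (y.1 a)) (s b (y.1 b)) (s c (y.1 c)) (s d (y.1 d))) x := by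
      intro a b c d
      have h0 : Continuous fun q : (Fin (n + 1) → ℂ) × (Fin (n + 1) → ℂ) × (Fin (n + 1) → ℂ) ×
          (Fin (n + 1) → ℂ) => wedgePairing q.1 q.2.1 q.2.2.1 q.2.2.2 :=
        continuous_wedgePairing (by fun_prop) (by fun_prop) (by fun_prop) (by fun_prop)
      exact h0.continuousAt.comp (f := fun y : Fconf (m + 2 + 1) 1 n =>
        (s a (y.1 a), s b (y.1 b), s c (y.1 c), s d (y.1 d)))
        ((hcs a).prodMk ((hcs b).prodMk ((hcs c).prodMk (hcs d))))
    have hloc : ContinuousAt (fun y : Fconf (m + 2 + 1) 1 n =>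
        crossRatio (s (Fin.castSucc 0) (y.1 (Fin.castSucc 0)))
          (s (Fin.castSucc 1) (y.1 (Fin.castSucc 1))) (s (Fin.last _) (y.1 (Fin.last _)))
          (s j.castSucc (y.1 j.castSucc))) x := by
      unfold crossRatio
      refine continuousAt_const.mul (((hcW _ _ _ _).div (hcW _ _ _ _) (hne _ _ ?_)).mul
        ((hcW _ _ _ _).div (hcW _ _ _ _) (hne _ _ ?_)))
      · exact (Fin.castSucc_lt_last j).ne
      · simp
    refine hloc.congr ?_
    filter_upwards [hev] with y hy
    obtain ⟨f, z, h⟩ := exists_eq_inftyConf' y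
    choose g hg using fun j => hs j _ (hy j)
    have e1 := crossRatio_eq f z (r := fun j => ⟨(y.1 j).rep, (y.1 j).rep_nonzero⟩)
      (fun j => (Projectivization.mk_rep _).trans (by rw [h])) j
    have e2 := crossRatio_eq f z (r := fun j => ⟨s j (y.1 j), g j⟩)
      (fun j => (hg j).trans (by rw [h])) j
    exact e2.trans e1.symm

theorem affineCoord_inftyConf (f : frames (Fin (n + 1))) (z : planeConf (m + 2))
    (j : Fin (m + 2)) : (affineCoord n m (inftyConf n (m + 2) (f, z))).1 j =
      (1 + Complex.I) * ((z.1 j - z.1 0) / (z.1 1 - z.1 0)) :=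
  crossRatio_eq f z (r := fun j => ⟨((inftyConf n (m + 2) (f, z)).1 j).rep,
    Projectivization.rep_nonzero _⟩) (fun _ => Projectivization.mk_rep _) j

end CrossRatio

section Lifting

variable {n m : ℕ}

theorem affineCoord_normalized (x : Fconf (m + 2 + 1) 1 n) :
    (affineCoord n m x).1 0 = 0 ∧ (affineCoord n m x).1 1 = 1 + Complex.I := by
  obtain ⟨f, z, rfl⟩ := exists_eq_inftyConf' x
  have h01 : z.1 1 - z.1 0 ≠ 0 := sub_ne_zero.2 fun h => absurd (z.2 h) (by simp)
  simp [affineCoord_inftyConf, h01]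

theorem smul_mem_frames {c : ℂ} (hc : c ≠ 0) {f : (Fin (n + 1) → ℂ) × (Fin (n + 1) → ℂ)}
    (hf : f ∈ frames (Fin (n + 1))) : c • f ∈ frames (Fin (n + 1)) := by
  have := comb_mem_frames (u := f.1) (v := f.2) hf (a := c) (b := 0) (c := 0) (d := c)
    (by simpa using hc)
  simp only [zero_smul, add_zero, zero_add] at this
  exact this

theorem inftyConf_smul {f f' : frames (Fin (n + 1))} {c : ℂ} (h : f'.1 = c • f.1)
    (z : planeConf (m + 2)) : inftyConf n (m + 2) (f', z) = inftyConf n (m + 2) (f, z) := by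
  refine inftyConf_eq_of (fun j => ⟨c, ?_⟩) ⟨c, by rw [h]; rfl⟩
  rw [h]
  simp [comb, smul_smul, mul_comm]

theorem frame_unique {f f' : frames (Fin (n + 1))} {z : planeConf (m + 2)} (h0 : z.1 0 = 0)
    (h1 : z.1 1 = 1 + Complex.I) (h : inftyConf n (m + 2) (f', z) = inftyConf n (m + 2) (f, z)) :
    ∃ c : ℂ, c ≠ 0 ∧ f'.1 = c • f.1 := by
  have key : ∀ j, ∃ a : ℂ, a • comb f.1 (snocCoef z.1 (1, 0) j) =
      comb f'.1 (snocCoef z.1 (1, 0) j) := fun j =>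
    toCP_eq_iff.1 ((inftyConf_apply f' z j).symm.trans
      ((congrFun (congrArg Subtype.val h) j).trans (inftyConf_apply f z j)))
  obtain ⟨a, ha⟩ := key (Fin.last _)
  obtain ⟨d, hd⟩ := key (Fin.castSucc 0)
  obtain ⟨e, he⟩ := key (Fin.castSucc 1)
  rw [snocCoef_last, comb_one_zero, comb_one_zero] at ha
  rw [snocCoef_castSucc, h0] at hd
  rw [snocCoef_castSucc, h1] at he
  simp only [comb, zero_smul, zero_add, one_smul] at hd
  have : comb f.1 (e * (1 + Complex.I), e * 1) = comb f.1 ((1 + Complex.I) * a, d) := by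
    refine (smul_comb f.1 e (1 + Complex.I, 1)).symm.trans (he.trans ?_)
    simp only [comb, ← ha, ← hd, smul_smul, one_mul]
  have h2 := comb_injective f this
  simp only [Prod.mk.injEq, mul_one] at h2
  obtain ⟨h2, rfl⟩ := h2
  have h3 : e = a := mul_left_cancel₀ one_add_I_ne_zero ((mul_comm _ _).trans h2)
  subst h3
  have hf : f'.1 = e • f.1 := Prod.ext ha.symm hd.symm
  refine ⟨e, ?_, hf⟩
  rintro rfl
  exact ne_zero_of_mem_frames f'.2 (by rw [hf, zero_smul]; rfl)

theorem exists_local_frame (x : Fconf (m + 2 + 1) 1 n) :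
    ∃ U ∈ 𝓝 x, ∃ φ : Fconf (m + 2 + 1) 1 n → (Fin (n + 1) → ℂ) × (Fin (n + 1) → ℂ),
      ContinuousOn φ U ∧ ∀ y ∈ U, ∃ h : φ y ∈ frames (Fin (n + 1)),
        inftyConf n (m + 2) (⟨φ y, h⟩, affineCoord n m y) = y := by
  choose s O hO hmem hc hs using fun j => exists_local_section (x.1 j)
  let r (j : Fin (m + 2 + 1)) (y : Fconf (m + 2 + 1) 1 n) := s j (y.1 j)
  let D (a b c d : Fin (m + 2 + 1)) (y : Fconf (m + 2 + 1) 1 n) : ℂ :=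
    wedgePairing (r a y) (r b y) (r c y) (r d y)
  have hU : {y : Fconf (m + 2 + 1) 1 n | ∀ j, y.1 j ∈ O j} ∈ 𝓝 x := by
    refine eventually_all.2 fun j => ?_
    exact ((hO j).preimage ((continuous_apply j).comp continuous_subtype_val)).mem_nhds (hmem j)
  have hrc : ∀ j, ContinuousOn (r j) {y | ∀ j, y.1 j ∈ O j} := fun j y hy =>
    (ContinuousAt.comp (f := fun y : Fconf (m + 2 + 1) 1 n => y.1 j) (hc j _ (hy j))
      ((continuous_apply j).comp continuous_subtype_val).continuousAt).continuousWithinAt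
  have hDc : ∀ a b c d, ContinuousOn (D a b c d) {y | ∀ j, y.1 j ∈ O j} := by
    intro a b c d
    exact continuousOn_iff_continuous_domRestrict.2 (continuous_wedgePairing
      (continuousOn_iff_continuous_domRestrict.1 (hrc a))
      (continuousOn_iff_continuous_domRestrict.1 (hrc b))
      (continuousOn_iff_continuous_domRestrict.1 (hrc c))
      (continuousOn_iff_continuous_domRestrict.1 (hrc d)))
  let i₀ : Fin (m + 2 + 1) := Fin.castSucc 0
  let i₁ : Fin (m + 2 + 1) := Fin.castSucc 1
  let l : Fin (m + 2 + 1) := Fin.last _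
  have key : ∀ y : Fconf (m + 2 + 1) 1 n, (∀ j, y.1 j ∈ O j) → D i₀ l i₀ l y ≠ 0 ∧
      ∃ h : ((D i₀ i₁ i₀ l y / D i₀ l i₀ l y / (1 + Complex.I)) • r l y,
        (D i₁ l i₀ l y / D i₀ l i₀ l y) • r i₀ y) ∈ frames (Fin (n + 1)),
      inftyConf n (m + 2) (⟨_, h⟩, affineCoord n m y) = y := by
    intro y hy
    obtain ⟨h0, e0⟩ := hs i₀ _ (hy i₀)
    obtain ⟨h1, e1⟩ := hs i₁ _ (hy i₁)
    obtain ⟨hl, el⟩ := hs l _ (hy l)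
    obtain ⟨hf, z, hz0, hz⟩ := exists_eq_inftyConf (k := m + 2) y h0 hl e0 el
    set f : frames (Fin (n + 1)) := ⟨(r l y, r i₀ y), hf⟩ with hfdef
    have hr0 : r i₀ y = comb f.1 (0, 1) := by simp [comb, f]
    have hrl : r l y = comb f.1 (1, 0) := by simp [comb, f]
    obtain ⟨β, hβ⟩ : ∃ β : ℂ, β • comb f.1 (z.1 1, 1) = r i₁ y := by
      obtain ⟨β, hβ⟩ := toCP_eq_iff.1 (e1.trans ((congrFun (congrArg Subtype.val hz) i₁).symm.trans
        (inftyConf_apply f z i₁)))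
      exact ⟨β, (congrArg (fun c => β • comb f.1 c) (snocCoef_castSucc ..).symm).trans hβ⟩
    have hβ0 : β ≠ 0 := by
      rintro rfl
      exact h1 (by rw [zero_smul] at hβ; exact hβ.symm)
    have hr1 : r i₁ y = comb f.1 (β * z.1 1, β) := by rw [← hβ, smul_comb, mul_one]
    have hz1 : z.1 1 ≠ 0 := by
      rw [← hz0]
      exact fun h => absurd (z.2 h) (by simp)
    have hdet : det2 (0, 1) (1, 0) ≠ 0 := by simp [det2]
    have ha : D i₁ l i₀ l y / D i₀ l i₀ l y = β := by
      simp only [D, hr0, hrl, hr1]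
      rw [wedgePairing_div _ _ _ _ _ hdet]
      simp [det2]
    have hb : D i₀ i₁ i₀ l y / D i₀ l i₀ l y = β * z.1 1 := by
      simp only [D, hr0, hrl, hr1]
      rw [wedgePairing_div _ _ _ _ _ hdet]
      simp [det2]
    refine ⟨?_, ?_⟩
    · have := comb_pair_mem_frames f.2 hdet
      rwa [← hr0, ← hrl] at this
    · rw [ha, hb]
      have hne : β * z.1 1 / (1 + Complex.I) ≠ 0 :=
        div_ne_zero (mul_ne_zero hβ0 hz1) one_add_I_ne_zero
      have h := comb_mem_frames hf (a := β * z.1 1 / (1 + Complex.I)) (b := 0) (c := 0) (d := β)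
        (by simpa using ⟨⟨⟨hβ0, hz1⟩, one_add_I_ne_zero⟩, hβ0⟩)
      simp only [zero_smul, add_zero, zero_add] at h
      refine ⟨h, ?_⟩
      conv_rhs => rw [← hz]
      refine inftyConf_eq_of (fun j => ⟨β, ?_⟩) ⟨_, rfl⟩
      have haff : (affineCoord n m y).1 j = (1 + Complex.I) * (z.1 j / z.1 1) := by
        rw [← hz, affineCoord_inftyConf, hz0, sub_zero, sub_zero]
      rw [haff]
      simp only [comb, smul_add, smul_smul, f]
      congr 2
      · have := one_add_I_ne_zero
        field_simp
      · ring
  refine ⟨_, hU, fun y => ((D i₀ i₁ i₀ l y / D i₀ l i₀ l y / (1 + Complex.I)) • r l y,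
        (D i₁ l i₀ l y / D i₀ l i₀ l y) • r i₀ y), ?_, fun y hy => (key y hy).2⟩
  have hd : ∀ a b, ContinuousOn (fun y => D a b i₀ l y / D i₀ l i₀ l y) {y | ∀ j, y.1 j ∈ O j} :=
    fun a b => (hDc _ _ _ _).div (hDc _ _ _ _) fun y hy => (key y hy).1
  exact (((hd _ _).div_const _).smul (hrc _)).prodMk ((hd _ _).smul (hrc _))

theorem exists_frame_lift {Γ : Type*} [Group Γ] (W : PathHom (Fconf (m + 2 + 1) 1 n) Γ)
    {x y : Fconf (m + 2 + 1) 1 n} (p : Path x y) :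
    ∀ f, inftyConf n (m + 2) (f, affineCoord n m x) = x →
      ∃ (f' : frames (Fin (n + 1))) (P : Path f f'),
        inftyConf n (m + 2) (f', affineCoord n m y) = y ∧
        W.val p = (W.comap (inftyConf n (m + 2))).val
          (P.prod (p.map (affineCoord n m).continuous)) := by
  choose U hU φ hφ hUφ using exists_local_frame (n := n) (m := m)
  induction p using path_induction with
  | htrans p q hp hq =>
    intro f hf
    obtain ⟨f', P, hf', hP⟩ := hp f hf
    obtain ⟨f'', Q, hf'', hQ⟩ := hq f' hf'
    refine ⟨f'', P.trans Q, hf'', ?_⟩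
    rw [W.val_trans, hP, hQ, ← PathHom.val_trans, Path.trans_prod_eq_prod_trans, Path.map_trans]
  | hhom p q hpq hp =>
    intro f hf
    obtain ⟨f', P, hf', hP⟩ := hp f hf
    refine ⟨f', P, hf', ?_⟩
    rw [← W.val_homotopic hpq, hP]
    refine PathHom.val_homotopic _ ?_
    exact Nonempty.map2 Path.Homotopic.prodHomotopy (Path.Homotopic.refl P)
      (hpq.map (affineCoord n m))
  | U => exact U ‹_›
  | hU x => exact hU x
  | hloc x p hp =>
    rename_i a b
    intro f hf
    have hp' : ∀ t, p t ∈ U x := fun t => hp (mem_range_self t)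
    choose h hh using hUφ x
    obtain ⟨c, hc, e⟩ := frame_unique (affineCoord_normalized a).1 (affineCoord_normalized a).2
      (hf.trans (hh a (by simpa using hp' 0)).symm)
    have hcont : Continuous fun t => φ x (p t) :=
      (hφ x).comp_continuous p.continuous hp'
    refine ⟨⟨c • φ x b, smul_mem_frames hc (h b (by simpa using hp' 1))⟩,
      ⟨⟨fun t => ⟨c • φ x (p t), smul_mem_frames hc (h (p t) (hp' t))⟩,
        (hcont.const_smul c).subtype_mk _⟩, ?_, ?_⟩,
      ?_, ?_⟩
    · ext1; simp [e]
    · ext1; simp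
    · rw [inftyConf_smul (f := ⟨φ x b, h b (by simpa using hp' 1)⟩) (c := c) rfl]
      exact hh b (by simpa using hp' 1)
    · rw [PathHom.comap_val]
      refine W.val_congr _ _ fun t => ?_
      change _ = inftyConf n (m + 2) (⟨c • φ x (p t), _⟩, affineCoord n m (p t))
      rw [inftyConf_smul (f := ⟨φ x (p t), h (p t) (hp' t)⟩) (c := c) rfl]
      exact (hh _ (hp' t)).symm

theorem val_loop_eq (hn : 2 ≤ n) {Γ : Type*} [Group Γ] (W : PathHom (Fconf (m + 2 + 1) 1 n) Γ)
    {x : Fconf (m + 2 + 1) 1 n} (p : Path x x) (f : frames (Fin (n + 1)))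
    (hf : inftyConf n (m + 2) (f, affineCoord n m x) = x) :
    W.val p = (W.comap (inftyConf n (m + 2))).val
      ((Path.refl f).prod (p.map (affineCoord n m).continuous)) := by
  obtain ⟨f', P, hf', hP⟩ := exists_frame_lift W p f hf
  obtain ⟨c, hc, e⟩ := frame_unique (affineCoord_normalized x).1 (affineCoord_normalized x).2
    (hf'.trans hf.symm)
  obtain ⟨a, ha⟩ : ∃ a : ℂ, Complex.exp a = c⁻¹ := ⟨_, Complex.exp_log (inv_ne_zero hc)⟩
  let Q : Path f f := ⟨⟨fun t => ⟨Complex.exp ((t : ℝ) * a) • (P t).1,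
      smul_mem_frames (Complex.exp_ne_zero _) (P t).2⟩, by fun_prop⟩, by ext1; simp, by
    ext1; simp [e, ha, smul_smul, hc]⟩
  have hQ : Q.Homotopic (Path.refl f) := frames_loop_homotopic_refl (by simp; omega) Q
  have e1 : W.val p = (W.comap (inftyConf n (m + 2))).val
      (Q.prod (p.map (affineCoord n m).continuous)) := by
    rw [hP, PathHom.comap_val, PathHom.comap_val]
    refine W.val_congr _ _ fun t => ?_
    change inftyConf n (m + 2) (P t, _) = inftyConf n (m + 2) (Q t, _)
    exact (inftyConf_smul rfl _).symm
  rw [e1]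
  refine PathHom.val_homotopic _ ?_
  exact Nonempty.map2 Path.Homotopic.prodHomotopy hQ (Path.Homotopic.refl _)

end Lifting

section Universal

variable {X Γ : Type*} [TopologicalSpace X] [Group Γ]

/-- `U` identifies the loops at `x` up to homotopy with the elements of `Γ`. -/
structure IsUniversalAt (U : PathHom X Γ) (x : X) : Prop where
  null : ∀ p : Path x x, U.val p = 1 → p.Homotopic (Path.refl x)
  surj : ∀ γ, ∃ p : Path x x, U.val p = γ

theorem IsUniversalAt.of_path {U : PathHom X Γ} {x y : X} (h : IsUniversalAt U x)
    (c : Path x y) : IsUniversalAt U y where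
  null p hp := by
    have h1 := h.null ((c.trans p).trans c.symm) (by simp [U.val_trans, hp, U.val_symm])
    obtain ⟨V, hV, -⟩ := exists_universal_pathHom y
    refine hV _ _ ?_
    have h2 := V.val_homotopic h1
    rw [V.val_trans, V.val_trans, V.val_symm, V.val_refl, mul_inv_eq_one] at h2
    rw [V.val_refl, mul_left_cancel (h2.trans (mul_one _).symm)]
  surj γ := by
    obtain ⟨p, hp⟩ := h.surj (U.val c * γ * (U.val c)⁻¹)
    refine ⟨(c.symm.trans p).trans c, ?_⟩
    rw [U.val_trans, U.val_trans, hp, U.val_symm]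
    group

theorem exists_isUniversalAt (x : X) :
    ∃ U : PathHom X (FundamentalGroup X x)ᵐᵒᵖ, IsUniversalAt U x := by
  obtain ⟨U, h1, h2⟩ := exists_universal_pathHom x
  exact ⟨U, fun p hp => h1 _ _ (hp.trans (U.val_refl _).symm), h2⟩

end Universal

section Covering

variable {k i n : ℕ}

/-- The projection from ordered to unordered configurations. -/
def confProj (k i n : ℕ) : C(Fconf k i n, Cconf k i n) :=
  ⟨Quotient.mk _, continuous_quotient_mk'⟩

theorem confProj_eq_iff {x y : Fconf k i n} :
    confProj k i n x = confProj k i n y ↔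
      ∃ ρ : Equiv.Perm (Fin k), (y : Fin k → CP n) = (x : Fin k → CP n) ∘ ρ :=
  Quotient.eq

theorem confProj_surjective (x : Cconf k i n) : ∃ y, confProj k i n y = x :=
  Quotient.exists_rep x

theorem comp_mem_Fconf {x : Fin k → CP n} (hx : x ∈ Fconf k i n) (ρ : Equiv.Perm (Fin k)) :
    x ∘ ρ ∈ Fconf k i n := by
  refine ⟨hx.1.comp ρ.injective, ?_⟩
  have h := ρ.surjective.range_comp fun j => (x j).rep
  exact (congrArg (fun s => finrank ℂ (span ℂ s)) h).trans hx.2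

instance : MulAction (Equiv.Perm (Fin k)) (Fconf k i n) where
  smul ρ x := ⟨x.1 ∘ ⇑ρ⁻¹, comp_mem_Fconf x.2 _⟩
  one_smul x := rfl
  mul_smul ρ τ x := by
    refine Subtype.ext ?_
    change x.1 ∘ ⇑(ρ * τ)⁻¹ = (x.1 ∘ ⇑τ⁻¹) ∘ ⇑ρ⁻¹
    rw [mul_inv_rev]
    rfl

theorem Fconf.smul_apply (ρ : Equiv.Perm (Fin k)) (x : Fconf k i n) (j : Fin k) :
    (ρ • x).1 j = x.1 (ρ⁻¹ j) := rfl

theorem isQuotientCoveringMap_confProj :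
    IsQuotientCoveringMap (confProj k i n) (Equiv.Perm (Fin k)) where
  toIsQuotientMap := isQuotientMap_quotient_mk'
  continuous_const_smul ρ := by
    refine Continuous.subtype_mk (continuous_pi fun j => ?_) _
    exact (continuous_apply _).comp continuous_subtype_val
  apply_eq_iff_mem_orbit {x y} := by
    rw [confProj_eq_iff]
    constructor
    · rintro ⟨ρ, h⟩
      refine ⟨ρ, Subtype.ext (funext fun j => ?_)⟩
      change y.1 (ρ⁻¹ j) = _
      rw [h]
      simp
    · rintro ⟨ρ, rfl⟩
      refine ⟨ρ, funext fun j => ?_⟩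
      simp [Fconf.smul_apply]
  disjoint x := by
    obtain ⟨V, hV, hd⟩ := (finite_range x.1).t2_separation
    refine ⟨{y | ∀ j, y.1 j ∈ V (x.1 j)}, ?_, ?_⟩
    · refine eventually_all.2 fun j => ?_
      exact ((hV (x.1 j)).2.preimage
        ((continuous_apply j).comp continuous_subtype_val)).mem_nhds (hV (x.1 j)).1
    · rintro ρ ⟨_, ⟨y, hy, rfl⟩, hy'⟩
      refine Equiv.ext fun j => ?_
      by_contra hne
      refine (hd (mem_range_self (ρ j)) (mem_range_self j) fun h => hne (x.2.1 h)).le_bot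
        ⟨?_, hy j⟩
      have := hy' (ρ j)
      simpa [Fconf.smul_apply] using this

theorem isCoveringMap_confProj : IsCoveringMap (confProj k i n) :=
  isQuotientCoveringMap_confProj.isCoveringMap

theorem exists_lift_path {x : Fconf k i n} {y : Cconf k i n} (p : Path (confProj k i n x) y) :
    ∃ (y' : Fconf k i n) (q : Path x y'), confProj k i n y' = y ∧
      ∀ t, confProj k i n (q t) = p t := by
  obtain ⟨Γ, h1, h2⟩ := isCoveringMap_confProj.exists_path_lifts p.toContinuousMap x p.source
  exact ⟨Γ 1, ⟨Γ, h2, rfl⟩, (congrFun h1 1).trans p.target, congrFun h1⟩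

theorem IsUniversalAt.null_lift {Γ : Type*} [Group Γ] {U : PathHom (Cconf k i n) Γ}
    {x y : Fconf k i n} (hU : IsUniversalAt U (confProj k i n x)) (p : Path x y)
    (hy : confProj k i n x = confProj k i n y) (h : (U.comap (confProj k i n)).val p = 1) :
    ∃ e : x = y, (p.cast rfl e).Homotopic (Path.refl x) := by
  have h1 := hU.null ((p.map (confProj k i n).continuous).cast rfl hy)
    (by rw [PathHom.val_cast]; exact h)
  have h2 := isCoveringMap_confProj.liftPath_apply_one_eq_of_homotopicRel h1 x (by simp) (by simp)
  have h3 := (isCoveringMap_confProj.eq_liftPath_iff' (γ := ((p.map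
    (confProj k i n).continuous).cast rfl hy).toContinuousMap) (e := x) (by simp)
    (Γ := p.toContinuousMap)).2 ⟨rfl, p.source⟩
  have h4 := isCoveringMap_confProj.liftPath_const (e := x) rfl
  have e : x = y := by
    have h5 := congrArg (fun f : C(I, Fconf k i n) => f 1) h3
    have h6 := congrArg (fun f : C(I, Fconf k i n) => f 1) h4
    exact (h6.symm.trans (h2.symm.trans h5.symm)).trans p.target
  subst e
  refine ⟨rfl, ?_⟩
  have := isCoveringMap_confProj.injective_path_homotopic_map (p := confProj k i n) x x
  exact Path.Homotopic.Quotient.exact (this (Quotient.sound h1))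

end Covering

section Append

variable {k : ℕ} {Γ : Type*} [Group Γ]

theorem exists_extend_perm (ρ : Equiv.Perm (Fin k)) : ∃ ρ' : Equiv.Perm (Fin (k + 1)),
    (∀ j : Fin k, ρ' j.castSucc = (ρ j).castSucc) ∧ ρ' (Fin.last k) = Fin.last k := by
  refine ⟨finSuccEquivLast.symm.permCongr (Equiv.optionCongr ρ), fun j => ?_, ?_⟩ <;>
  simp [Equiv.permCongr_apply]

/-- A radius exceeding the norms of all points of a configuration. -/
def confRadius (z : Fin k → ℂ) : ℝ := 1 + ∑ j, ‖z j‖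

theorem norm_lt_confRadius (z : Fin k → ℂ) (j : Fin k) : ‖z j‖ < confRadius z := by
  have := Finset.single_le_sum (f := fun j => ‖z j‖) (fun _ _ => norm_nonneg _)
    (Finset.mem_univ j)
  simp only [confRadius]
  linarith

theorem confRadius_comp (z : Fin k → ℂ) (ρ : Equiv.Perm (Fin k)) :
    confRadius (z ∘ ρ) = confRadius z :=
  congrArg (1 + ·) (Equiv.sum_comp ρ fun j => ‖z j‖)

theorem continuous_confRadius : Continuous (confRadius (k := k)) := by
  unfold confRadius
  fun_prop

/-- Append a far away point to a configuration. -/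
def appendFar (z : Fin k → ℂ) : Fin (k + 1) → ℂ :=
  Fin.snoc (α := fun _ => ℂ) z (confRadius z : ℂ)

@[simp] theorem appendFar_castSucc (z : Fin k → ℂ) (j : Fin k) :
    appendFar z j.castSucc = z j := Fin.snoc_castSucc (α := fun _ => ℂ) ..

@[simp] theorem appendFar_last (z : Fin k → ℂ) :
    appendFar z (Fin.last k) = confRadius z := Fin.snoc_last (α := fun _ => ℂ) ..

theorem re_lt_confRadius (z : Fin k → ℂ) (j : Fin k) : (z j).re < confRadius z :=
  (Complex.re_le_norm _).trans_lt (norm_lt_confRadius z j)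

theorem appendFar_mem_lexCell {z : Fin k → ℂ} {π : Equiv.Perm (Fin k)}
    {π' : Equiv.Perm (Fin (k + 1))} (h1 : ∀ j : Fin k, π' j.castSucc = (π j).castSucc)
    (h2 : π' (Fin.last k) = Fin.last k) (hz : z ∈ lexCell π) : appendFar z ∈ lexCell π' := by
  intro p q hpq
  induction p using Fin.lastCases with
  | last => exact absurd hpq (Fin.le_last q).not_gt
  | cast p =>
    induction q using Fin.lastCases with
    | last =>
      rw [h1, h2, appendFar_castSucc, appendFar_last]
      exact Or.inl (by simpa using re_lt_confRadius z _)
    | cast q =>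
      rw [h1, h1, appendFar_castSucc, appendFar_castSucc]
      exact hz p q (by simpa using hpq)

theorem appendFar_comp (z : Fin k → ℂ) {ρ : Equiv.Perm (Fin k)}
    {ρ' : Equiv.Perm (Fin (k + 1))} (h1 : ∀ j : Fin k, ρ' j.castSucc = (ρ j).castSucc)
    (h2 : ρ' (Fin.last k) = Fin.last k) : appendFar (z ∘ ρ) = appendFar z ∘ ρ' := by
  funext j
  induction j using Fin.lastCases with
  | last => simp [h2, confRadius_comp]
  | cast j => simp [h1]

theorem appendFar_mem {z : Fin k → ℂ} (hz : z ∈ planeConf k) :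
    appendFar z ∈ planeConf (k + 1) := by
  obtain ⟨π', h1, h2⟩ := exists_extend_perm (lexLabel z)
  exact lexCell_subset _ (appendFar_mem_lexCell h1 h2 (mem_lexCell hz))

theorem continuous_appendFar : Continuous (appendFar (k := k)) := by
  refine continuous_pi fun j => ?_
  induction j using Fin.lastCases with
  | last =>
    simp only [appendFar_last]
    exact Complex.continuous_ofReal.comp continuous_confRadius
  | cast j =>
    simp only [appendFar_castSucc]
    fun_prop

/-- Append a far away point to a configuration, as a map of configuration spaces. -/
def appendMap (k : ℕ) : C(planeConf k, planeConf (k + 1)) :=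
  ⟨fun z => ⟨appendFar z.1, appendFar_mem z.2⟩,
    (continuous_appendFar.comp continuous_subtype_val).subtype_mk _⟩

theorem seg_comap_appendMap (W : PathHom (planeConf (k + 1)) Γ) {S : Set (Fin k → ℂ)}
    (hS : Convex ℝ S) (hSF : S ⊆ planeConf k) {S' : Set (Fin (k + 1) → ℂ)} (hS' : Convex ℝ S')
    (hSF' : S' ⊆ planeConf (k + 1)) (h : ∀ z ∈ S, appendFar z ∈ S') {a b : Fin k → ℂ}
    (ha : a ∈ S) (hb : b ∈ S) :
    (W.comap (appendMap k)).seg a b = W.seg (appendFar a) (appendFar b) := by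
  have hs := (hS.segment_subset ha hb).trans hSF
  rw [← PathHom.val_segPath _ (a := ⟨a, hSF ha⟩) (b := ⟨b, hSF hb⟩) hs, PathHom.comap_val]
  exact W.val_eq_seg hS' hSF' _ fun t => h _ (segPath_mem (⟨a, hSF ha⟩ : planeConf k)
    ⟨b, hSF hb⟩ hs hS ha hb t)

theorem IsBraidHom.comap_appendMap {W : PathHom (planeConf (k + 1)) Γ} (hW : IsBraidHom W) :
    IsBraidHom (W.comap (appendMap k)) where
  inv ρ a b p := by
    obtain ⟨ρ', h1, h2⟩ := exists_extend_perm ρ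
    rw [PathHom.comap_val, PathHom.comap_val]
    exact (W.val_congr _ ((p.map (appendMap k).continuous).map (permuteLabels ρ').continuous)
      fun t => Subtype.ext (appendFar_comp (p t).1 h1 h2)).trans
      (hW.inv ρ' (p.map (appendMap k).continuous))
  cell π a ha b hb := by
    obtain ⟨π', h1, h2⟩ := exists_extend_perm π
    have h := fun z (hz : z ∈ lexCell π) => appendFar_mem_lexCell h1 h2 hz
    rw [seg_comap_appendMap W (convex_lexCell π) (lexCell_subset π) (convex_lexCell π')
      (lexCell_subset π') h ha hb]
    exact hW.cell π' _ (h a ha) _ (h b hb)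

/-- Configurations with increasing imaginary parts and a last point to the right of all others. -/
def farCone (k : ℕ) : Set (Fin (k + 1) → ℂ) :=
  {z | (∀ p q : Fin k, p < q → (z p.castSucc).im < (z q.castSucc).im) ∧
    ∀ p : Fin k, (z p.castSucc).re < (z (Fin.last k)).re}

theorem convex_farCone : Convex ℝ (farCone k) := by
  simp only [farCone, ofPred_forall, ofPred_and]
  exact (convex_iInter fun p => convex_iInter fun q => convex_iInter fun _ =>
    convex_im_lt _ _).inter (convex_iInter fun p => convex_re_lt _ _)

theorem farCone_subset : farCone k ⊆ planeConf (k + 1) := by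
  intro z hz a b hab
  induction a using Fin.lastCases with
  | last =>
    induction b using Fin.lastCases with
    | last => rfl
    | cast b => exact absurd (congrArg Complex.re hab) (hz.2 b).ne'
  | cast a =>
    induction b using Fin.lastCases with
    | last => exact absurd (congrArg Complex.re hab) (hz.2 a).ne
    | cast b =>
      rcases lt_trichotomy a b with h | h | h
      · exact absurd (congrArg Complex.im hab) (hz.1 _ _ h).ne
      · rw [h]
      · exact absurd (congrArg Complex.im hab) (hz.1 _ _ h).ne'

theorem appendFar_mem_farCone {z : Fin k → ℂ} (hz : z ∈ imCone k) : appendFar z ∈ farCone k := by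
  refine ⟨fun p q hpq => ?_, fun p => ?_⟩
  · simpa using hz p q hpq
  · simpa using re_lt_confRadius z p

theorem stdConf_mem_farCone {u : Equiv.Perm (Fin (k + 1))} (hu : u (Fin.last k) = Fin.last k) :
    stdConf u ∈ farCone k := by
  refine ⟨fun p q hpq => ?_, fun p => ?_⟩
  · simpa [stdConf] using hpq
  · have h1 : u⁻¹ (Fin.last k) = Fin.last k := by rw [Equiv.Perm.inv_eq_iff_eq, hu]
    have h2 : u⁻¹ p.castSucc ≠ Fin.last k := by
      rw [Ne, Equiv.Perm.inv_eq_iff_eq, hu]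
      exact p.castSucc_ne_last
    simp only [stdConf, h1]
    exact_mod_cast Fin.lt_last_iff_ne_last.2 h2

theorem IsBraidHom.genVal_comap_appendMap {W : PathHom (planeConf (k + 1)) Γ} (hW : IsBraidHom W)
    {i : ℕ} (hi : i + 1 < k) : genVal (W.comap (appendMap k)) i = genVal W i := by
  have hone := stdConf_mem_farCone (k := k) (u := 1) rfl
  have hl : adj (k + 1) i (Fin.last k) = Fin.last k := by
    ext
    rw [adj_val (by omega)]
    simp only [Fin.val_last]
    split_ifs <;> omega
  have hc : ∀ j : Fin k, adj (k + 1) i j.castSucc = (adj k i j).castSucc := by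
    intro j
    ext
    rw [adj_val (by omega)]
    simp only [Fin.val_castSucc]
    rw [adj_val hi]
  have hadj := stdConf_mem_farCone hl
  rw [genVal, seg_comap_appendMap W convex_imCone imCone_subset convex_farCone farCone_subset
    (fun z hz => appendFar_mem_farCone hz) (stdConf_mem_imCone _) (stdConf_mem_imCone _),
    ← W.seg_mul_seg convex_farCone farCone_subset
      (appendFar_mem_farCone (stdConf_mem_imCone _)) hone
      (appendFar_mem_farCone (stdConf_mem_imCone _)),
    ← W.seg_mul_seg convex_farCone farCone_subset hone hadj
      (appendFar_mem_farCone (stdConf_mem_imCone _)),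
    hW.cell 1 _ (appendFar_mem_lexCell (π := 1) (fun _ => rfl) rfl (stdConf_mem_lexCell 1)) _
      (stdConf_mem_lexCell 1),
    hW.cell (adj (k + 1) i) _ (stdConf_mem_lexCell _) _
      (appendFar_mem_lexCell hc hl (stdConf_mem_lexCell _)), one_mul, mul_one, genVal]

end Append

section Comparison

variable {Γ : Type*} [Group Γ]

/-- The identity path of the unit interval. -/
def unitPath : Path (0 : I) 1 := ⟨⟨id, continuous_id⟩, rfl, rfl⟩

theorem PathHom.val_slide {Z : Type*} [TopologicalSpace Z] (U : PathHom (I × Z) Γ) {a b : Z}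
    (p : Path a b) :
    U.val ((Path.refl (0 : I)).prod p) = U.val (unitPath.prod (Path.refl a)) *
      U.val ((Path.refl (1 : I)).prod p) * (U.val (unitPath.prod (Path.refl b)))⁻¹ := by
  rw [eq_mul_inv_iff_mul_eq, ← U.val_trans, ← U.val_trans]
  exact U.val_homotopic ((homotopic_prod_right unitPath p).symm.trans
    (homotopic_prod_left unitPath p))

/-- If rotating a configuration amounts to rescaling the first vector of a frame, then the full
rotation is trivial. -/
theorem val_rot_eq_one {Y : Type*} [TopologicalSpace Y] {n N : ℕ} (hn : 2 ≤ n) (U : PathHom Y Γ)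
    (K : C(frames (Fin (n + 1)) × planeConf N, Y)) (f : frames (Fin (n + 1)))
    (L : C(planeConf N, Y)) (hL : ∀ z, L z = K (f, z))
    (hK : ∀ (c : ℂ) (f' : frames (Fin (n + 1))) (z z' : planeConf N),
      f'.1 = (c • f.1.1, f.1.2) → z'.1 = c • z.1 → K (f', z) = K (f, z')) :
    ((U.comap L).comap (rotConf N)).val (linePath 0 (2 * Real.pi)) = 1 := by
  let r : I → frames (Fin (n + 1)) := fun t =>
    ⟨(Complex.exp (t * (2 * Real.pi) * Complex.I) • f.1.1, f.1.2), by
      have := comb_pair_mem_frames f.2 (c := (Complex.exp (t * (2 * Real.pi) * Complex.I), 0))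
        (d := (0, 1)) (by simp [det2, Complex.exp_ne_zero])
      simpa [comb] using this⟩
  have hr : Continuous r := by
    refine Continuous.subtype_mk ?_ _
    fun_prop
  let p : Path f f := ⟨⟨r, hr⟩, Subtype.ext (Prod.ext (by simp [r]) rfl),
    Subtype.ext (Prod.ext (by simp [r, Complex.exp_two_pi_mul_I]) rfl)⟩
  have hp := frames_loop_homotopic_refl (by simpa using hn) p
  rw [PathHom.comap_val, PathHom.comap_val]
  have e1 : U.val (((linePath 0 (2 * Real.pi)).map (rotConf N).continuous).map L.continuous) =
      (U.comap K).val (p.prod (Path.refl (baseConf N))) := by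
    rw [PathHom.comap_val]
    refine U.val_congr _ _ fun t => (hL _).trans ?_
    refine (hK (Complex.exp (t * (2 * Real.pi) * Complex.I)) (r t) (baseConf N) _ rfl ?_).symm
    change (rotConf N (0 + t * (2 * Real.pi - 0))).1 = _
    rw [rotConf_coe]
    simp
  rw [e1, (U.comap K).val_homotopic (Nonempty.map2 Path.Homotopic.prodHomotopy hp
    (Path.Homotopic.refl _))]
  exact (U.comap K).val_refl (f, baseConf N)

variable {n k : ℕ}

/-- The configuration of points of an affine line. -/
def finiteConf (n N : ℕ) [Nontrivial (Fin N)] :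
    C(frames (Fin (n + 1)) × planeConf N, Fconf N 1 n) :=
  (projConf n N).comp ⟨fun x => (x.1, ⟨fun j => (x.2.1 j, 1), fun i j hij => by
    simpa [det2] using sub_ne_zero.2 fun h => hij (x.2.2 h)⟩), by
      refine continuous_fst.prodMk (Continuous.subtype_mk (continuous_pi fun j => ?_) _)
      exact ((continuous_apply j).comp (continuous_subtype_val.comp continuous_snd)).prodMk
        continuous_const⟩

theorem finiteConf_rescale {N : ℕ} [Nontrivial (Fin N)] (f : frames (Fin (n + 1))) (c : ℂ)
    (f' : frames (Fin (n + 1))) (z z' : planeConf N) (hf : f'.1 = (c • f.1.1, f.1.2))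
    (hz : z'.1 = c • z.1) : finiteConf n N (f', z) = finiteConf n N (f, z') := by
  refine Subtype.ext (funext fun j => ?_)
  refine toCP_eq_iff.2 ⟨1, ?_⟩
  change (1 : ℂ) • comb f.1 (z'.1 j, 1) = comb f'.1 (z.1 j, 1)
  rw [hf, hz]
  simp [comb, smul_smul, mul_comm]

theorem inftyConf_rescale [Nontrivial (Fin (k + 1))] (f : frames (Fin (n + 1))) (c : ℂ)
    (f' : frames (Fin (n + 1))) (z z' : planeConf k) (hf : f'.1 = (c • f.1.1, f.1.2))
    (hz : z'.1 = c • z.1) : inftyConf n k (f', z) = inftyConf n k (f, z') := by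
  refine inftyConf_eq_of (fun j => ⟨1, ?_⟩) ⟨c, by rw [hf]⟩
  rw [hf, hz]
  simp [comb, smul_smul, mul_comm]

theorem slide_ne_zero (z : Fin k → ℂ) (s : I) (j : Fin k) :
    (confRadius z : ℂ) - (s : ℂ) * z j ≠ 0 := by
  rw [sub_ne_zero]
  intro h
  have h1 : confRadius z ≤ ‖z j‖ := by
    calc confRadius z ≤ ‖(confRadius z : ℂ)‖ := by
          rw [Complex.norm_real]; exact Real.le_norm_self _
      _ = (s : ℝ) * ‖z j‖ := by
          rw [h, norm_mul, Complex.norm_real, Real.norm_of_nonneg s.2.1]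
      _ ≤ ‖z j‖ := mul_le_of_le_one_left (norm_nonneg _) s.2.2
  exact absurd (norm_lt_confRadius z j) h1.not_gt

/-- Slide the point at infinity to a far away point of the affine line. -/
def slideConf [Nontrivial (Fin (k + 1))] (f : frames (Fin (n + 1))) :
    C(I × planeConf k, Fconf (k + 1) 1 n) :=
  (projConf n (k + 1)).comp ⟨fun x => (f, ⟨snocCoef x.2.1 (confRadius x.2.1, (x.1 : ℂ)),
    snocCoef_mem x.2.2 (slide_ne_zero _ _)⟩), by
      refine continuous_const.prodMk (Continuous.subtype_mk ?_ _)
      refine continuous_snocCoef (by fun_prop) (Continuous.prodMk ?_ ?_)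
      · exact Complex.continuous_ofReal.comp (continuous_confRadius.comp (by fun_prop))
      · fun_prop⟩

theorem slideConf_apply [Nontrivial (Fin (k + 1))] (f : frames (Fin (n + 1))) (s : I)
    (z : planeConf k) (j : Fin (k + 1)) : (slideConf f (s, z)).1 j =
      toCP ⟨comb f.1 (snocCoef z.1 (confRadius z.1, (s : ℂ)) j),
        comb_ne_zero f ⟨_, snocCoef_mem z.2 (slide_ne_zero z.1 s)⟩ j⟩ := rfl

theorem slideConf_zero [Nontrivial (Fin (k + 1))] (f : frames (Fin (n + 1)))
    (z : planeConf k) : slideConf f (0, z) = inftyConf n k (f, z) := by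
  refine Subtype.ext (funext fun j => ?_)
  rw [slideConf_apply, inftyConf_apply, toCP_eq_iff]
  induction j using Fin.lastCases with
  | last => exact ⟨confRadius z.1, by simp [comb]⟩
  | cast j => exact ⟨1, by simp⟩

theorem slideConf_one [Nontrivial (Fin (k + 1))] (f : frames (Fin (n + 1)))
    (z : planeConf k) : slideConf f (1, z) = finiteConf n (k + 1) (f, appendMap k z) := by
  refine Subtype.ext (funext fun j => toCP_eq_iff.2 ⟨1, ?_⟩)
  change (1 : ℂ) • comb f.1 (appendFar z.1 j, 1) =
    comb f.1 (snocCoef z.1 (confRadius z.1, ((1 : I) : ℂ)) j)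
  induction j using Fin.lastCases with
  | last => simp
  | cast j => simp

theorem confProj_finiteConf_permuteLabels {N : ℕ} [Nontrivial (Fin N)] (f : frames (Fin (n + 1)))
    (z : planeConf N) (ρ : Equiv.Perm (Fin N)) :
    confProj N 1 n (finiteConf n N (f, permuteLabels ρ z)) =
      confProj N 1 n (finiteConf n N (f, z)) :=
  (confProj_eq_iff.2 ⟨ρ, rfl⟩).symm

theorem snocCoef_comp (z : Fin k → ℂ) (e : ℂ × ℂ) {ρ : Equiv.Perm (Fin k)}
    {ρ' : Equiv.Perm (Fin (k + 1))} (h1 : ∀ j : Fin k, ρ' j.castSucc = (ρ j).castSucc)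
    (h2 : ρ' (Fin.last k) = Fin.last k) : snocCoef (z ∘ ρ) e = snocCoef z e ∘ ρ' := by
  funext j
  induction j using Fin.lastCases with
  | last => simp [h2]
  | cast j => simp [h1]

theorem confProj_slideConf_permuteLabels [Nontrivial (Fin (k + 1))]
    (f : frames (Fin (n + 1))) (s : I)
    (z : planeConf k) (ρ : Equiv.Perm (Fin k)) :
    confProj (k + 1) 1 n (slideConf f (s, permuteLabels ρ z)) =
      confProj (k + 1) 1 n (slideConf f (s, z)) := by
  obtain ⟨ρ', h1, h2⟩ := exists_extend_perm ρ
  refine (confProj_eq_iff.2 ⟨ρ', funext fun j => toCP_eq_iff.2 ⟨1, ?_⟩⟩).symm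
  change (1 : ℂ) • comb f.1 (snocCoef z.1 (confRadius z.1, (s : ℂ)) (ρ' j)) =
    comb f.1 (snocCoef (z.1 ∘ ρ) (confRadius (z.1 ∘ ρ), (s : ℂ)) j)
  rw [one_smul, snocCoef_comp _ _ h1 h2, confRadius_comp]
  rfl

theorem confProj_inftyConf_permuteLabels [Nontrivial (Fin (k + 1))] (f : frames (Fin (n + 1)))
    (z : planeConf k) (ρ : Equiv.Perm (Fin k)) :
    confProj (k + 1) 1 n (inftyConf n k (f, permuteLabels ρ z)) =
      confProj (k + 1) 1 n (inftyConf n k (f, z)) := by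
  rw [← slideConf_zero, ← slideConf_zero, confProj_slideConf_permuteLabels]

/-- Points of an affine line as an unordered configuration. -/
def finiteProj {N : ℕ} [Nontrivial (Fin N)] (f : frames (Fin (n + 1))) :
    C(planeConf N, Cconf N 1 n) :=
  (confProj N 1 n).comp ((finiteConf n N).comp ⟨fun z => (f, z), by fun_prop⟩)

/-- Points of an affine line and its point at infinity as an unordered configuration. -/
def inftyProj [Nontrivial (Fin (k + 1))] (f : frames (Fin (n + 1))) :
    C(planeConf k, Cconf (k + 1) 1 n) :=
  (confProj (k + 1) 1 n).comp ((inftyConf n k).comp ⟨fun z => (f, z), by fun_prop⟩)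

/-- The normalizing gauge of a path homomorphism on the space of plane configurations. -/
def cellGauge {N : ℕ} (W : PathHom (planeConf N) Γ) (a : planeConf N) : Γ :=
  W.seg (stdConf 1) ((a : Fin N → ℂ) ∘ lexLabel (a : Fin N → ℂ))

theorem comp_lexLabel_permuteLabels {N : ℕ} (ρ : Equiv.Perm (Fin N)) (a : planeConf N) :
    (permuteLabels ρ a : Fin N → ℂ) ∘ lexLabel (permuteLabels ρ a : Fin N → ℂ) =
      (a : Fin N → ℂ) ∘ lexLabel (a : Fin N → ℂ) := by
  rw [permuteLabels_coe, lexLabel_comp a.2]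
  funext j
  simp

theorem cellGauge_permuteLabels {N : ℕ} (W : PathHom (planeConf N) Γ) (ρ : Equiv.Perm (Fin N))
    (a : planeConf N) : cellGauge W (permuteLabels ρ a) = cellGauge W a := by
  rw [cellGauge, cellGauge, comp_lexLabel_permuteLabels]

theorem cellGauge_of_mem {N : ℕ} (W : PathHom (planeConf N) Γ) {a : planeConf N}
    (ha : (a : Fin N → ℂ) ∈ lexCell 1) : cellGauge W a = W.seg (stdConf 1) a := by
  rw [cellGauge, lexLabel_of_mem ha]
  rfl

theorem cellGauge_baseConf {N : ℕ} (W : PathHom (planeConf N) Γ) :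
    cellGauge W (baseConf N) = 1 := by
  rw [cellGauge_of_mem W (stdConf_mem_lexCell 1)]
  exact W.seg_self

variable [Nontrivial (Fin (k + 1))]

/-- The braid homomorphism induced by a path homomorphism on unordered configurations. -/
def braidPart (f : frames (Fin (n + 1))) (U : PathHom (Cconf (k + 1) 1 n) Γ) :
    PathHom (planeConf (k + 1)) Γ :=
  (U.comap (finiteProj f)).gauge (cellGauge (U.comap (finiteProj f)))

theorem isBraidHom_braidPart (f : frames (Fin (n + 1))) (U : PathHom (Cconf (k + 1) 1 n) Γ) :
    IsBraidHom (braidPart f U) := by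
  refine isBraidHom_gauge fun ρ a b p => ?_
  exact U.val_congr _ _ fun t => confProj_finiteConf_permuteLabels f (p t) ρ

theorem braidPart_val (f : frames (Fin (n + 1))) (U : PathHom (Cconf (k + 1) 1 n) Γ)
    {c : planeConf (k + 1)} {ρ : Equiv.Perm (Fin (k + 1))}
    (hc : c = permuteLabels ρ (baseConf (k + 1)))
    (p : Path (baseConf (k + 1)) c) :
    (braidPart f U).val p = (U.comap (finiteProj f)).val p := by
  subst hc
  rw [braidPart, PathHom.gauge_val, cellGauge_permuteLabels, cellGauge_baseConf, one_mul, inv_one,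
    mul_one]

/-- The comparison of the two families of configurations along the sliding of infinity. -/
def slideGauge (f : frames (Fin (n + 1))) (U : PathHom (Cconf (k + 1) 1 n) Γ)
    (a : planeConf k) : Γ :=
  (U.comap ((confProj (k + 1) 1 n).comp (slideConf f))).val (unitPath.prod (Path.refl a)) *
    (cellGauge (U.comap (finiteProj f)) (appendMap k a))⁻¹

theorem slideGauge_permuteLabels (f : frames (Fin (n + 1))) (U : PathHom (Cconf (k + 1) 1 n) Γ)
    (ρ : Equiv.Perm (Fin k)) (a : planeConf k) :
    slideGauge f U (permuteLabels ρ a) = slideGauge f U a := by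
  obtain ⟨ρ', h1, h2⟩ := exists_extend_perm ρ
  have h : appendMap k (permuteLabels ρ a) = permuteLabels ρ' (appendMap k a) :=
    Subtype.ext (appendFar_comp a.1 h1 h2)
  rw [slideGauge, slideGauge, h, cellGauge_permuteLabels]
  congr 1
  exact U.val_congr _ _ fun t => confProj_slideConf_permuteLabels f t a ρ

theorem val_inftyProj (f : frames (Fin (n + 1))) (U : PathHom (Cconf (k + 1) 1 n) Γ)
    {a b : planeConf k} (p : Path a b) :
    (U.comap (inftyProj f)).val p = slideGauge f U a *
      ((braidPart f U).comap (appendMap k)).val p * (slideGauge f U b)⁻¹ := by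
  have e := (U.comap ((confProj (k + 1) 1 n).comp (slideConf f))).val_slide p
  have e0 : (U.comap ((confProj (k + 1) 1 n).comp (slideConf f))).val
      ((Path.refl (0 : I)).prod p) = (U.comap (inftyProj f)).val p :=
    U.val_congr _ _ fun t => congrArg (confProj (k + 1) 1 n) (slideConf_zero f (p t))
  have e1 : (U.comap ((confProj (k + 1) 1 n).comp (slideConf f))).val
      ((Path.refl (1 : I)).prod p) =
        (U.comap (finiteProj f)).val (p.map (appendMap k).continuous) :=
    U.val_congr _ _ fun t => congrArg (confProj (k + 1) 1 n) (slideConf_one f (p t))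
  rw [← e0, e, e1, (braidPart f U).comap_val, braidPart, PathHom.gauge_val, slideGauge,
    slideGauge]
  group

theorem braidPart_relations (hn : 2 ≤ n) (f : frames (Fin (n + 1)))
    (U : PathHom (Cconf (k + 1) 1 n) Γ) :
    garside (genVal (braidPart f U)) (k + 1) ^ 2 = 1 ∧
      garside (genVal (braidPart f U)) k ^ 2 = 1 := by
  have hW := isBraidHom_braidPart f U
  have hrot : ∀ N, rotConf N (2 * Real.pi) = rotConf N 0 := fun N => by
    simpa using rotConf_add_int (N := N) 0 1
  constructor
  · rw [← hW.val_rot, PathHom.comap_val, braidPart, PathHom.gauge_val, ← PathHom.comap_val,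
      val_rot_eq_one hn U ((confProj (k + 1) 1 n).comp (finiteConf n (k + 1))) f (finiteProj f)
        (fun z => rfl) fun c f' z z' hf hz =>
          congrArg (confProj (k + 1) 1 n) (finiteConf_rescale f c f' z z' hf hz), hrot]
    simp
  · have hV := hW.comap_appendMap
    rw [garside_congr fun i hi => (hW.genVal_comap_appendMap hi).symm, ← hV.val_rot,
      PathHom.comap_val]
    have e := val_inftyProj f U ((linePath 0 (2 * Real.pi)).map (rotConf k).continuous)
    rw [← PathHom.comap_val, val_rot_eq_one hn U ((confProj (k + 1) 1 n).comp (inftyConf n k)) f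
      (inftyProj f) (fun z => rfl) fun c f' z z' hf hz =>
          congrArg (confProj (k + 1) 1 n) (inftyConf_rescale f c f' z z' hf hz),
      congrArg (slideGauge f U) (hrot k)] at e
    simpa [eq_comm (a := (1 : Γ)), mul_inv_eq_one, mul_eq_left] using e

/-- The base point of the affine configurations is joined to the base point of the configurations
containing the point at infinity. -/
theorem exists_slide_path (f : frames (Fin (n + 1))) (U : PathHom (Cconf (k + 1) 1 n) Γ) :
    ∃ t : Path (inftyConf n k (f, baseConf k)) (finiteConf n (k + 1) (f, baseConf (k + 1))),
      (U.comap (confProj (k + 1) 1 n)).val t = slideGauge f U (baseConf k) := by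
  have ha : (appendMap k (baseConf k)).1 ∈ lexCell 1 :=
    appendFar_mem_lexCell (π := 1) (fun _ => rfl) rfl (stdConf_mem_lexCell 1)
  have hb : (baseConf (k + 1)).1 ∈ lexCell 1 := stdConf_mem_lexCell 1
  let s := segPath (appendMap k (baseConf k)) (baseConf (k + 1))
    (((convex_lexCell 1).segment_subset ha hb).trans (lexCell_subset 1))
  refine ⟨(((unitPath.prod (Path.refl (baseConf k))).map (slideConf f).continuous).cast
    (slideConf_zero f _).symm (slideConf_one f _).symm).trans
      (s.map ((finiteConf n (k + 1)).comp ⟨fun z => (f, z), by fun_prop⟩).continuous), ?_⟩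
  rw [PathHom.val_trans, PathHom.val_cast, slideGauge, cellGauge_of_mem _ ha,
    (U.comap (finiteProj f)).seg_inv (convex_lexCell 1) (lexCell_subset 1)
      (stdConf_mem_lexCell 1) ha]
  congr 1
  exact (U.comap (finiteProj f)).val_segPath _

end Comparison

section Presentation

variable {Γ : Type*} [Group Γ] {m : ℕ}

theorem br_of_lt {i : ℕ} (h : i < m) : br m i = FreeGroup.of ⟨i, h⟩ := dif_pos h

/-- The standard generators of a group presented by braid generators. -/
def braidGen (R : Set (FreeGroup (Fin m))) (i : ℕ) : PresentedGroup R :=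
  PresentedGroup.mk R (br m i)

theorem artinFam_braidGen {R : Set (FreeGroup (Fin m))} (hR : ArtinRels m ⊆ R) :
    ArtinFam (m + 1) (braidGen R) := by
  constructor
  · intro i j hij hj
    have := PresentedGroup.one_of_mem (hR (Or.inl ⟨i, j, hij, by omega, rfl⟩))
    rwa [map_mul, map_inv, mul_inv_eq_one, map_mul, map_mul] at this
  · intro i hi
    have := PresentedGroup.one_of_mem (hR (Or.inr ⟨i, by omega, rfl⟩))
    rw [map_mul, map_inv, mul_inv_eq_one] at this
    simp only [map_mul] at this
    exact this

theorem closure_braidGen (R : Set (FreeGroup (Fin m))) (g : PresentedGroup R) :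
    g ∈ Subgroup.closure (braidGen R '' {i | i < m}) := by
  have h := PresentedGroup.closure_range_of R
  have h2 : range (PresentedGroup.of (rels := R)) ⊆ braidGen R '' {i | i < m} := by
    rintro _ ⟨i, rfl⟩
    exact ⟨i, i.2, by rw [braidGen, br_of_lt i.2]; rfl⟩
  exact Subgroup.closure_mono h2 (h ▸ Subgroup.mem_top g)

/-- The evaluation of words at a sequence of elements. -/
def evalWord (m : ℕ) (a : ℕ → Γ) : FreeGroup (Fin m) →* Γ := FreeGroup.lift fun i => a i

theorem evalWord_br (a : ℕ → Γ) {i : ℕ} (h : i < m) : evalWord m a (br m i) = a i := by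
  rw [br_of_lt h, evalWord, FreeGroup.lift_apply_of]

theorem evalWord_artinRels {a : ℕ → Γ} (ha : ArtinFam (m + 1) a) {r : FreeGroup (Fin m)}
    (hr : r ∈ ArtinRels m) : evalWord m a r = 1 := by
  rcases hr with ⟨i, j, hij, hj, rfl⟩ | ⟨i, hi, rfl⟩
  · rw [map_mul, map_inv, mul_inv_eq_one, map_mul, map_mul, evalWord_br a (by omega),
      evalWord_br a hj]
    exact ha.comm i j hij (by omega)
  · rw [map_mul, map_inv, mul_inv_eq_one]
    simp only [map_mul]
    rw [evalWord_br a hi, evalWord_br a (by omega)]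
    exact ha.braid i (by omega)

theorem exists_presented_hom {R : Set (FreeGroup (Fin m))} {a : ℕ → Γ}
    (ha : ∀ r ∈ R, evalWord m a r = 1) :
    ∃ φ : PresentedGroup R →* Γ, ∀ i < m, φ (braidGen R i) = a i :=
  ⟨PresentedGroup.toGroup ha, fun _ hi => evalWord_br a hi⟩

theorem sphereWord_eq : sphereWord m = ascWord (br m) m * descWord (br m) m := rfl

theorem deltaWord_eq : DeltaWord m = garside (br m) m := rfl

theorem artinFam_adj {N : ℕ} : ArtinFam N (adj N) := artinFam_of_fun id fun _ _ _ => rfl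

theorem posLift_adj_self {N : ℕ} (u : Equiv.Perm (Fin N)) : posLift (adj N) u = u := by
  have h := posLift_spec (adj N) u
  generalize posLift (adj N) u = g at h
  induction h with
  | one => rfl
  | step u g i h1 h2 ih => rw [ih]

theorem ascWord_congr {a b : ℕ → Γ} {l : ℕ} (h : ∀ i < l, a i = b i) :
    ascWord a l = ascWord b l := by
  unfold ascWord
  congr 1
  exact List.map_congr_left fun i hi => h i (List.mem_range.1 hi)

theorem cosetRep_congr {k : ℕ} {a b : ℕ → Γ} (hk : 0 < k) (h : ∀ i < k, a i = b i) (d : ℕ) :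
    cosetRep k a d = cosetRep k b d := by
  induction d with
  | zero => rfl
  | succ d ih => rw [cosetRep, cosetRep, ih, h _ (by omega)]

theorem map_cosetRep {H : Type*} [Group H] (φ : Γ →* H) (k : ℕ) (a : ℕ → Γ) (d : ℕ) :
    φ (cosetRep k a d) = cosetRep k (fun i => φ (a i)) d := by
  induction d with
  | zero => exact map_one φ
  | succ d ih => rw [cosetRep, cosetRep, map_mul, ih]

theorem cosetRep_adj_apply {k d : ℕ} (hd : d ≤ k) :
    cosetRep k (adj (k + 1)) d ⟨k - d, by omega⟩ = Fin.last k := by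
  induction d with
  | zero => rfl
  | succ d ih =>
    have : adj (k + 1) (k - 1 - d) ⟨k - (d + 1), by omega⟩ = ⟨k - d, by omega⟩ := by
      ext
      rw [adj_val (by omega), if_pos (by simp only; omega)]
      simp only
      omega
    rw [cosetRep, Equiv.Perm.mul_apply, this, ih (by omega)]

end Presentation

section Main

variable {Γ : Type*} [Group Γ] {n m k : ℕ}

theorem eq_one_of_comp_eq {α : Type*} {x : Fin k → α} (hx : Function.Injective x)
    {ρ : Equiv.Perm (Fin k)} (h : x = x ∘ ρ) : ρ = 1 :=
  Equiv.ext fun j => hx (congrFun h j).symm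

theorem homotopic_refl_cast {X : Type*} [TopologicalSpace X] {a b : X} {p : Path a a}
    (h : p.Homotopic (Path.refl a)) (e : b = a) : (p.cast e e).Homotopic (Path.refl b) := by
  subst e
  exact h

theorem inftyConf_injective [Nontrivial (Fin (k + 1))] (f : frames (Fin (n + 1)))
    {z z' : planeConf k} (h : inftyConf n k (f, z) = inftyConf n k (f, z')) : z = z' := by
  refine Subtype.ext (funext fun j => ?_)
  obtain ⟨a, ha⟩ := toCP_eq_iff.1 ((inftyConf_apply f z j.castSucc).symm.trans
    ((congrFun (congrArg Subtype.val h) j.castSucc).trans (inftyConf_apply f z' j.castSucc)))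
  have ha' : a • comb f.1 (snocCoef z'.1 (1, 0) j.castSucc) =
    comb f.1 (snocCoef z.1 (1, 0) j.castSucc) := ha
  rw [snocCoef_castSucc, snocCoef_castSucc, smul_comb] at ha'
  have := comb_injective f ha'
  simp only [Prod.mk.injEq, mul_one] at this
  rw [← this.1, this.2, one_mul]

theorem baseConf_zero : (baseConf (m + 2)).1 0 = 0 := by
  simp [baseConf, stdConf, Complex.ext_iff]

theorem baseConf_one : (baseConf (m + 2)).1 1 = 1 + Complex.I := by
  simp [baseConf, stdConf, Complex.ext_iff]

theorem affineCoord_baseConf (f : frames (Fin (n + 1))) :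
    affineCoord n m (inftyConf n (m + 2) (f, baseConf (m + 2))) = baseConf (m + 2) := by
  refine Subtype.ext (funext fun j => ?_)
  rw [affineCoord_inftyConf, baseConf_zero, baseConf_one, sub_zero, sub_zero,
    mul_div_cancel₀ _ one_add_I_ne_zero]

/-- A null-homotopic loop of configurations containing the point at infinity is the product of a
null-homotopic plane braid and a loop of affine transformations. -/
theorem val_of_null {W : PathHom (planeConf (m + 2)) Γ} (hW : IsBraidHom W)
    (f : frames (Fin (n + 1))) (p : Path (baseConf (m + 2)) (baseConf (m + 2)))
    (hp : (p.map ((inftyConf n (m + 2)).comp ⟨fun z => (f, z), by fun_prop⟩).continuous).Homotopic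
      (Path.refl _)) : ∃ l : ℤ, W.val p = (garside (genVal W) (m + 2) ^ 2) ^ l := by
  have h01 : ∀ t, (p t).1 1 - (p t).1 0 ≠ 0 := fun t =>
    sub_ne_zero.2 fun h => absurd ((p t).2 h) (by simp)
  have hc : ∀ j, Continuous fun t => (p t).1 j := fun j =>
    (continuous_apply j).comp (continuous_subtype_val.comp p.continuous)
  have hδ := hp.map (affineCoord n m)
  have e := (affineCoord_baseConf (m := m) f).symm
  refine hW.val_affine p (((p.map ((inftyConf n (m + 2)).comp
    ⟨fun z => (f, z), by fun_prop⟩).continuous).map (affineCoord n m).continuous).cast e e) ?_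
    ⟨fun t => ((p t).1 1 - (p t).1 0) / (1 + Complex.I), ((hc 1).sub (hc 0)).div_const _⟩
    (fun t => div_ne_zero (h01 t) one_add_I_ne_zero) ?_ ?_ ⟨fun t => (p t).1 0, hc 0⟩ ?_ ?_ ?_
  · exact homotopic_refl_cast hδ e
  · simp [baseConf_zero, baseConf_one, one_add_I_ne_zero]
  · simp [baseConf_zero, baseConf_one, one_add_I_ne_zero]
  · simp [baseConf_zero]
  · simp [baseConf_zero]
  · intro t j
    change _ = ((p t).1 1 - (p t).1 0) / (1 + Complex.I) *
      (affineCoord n m (inftyConf n (m + 2) (f, p t))).1 j + (p t).1 0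
    rw [affineCoord_inftyConf]
    have := h01 t
    have := one_add_I_ne_zero
    field_simp
    ring

theorem exists_isUniversalAt_base [Nontrivial (Fin (k + 1))] {U : PathHom (Cconf (k + 1) 1 n) Γ}
    {f : frames (Fin (n + 1))} {z : planeConf k}
    (hU : IsUniversalAt U (confProj (k + 1) 1 n (inftyConf n k (f, z)))) :
    IsUniversalAt U (confProj (k + 1) 1 n (inftyConf n k (f, baseConf k))) ∧
      IsUniversalAt U (confProj (k + 1) 1 n (finiteConf n (k + 1) (f, baseConf (k + 1)))) := by
  have h1 : (permuteLabels (lexLabel z.1)⁻¹ (baseConf k)).1 ∈ lexCell (lexLabel z.1) := by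
    have := (comp_mem_lexCell (ρ := (lexLabel z.1)⁻¹)).2
      (stdConf_mem_lexCell (1 : Equiv.Perm (Fin k)))
    rwa [inv_inv, mul_one] at this
  have hs := ((convex_lexCell _).segment_subset (mem_lexCell z.2) h1).trans (lexCell_subset _)
  have h2 := hU.of_path (((segPath z _ hs).map (inftyProj f).continuous).cast rfl
    (confProj_inftyConf_permuteLabels f (baseConf k) (lexLabel z.1)⁻¹).symm)
  obtain ⟨t, -⟩ := exists_slide_path f U
  exact ⟨h2, h2.of_path (t.map (confProj (k + 1) 1 n).continuous)⟩

/-- Every value of a universal path homomorphism is the value of a plane braid. -/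
theorem exists_val_eq (hn : 2 ≤ n) {U : PathHom (Cconf (m + 2 + 1) 1 n) Γ}
    {f : frames (Fin (n + 1))}
    (hU : IsUniversalAt U (confProj (m + 2 + 1) 1 n
      (finiteConf n (m + 2 + 1) (f, baseConf (m + 2 + 1)))))
    (hreal : ∀ ρ, ∃ (c : planeConf (m + 2 + 1)) (_ : Path (baseConf (m + 2 + 1)) c),
      c = permuteLabels ρ (baseConf (m + 2 + 1))) (γ : Γ) :
    ∃ (a b : planeConf (m + 2)) (p : Path a b) (c : planeConf (m + 2 + 1))
      (q : Path (baseConf (m + 2 + 1)) c),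
      γ = ((braidPart f U).comap (appendMap (m + 2))).val p * (braidPart f U).val q := by
  obtain ⟨p, rfl⟩ := hU.surj γ
  obtain ⟨y, q, hy, hq⟩ := exists_lift_path p
  obtain ⟨ρ, hρ⟩ := confProj_eq_iff.1 hy.symm
  obtain ⟨c, r, hc⟩ := hreal ρ
  have hyc : y = finiteConf n (m + 2 + 1) (f, c) := by
    rw [hc]
    exact Subtype.ext hρ
  have e1 : U.val p = (U.comap (confProj _ 1 n)).val q := (U.val_congr _ _ hq).symm
  have e2 : (braidPart f U).val r = (U.comap (confProj _ 1 n)).val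
      (r.map ((finiteConf n (m + 2 + 1)).comp ⟨fun z => (f, z), by fun_prop⟩).continuous) :=
    braidPart_val f U hc r
  set Q := U.comap (confProj (m + 2 + 1) 1 n)
  let l := (q.cast rfl hyc.symm).trans
    (r.map ((finiteConf n (m + 2 + 1)).comp ⟨fun z => (f, z), by fun_prop⟩).continuous).symm
  have hl : Q.val l = U.val p * ((braidPart f U).val r)⁻¹ := by
    rw [Q.val_trans, Q.val_cast, e1, e2, Q.val_symm]
  obtain ⟨t, ht⟩ := exists_slide_path f U
  have e3 := val_loop_eq hn Q ((t.trans l).trans t.symm) f (by rw [affineCoord_baseConf])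
  refine ⟨_, _, (((t.trans l).trans t.symm).map (affineCoord n m).continuous), c, r, ?_⟩
  have e4 := val_inftyProj f U (((t.trans l).trans t.symm).map (affineCoord n m).continuous)
  rw [show (Q.comap (inftyConf n (m + 2))).val ((Path.refl f).prod
    (((t.trans l).trans t.symm).map (affineCoord n m).continuous)) = _ from e4,
    congrArg (slideGauge f U) (affineCoord_baseConf f), ← ht, Q.val_trans, Q.val_trans, Q.val_symm,
    mul_left_inj, mul_right_inj, hl] at e3
  rw [← e3]
  group

theorem closure_braidGen' (R : Set (FreeGroup (Fin m))) (g : PresentedGroup R) :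
    g ∈ Subgroup.closure (braidGen R '' {i | i + 1 < m + 1}) := by
  simpa only [Nat.add_lt_add_iff_right] using closure_braidGen R g

/-- The relators of the fundamental group of the configuration space. -/
def confRels (k : ℕ) : Set (FreeGroup (Fin k)) := ArtinRels k ∪ {sphereWord k, DeltaWord k ^ 2}

theorem asc_mul_desc_confRels (k : ℕ) :
    ascWord (braidGen (confRels k)) k * descWord (braidGen (confRels k)) k = 1 := by
  have h : sphereWord k ∈ confRels k := Or.inr (Or.inl rfl)
  have := PresentedGroup.one_of_mem h
  rwa [sphereWord_eq, map_mul, map_ascWord, map_descWord] at this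

theorem garside_confRels (k : ℕ) : garside (braidGen (confRels k)) k ^ 2 = 1 := by
  have h : DeltaWord k ^ 2 ∈ confRels k := Or.inr (Or.inr rfl)
  have := PresentedGroup.one_of_mem h
  rwa [map_pow, deltaWord_eq, map_garside] at this

theorem evalWord_confRels {a : ℕ → Γ} (ha : ArtinFam (k + 1) a)
    (h1 : garside a (k + 1) ^ 2 = 1) (h2 : garside a k ^ 2 = 1) {r : FreeGroup (Fin k)}
    (hr : r ∈ confRels k) : evalWord k a r = 1 := by
  rcases hr with hr | rfl | rfl
  · exact evalWord_artinRels ha hr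
  · rw [sphereWord_eq, map_mul, map_ascWord, map_descWord,
      ascWord_congr fun i hi => evalWord_br a hi, descWord_congr fun i hi => evalWord_br a hi]
    exact asc_mul_desc_eq_one ha h1 h2
  · rw [map_pow, deltaWord_eq, map_garside,
      garside_congr fun i hi => evalWord_br a (by omega : i < k)]
    exact h2

theorem exists_perm_hom (m : ℕ) : ∃ P : PresentedGroup (ArtinRels m) →* Equiv.Perm (Fin (m + 1)),
    (∀ i, i + 1 < m + 1 → P (braidGen (ArtinRels m) i) = adj (m + 1) i) ∧
      Function.Surjective P := by
  obtain ⟨P, hP⟩ := exists_presented_hom fun r hr => evalWord_artinRels (artinFam_adj) hr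
  refine ⟨P, fun i hi => hP i (by omega), fun u => ⟨posLift (braidGen (ArtinRels m)) u, ?_⟩⟩
  have hP' : ∀ i, i + 1 < m + 1 → P (braidGen (ArtinRels m) i) = adj (m + 1) i :=
    fun i hi => hP i (by omega)
  have hA : ArtinFam (m + 1) fun i => P (braidGen (ArtinRels m) i) := by
    have h := artinFam_braidGen (m := m) (R := ArtinRels m) subset_rfl
    refine ⟨fun i j hij hj => ?_, fun i hi => ?_⟩
    · rw [← map_mul, h.comm i j hij hj, map_mul]
    · rw [← map_mul, ← map_mul, h.braid i hi, map_mul, map_mul]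
  rw [posLift_map P hA, posLift_congr artinFam_adj hP', posLift_adj_self]

end Main

section Conclusion

variable {Γ : Type*} [Group Γ] {n m : ℕ}

theorem presented_surjective (hn : 2 ≤ n) {U : PathHom (Cconf (m + 2 + 1) 1 n) Γ}
    {f : frames (Fin (n + 1))}
    (hU : IsUniversalAt U (confProj (m + 2 + 1) 1 n
      (finiteConf n (m + 2 + 1) (f, baseConf (m + 2 + 1)))))
    (φ : PresentedGroup (confRels (m + 2)) →* Γ)
    (hφ : ∀ i < m + 2, φ (braidGen _ i) = genVal (braidPart f U) i) : Function.Surjective φ := by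
  have hW := isBraidHom_braidPart f U
  have hb := artinFam_braidGen (m := m + 2) (R := ArtinRels (m + 2)) subset_rfl
  have hb' := artinFam_braidGen (m := m + 1) (R := ArtinRels (m + 1)) subset_rfl
  have hs := artinFam_braidGen (m := m + 2) (R := confRels (m + 2)) subset_union_left
  obtain ⟨π, hπ⟩ := exists_presented_hom fun r hr => evalWord_artinRels hs hr
  obtain ⟨ι, hι⟩ := exists_presented_hom (m := m + 1) fun r hr => evalWord_artinRels
    (a := braidGen (confRels (m + 2))) ⟨fun i j hij hj => hs.comm i j hij (by omega),
      fun i hi => hs.braid i (by omega)⟩ hr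
  obtain ⟨Ψ, hΨ⟩ := exists_braidHom hb
  obtain ⟨Ψ', hΨ'⟩ := exists_braidHom hb'
  obtain ⟨P, hP, hPs⟩ := exists_perm_hom (m + 2)
  intro γ
  obtain ⟨a, b, p, c, q, rfl⟩ := exists_val_eq hn hU (fun ρ => by
    obtain ⟨g, hg⟩ := hPs ρ⁻¹
    obtain ⟨c, r, hc, -⟩ := exists_realization hΨ hb P hP (closure_braidGen' _ g)
    exact ⟨c, r, by rw [hc, hg, inv_inv]⟩) γ
  refine ⟨ι (Ψ'.val p) * π (Ψ.val q), ?_⟩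
  rw [map_mul, IsUniversalBraid.factor hΨ hW (φ.comp π) (fun i hi => ?_) q,
    IsUniversalBraid.factor hΨ' hW.comap_appendMap (φ.comp ι) (fun i hi => ?_) p]
  · rfl
  · rw [hW.genVal_comap_appendMap hi, ← hφ i (by omega), ← hι i (by omega)]
    rfl
  · rw [← hφ i (by omega), ← hπ i (by omega)]
    rfl

theorem presented_injective {U : PathHom (Cconf (m + 2 + 1) 1 n) Γ}
    {f : frames (Fin (n + 1))}
    (hU : IsUniversalAt U (confProj (m + 2 + 1) 1 n
      (finiteConf n (m + 2 + 1) (f, baseConf (m + 2 + 1)))))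
    (hU' : IsUniversalAt U (confProj (m + 2 + 1) 1 n (inftyConf n (m + 2) (f, baseConf (m + 2)))))
    (φ : PresentedGroup (confRels (m + 2)) →* Γ)
    (hφ : ∀ i < m + 2, φ (braidGen _ i) = genVal (braidPart f U) i) : Function.Injective φ := by
  have hW := isBraidHom_braidPart f U
  have hb := artinFam_braidGen (m := m + 2) (R := ArtinRels (m + 2)) subset_rfl
  have hb' := artinFam_braidGen (m := m + 1) (R := ArtinRels (m + 1)) subset_rfl
  have hs := artinFam_braidGen (m := m + 2) (R := confRels (m + 2)) subset_union_left
  obtain ⟨π, hπ⟩ := exists_presented_hom fun r hr => evalWord_artinRels hs hr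
  obtain ⟨ι, hι⟩ := exists_presented_hom (m := m + 1) fun r hr => evalWord_artinRels
    (a := braidGen (ArtinRels (m + 2))) ⟨fun i j hij hj => hb.comm i j hij (by omega),
      fun i hi => hb.braid i (by omega)⟩ hr
  obtain ⟨Ψ, hΨ⟩ := exists_braidHom hb
  obtain ⟨Ψ', hΨ'⟩ := exists_braidHom hb'
  obtain ⟨P, hP, -⟩ := exists_perm_hom (m + 2)
  obtain ⟨P', hP', -⟩ := exists_perm_hom (m + 1)
  rw [injective_iff_map_eq_one]
  intro g hg
  obtain ⟨h, hh, d, hd, rfl⟩ := exists_eq_mul_cosetRep hs (asc_mul_desc_confRels _)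
    (closure_braidGen _ g)
  obtain ⟨h₀, rfl⟩ : ∃ h₀, π (ι h₀) = h := by
    have hle : Subgroup.closure (braidGen (confRels (m + 2)) '' {i | i + 1 < m + 2}) ≤
        (π.comp ι).range := by
      rw [Subgroup.closure_le]
      rintro _ ⟨i, hi, rfl⟩
      have hi : i + 1 < m + 2 := hi
      exact ⟨braidGen _ i, by rw [MonoidHom.comp_apply, hι i (by omega), hπ i (by omega)]⟩
    exact hle hh
  have hcos : π (cosetRep (m + 2) (braidGen (ArtinRels (m + 2))) d) =
      cosetRep (m + 2) (braidGen (confRels (m + 2))) d := by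
    rw [map_cosetRep]
    exact cosetRep_congr (by omega) hπ d
  rw [← hcos, ← map_mul] at hg
  obtain ⟨c, γ, hc, hγ⟩ := exists_realization hΨ hb P hP
    (closure_braidGen' _ (ι h₀ * cosetRep (m + 2) (braidGen (ArtinRels (m + 2))) d))
  have hval : (braidPart f U).val γ = 1 := by
    rw [IsUniversalBraid.factor hΨ hW (φ.comp π) (fun i hi => ?_) γ, hγ]
    · exact hg
    · rw [← hφ i (by omega), ← hπ i (by omega)]
      rfl
  rw [braidPart_val f U hc γ] at hval
  -- the permutation of the realization is trivial, hence `d = 0`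
  obtain ⟨e, -⟩ := hU.null_lift
    (γ.map ((finiteConf n (m + 2 + 1)).comp ⟨fun z => (f, z), by fun_prop⟩).continuous)
    (by rw [hc]; exact (confProj_finiteConf_permuteLabels f _ _).symm) hval
  have hperm : P (ι h₀ * cosetRep (m + 2) (braidGen (ArtinRels (m + 2))) d) = 1 := by
    rw [hc] at e
    exact inv_eq_one.1 (eq_one_of_comp_eq (finiteConf n (m + 2 + 1) (f, baseConf _)).2.1
      (congrArg Subtype.val e))
  have hfix : P (ι h₀) (Fin.last (m + 2)) = Fin.last (m + 2) := by
    have hle : Subgroup.closure (braidGen (ArtinRels (m + 1)) '' {i | i < m + 1}) ≤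
        (MulAction.stabilizer (Equiv.Perm (Fin (m + 2 + 1))) (Fin.last (m + 2))).comap
          (P.comp ι) := by
      rw [Subgroup.closure_le]
      rintro _ ⟨i, hi, rfl⟩
      have hi : i < m + 1 := hi
      change P (ι _) (Fin.last _) = Fin.last _
      rw [hι i hi, hP i (by omega)]
      ext
      rw [adj_val (by omega)]
      simp only [Fin.val_last]
      split_ifs <;> omega
    exact hle (closure_braidGen _ h₀)
  have hd0 : d = 0 := by
    have h1 : P (cosetRep (m + 2) (braidGen (ArtinRels (m + 2))) d) =
        cosetRep (m + 2) (adj (m + 2 + 1)) d := by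
      rw [map_cosetRep]
      exact cosetRep_congr (by omega) (fun i hi => hP i (by omega)) d
    have h2 := Equiv.congr_fun hperm ⟨m + 2 - d, by omega⟩
    rw [map_mul, Equiv.Perm.mul_apply, h1, cosetRep_adj_apply hd, hfix] at h2
    have h3 := congrArg Fin.val h2
    simp at h3
    omega
  subst hd0
  rw [cosetRep, mul_one] at hg ⊢
  -- realize `h₀` by a plane braid, which is a power of the full twist
  obtain ⟨c', γ', hc', hγ'⟩ := exists_realization hΨ' hb' P' hP' (closure_braidGen' _ h₀)
  have hval' : ((braidPart f U).comap (appendMap (m + 2))).val γ' = 1 := by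
    rw [IsUniversalBraid.factor hΨ' hW.comap_appendMap (φ.comp (π.comp ι)) (fun i hi => ?_) γ', hγ']
    · exact hg
    · rw [hW.genVal_comap_appendMap hi, ← hφ i (by omega), ← hπ i (by omega), ← hι i (by omega)]
      rfl
  have hinf : (U.comap (inftyProj f)).val γ' = 1 := by
    rw [val_inftyProj, hval', hc', slideGauge_permuteLabels, mul_one, mul_inv_cancel]
  obtain ⟨e', hnull⟩ := hU'.null_lift
    (γ'.map ((inftyConf n (m + 2)).comp ⟨fun z => (f, z), by fun_prop⟩).continuous)
    (by rw [hc']; exact (confProj_inftyConf_permuteLabels f _ _).symm) hinf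
  have hcb : baseConf (m + 2) = c' := inftyConf_injective f e'
  subst hcb
  obtain ⟨l, hl⟩ := val_of_null (IsUniversalBraid.isBraidHom hΨ') f γ' hnull
  rw [← hγ', hl, map_zpow, map_zpow, map_pow, map_pow, map_garside, map_garside,
    garside_congr fun i hi => show π (ι (genVal Ψ' i)) = braidGen (confRels (m + 2)) i by
      rw [IsUniversalBraid.genVal_eq hΨ' hb' hi, hι i (by omega), hπ i (by omega)],
    garside_confRels, one_zpow]

end Conclusion

end Auxiliary

/-- For `k ≥ 3` and `n ≥ 2`, `π₁(C_{k+1}^{1,n})` is presented by generators `σ_1, …, σ_k`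
subject to the Artin relations, `σ_1⋯σ_{k-1}σ_k²σ_{k-1}⋯σ_1 = 1` and `Δ_k² = 1`. -/
theorem pi1_Cconf_one_n (k n : ℕ) (hk : 3 ≤ k) (hn : 2 ≤ n) (x : Cconf (k + 1) 1 n) :
    Nonempty (FundamentalGroup (Cconf (k + 1) 1 n) x ≃*
      PresentedGroup (ArtinRels k ∪ {sphereWord k, DeltaWord k ^ 2})) := by
  obtain ⟨m, rfl⟩ : ∃ m, k = m + 2 := ⟨k - 2, by omega⟩
  obtain ⟨y, rfl⟩ := confProj_surjective x
  obtain ⟨f, z, rfl⟩ := exists_eq_inftyConf' y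
  obtain ⟨U, hU⟩ := exists_isUniversalAt (confProj (m + 2 + 1) 1 n (inftyConf n (m + 2) (f, z)))
  obtain ⟨h1, h2⟩ := exists_isUniversalAt_base hU
  obtain ⟨r1, r2⟩ := braidPart_relations hn f U
  obtain ⟨φ, hφ⟩ := exists_presented_hom fun r hr =>
    evalWord_confRels (isBraidHom_braidPart f U).artinFam r1 r2 hr
  exact ⟨((MulEquiv.inv' _).trans (MulEquiv.ofBijective φ
    ⟨presented_injective h2 h1 φ hφ, presented_surjective hn h2 φ hφ⟩).symm)⟩
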